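/- Biedenharn–Elliot relation for the normalized q-Racah polynomials: for all nonnegative integers i, j, x, y with i+j ≤ N and x+y ≤ N, one has Σ_{a=0}^{min(N−j,N−y)} p_i(a;c₃,c₂,c₁;N−j)·p_j(y;c₁,c₀,c₄;N−a)·p_a(x;c₄,c₃,c₂;N−y)·(c₀/c₃)^{i/2}(c₃/c₁)^{j/2}(c₁/c₄)^{a/2}(c₄/c₂)^{y/2}(c₂/c₀)^{x/2}·ξ_i(c₁,c₂)·ξ_j(c₄,c₀)·ξ_a(c₂,c₃)·ξ_y(c₀,c₁)·ξ_x(c₃,c₄) = p_j(x;c₃,c₄,c₀;N−i)·p_i(y;c₀,c₁,c₂;N−x). -/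

import Mathlib

noncomputable section
namespace qR

/-- q-Pochhammer symbol `(a;q)_k = ∏_{l<k} (1 - a qˡ)`. -/
def poch (q a : ℂ) (k : ℕ) : ℂ := ∏ l ∈ Finset.range k, (1 - a * q ^ l)

/-- q-binomial coefficient, zero outside `0 ≤ n ≤ N`. -/
def binom (q : ℂ) (N n : ℤ) : ℂ :=
  if 0 ≤ n ∧ n ≤ N then poch q q N.toNat / (poch q q n.toNat * poch q q (N - n).toNat) else 0

/-- Normalisation `Ω(n;c1,c2,c3;N)`; `s` and `t2` are the chosen square roots of `q` and `c2`,
so that `(q c2)^(n - N/2) = (s t2)^(2n - N)`. -/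
def Om (q s c1 c2 c3 t2 : ℂ) (N n : ℤ) : ℂ :=
  binom q N n * (1 - c2 * c3 * q ^ (2 * n + 1)) * poch q (q * c2) n.toNat
      * poch q (c1 * c2 * c3 * q ^ (N + 2)) n.toNat * poch q (q * c1) (N - n).toNat
    / ((s * t2) ^ (2 * n - N) * poch q (c2 * c3 * q ^ (n + 1)) (N + 1).toNat
        * poch q (q * c3) n.toNat)

/-- Normalised q-Racah polynomial `p_n(x;c1,c2,c3;N)`, with the convention that it
vanishes unless `0 ≤ n ≤ N` and `0 ≤ x ≤ N`. -/
def p (q s c1 c2 c3 t2 : ℂ) (N n x : ℤ) : ℂ :=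
  if 0 ≤ n ∧ n ≤ N ∧ 0 ≤ x ∧ x ≤ N then
    Om q s c1 c2 c3 t2 N n *
      ∑ k ∈ Finset.range (n.toNat + 1),
        poch q (q ^ (-n)) k * poch q (c2 * c3 * q ^ (n + 1)) k * poch q (q ^ (-x)) k
            * poch q (c1 * c2 * q ^ (x + 1)) k * q ^ k
          / (poch q (q * c2) k * poch q (c1 * c2 * c3 * q ^ (N + 2)) k
              * poch q (q ^ (-N)) k * poch q q k)
  else 0

/-- `ω_n(c) = (-1)^n c^{n/2} q^{n(n+1)/2}`, where `r` is the chosen square root of `c`. -/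
def om (q r : ℂ) (n : ℤ) : ℂ := (-1 : ℂ) ^ n * r ^ n * q ^ (n * (n + 1) / 2)

/-- `ξ_n(c1,c2) = ((qc1;q)_n/(qc2;q)_n) (c2/c1)^{n/2}`, where `t1, t2` are the chosen
square roots of `c1, c2`. -/
def xi (q c1 c2 t1 t2 : ℂ) (n : ℤ) : ℂ :=
  poch q (q * c1) n.toNat / poch q (q * c2) n.toNat * (t2 / t1) ^ n

/-- `λ(x;c) = -(1-q^{-x})(1-c q^{x+1})`. -/
def lam (q c : ℂ) (x : ℤ) : ℂ := -(1 - q ^ (-x)) * (1 - c * q ^ (x + 1))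

def PhiP (q c1 c2 c3 : ℂ) (N n : ℤ) : ℂ :=
  -c2 * q ^ (n - N) * (1 - q ^ n) * (1 - c1 * q ^ (N - n + 1)) * (1 - c2 * c3 * q ^ (n + N + 1))
      * (1 - c3 * q ^ n)
    / ((1 - c2 * c3 * q ^ (2 * n)) * (1 - c2 * c3 * q ^ (2 * n + 1)))

def PhiM (q c1 c2 c3 : ℂ) (N n : ℤ) : ℂ :=
  (1 - q ^ (n - N)) * (1 - c1 * c2 * c3 * q ^ (n + N + 2)) * (1 - c2 * q ^ (n + 1))
      * (1 - c2 * c3 * q ^ (n + 1))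
    / ((1 - c2 * c3 * q ^ (2 * n + 1)) * (1 - c2 * c3 * q ^ (2 * n + 2)))

/-- `Φ^ε(n;c1,c2,c3;N)`, where `ε = 1, -1, 0` selects `Φ⁺, Φ⁻, Φ⁰`. -/
def Phi (q c1 c2 c3 : ℂ) (N ε n : ℤ) : ℂ :=
  if ε = 1 then PhiP q c1 c2 c3 N n
  else if ε = -1 then PhiM q c1 c2 c3 N n
  else -PhiP q c1 c2 c3 N n - PhiM q c1 c2 c3 N n

/-- `λ₊(x;c1,c2,c3;N)`. -/
def lamP (q c1 c2 c3 : ℂ) (N x : ℤ) : ℂ :=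
  -(q ^ (-N - 1) / c3 - q ^ (-x)) * (1 - c1 * c2 * c3 * q ^ (N + x + 2))

/-- `λ₋(x;c1,c2,c3;N)`. -/
def lamM (q c1 c2 c3 : ℂ) (N x : ℤ) : ℂ :=
  -(q ^ (-N) - q ^ (-x)) * (1 - c1 * c2 * q ^ (N + x + 1))

def PhiPp (q sq c1 c2 c3 : ℂ) (N n : ℤ) : ℂ :=
  -sq * c2 * q ^ (2 * n - N - 1) * (1 - q ^ n) * (1 - c1 * q ^ (N - n + 1))
      * (1 - c1 * q ^ (N + 2 - n)) * (1 - c3 * q ^ n)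
    / ((1 - c2 * c3 * q ^ (2 * n)) * (1 - c2 * c3 * q ^ (2 * n + 1)))

def PhiPm (q sq c1 c2 c3 : ℂ) (N n : ℤ) : ℂ :=
  -((1 - c1 * c2 * c3 * q ^ (n + N + 2)) * (1 - c1 * c2 * c3 * q ^ (n + N + 3))
      * (1 - c2 * q ^ (n + 1)) * (1 - c2 * c3 * q ^ (n + 1)))
    / (c3 * q ^ (N + 1) * sq * (1 - c2 * c3 * q ^ (2 * n + 1)) * (1 - c2 * c3 * q ^ (2 * n + 2)))

def PhiP0 (q sq c1 c2 c3 : ℂ) (N n : ℤ) : ℂ :=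
  -PhiPp q sq c1 c2 c3 N n - PhiPm q sq c1 c2 c3 N n
    - (1 - c1 * c2 * q ^ (N + 2)) * (1 - c1 * c2 * c3 * q ^ (N + 2)) / (c3 * q ^ (N + 1) * sq)

def PhiMp (q sq c1 c2 c3 : ℂ) (N n : ℤ) : ℂ :=
  -sq * (1 - q ^ n) * (1 - c3 * q ^ n) * (1 - c2 * c3 * q ^ (n + N))
      * (1 - c2 * c3 * q ^ (n + N + 1))
    / (q ^ N * (1 - c2 * c3 * q ^ (2 * n)) * (1 - c2 * c3 * q ^ (2 * n + 1)))

def PhiMm (q sq c1 c2 c3 : ℂ) (N n : ℤ) : ℂ :=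
  -c3 * sq * q ^ N * (1 - q ^ (n - N)) * (1 - q ^ (n - N + 1)) * (1 - c2 * q ^ (n + 1))
      * (1 - c2 * c3 * q ^ (n + 1))
    / ((1 - c2 * c3 * q ^ (2 * n + 1)) * (1 - c2 * c3 * q ^ (2 * n + 2)))

def PhiM0 (q sq c1 c2 c3 : ℂ) (N n : ℤ) : ℂ :=
  -PhiMp q sq c1 c2 c3 N n - PhiMm q sq c1 c2 c3 N n - sq * (1 - c3 * q ^ N) * (q ^ (-N) - 1)

/-- Contiguity coefficient `Φ_σ^ε(n;c1,c2,c3;N)`, where `σ = 1` is the `+` and `σ = -1`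
the `-` family, `ε ∈ {1,0,-1}` selects the superscript, and `sq` is the chosen square
root of `q c2`. -/
def PhiC (q sq c1 c2 c3 : ℂ) (σ ε N n : ℤ) : ℂ :=
  if σ = 1 then
    if ε = 1 then PhiPp q sq c1 c2 c3 N n
    else if ε = -1 then PhiPm q sq c1 c2 c3 N n
    else PhiP0 q sq c1 c2 c3 N n
  else
    if ε = 1 then PhiMp q sq c1 c2 c3 N n
    else if ε = -1 then PhiMm q sq c1 c2 c3 N n
    else PhiM0 q sq c1 c2 c3 N n

def Fp (q c1 c2 : ℂ) (x : ℤ) : ℂ :=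
  c1 * c2 ^ 2 * q ^ (x + 1) * (1 - c1 * q ^ x) * (1 - q ^ x)
    / ((1 - c1 * c2 * q ^ (2 * x)) * (1 - c1 * c2 * q ^ (2 * x + 1)))

def Fm (q c1 c2 : ℂ) (x : ℤ) : ℂ :=
  c1 * c2 * q ^ (x + 1) * (1 - c2 * q ^ (x + 1)) * (1 - c1 * c2 * q ^ (x + 1))
    / ((1 - c1 * c2 * q ^ (2 * x + 1)) * (1 - c1 * c2 * q ^ (2 * x + 2)))

/-- The coefficients `A^{ε,ε'}_{i,j}(c1,c2,c3,c4;N)` for `(ε,ε') ≠ (0,0)`;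
`t2` is the chosen square root of `c2` and the fifth parameter
`c0 = (q^{2N+3} c1 c2 c3 c4)⁻¹` is computed internally. -/
def Aaux (q s c1 c2 c3 c4 t2 : ℂ) (N ε ε' i j : ℤ) : ℂ :=
  if ε' = 1 ∨ ε' = -1 then
    -c3 * q ^ (N + 1) *
        (if ε' = 1 then Fp q c4 ((q ^ (2 * N + 3) * c1 * c2 * c3 * c4)⁻¹) j
         else Fm q c4 ((q ^ (2 * N + 3) * c1 * c2 * c3 * c4)⁻¹) j) *
        PhiC q (s * t2) c1 c2 c3 ε' ε (N - j) i
  else if ε = 1 ∨ ε = -1 then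
    c3 * q ^ (N + 1) *
        (Fp q c4 ((q ^ (2 * N + 3) * c1 * c2 * c3 * c4)⁻¹) j
          + Fm q c4 ((q ^ (2 * N + 3) * c1 * c2 * c3 * c4)⁻¹) j) *
        Phi q c1 c2 c3 (N - j) ε i
  else 0

/-- The coefficients `A^{ε,ε'}_{i,j}(c1,c2,c3,c4;N)`. -/
def A (q s c1 c2 c3 c4 t2 : ℂ) (N ε ε' i j : ℤ) : ℂ :=
  if ε = 0 ∧ ε' = 0 then
    -((1 - c3 * q ^ (N + 1 - j)) * (s * t2) / (1 - c1 * c2 * q ^ (N + 2 - j)))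
          * ∑ e ∈ ({-1, 0, 1} : Finset ℤ), Aaux q s c1 c2 c3 c4 t2 N e 1 i j
      - (1 - c1 * c2 * q ^ (N + 1 - j)) / ((1 - c3 * q ^ (N - j)) * (s * t2))
          * ∑ e ∈ ({-1, 0, 1} : Finset ℤ), Aaux q s c1 c2 c3 c4 t2 N e (-1) i j
      - ∑ e ∈ ({-1, 1} : Finset ℤ), Aaux q s c1 c2 c3 c4 t2 N e 0 i j
  else Aaux q s c1 c2 c3 c4 t2 N ε ε' i j

/-- `Λ(x;c1,c2,c3,c4;N)`; `s, t1, t2, t3, t4` are the chosen square roots of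
`q, c1, c2, c3, c4`. -/
def Lam (q s c1 c2 c3 c4 t1 t2 t3 t4 : ℂ) (N x : ℤ) : ℂ :=
  (-1 : ℂ) ^ x * binom q N x * (1 - c1 * c2 * q ^ (2 * x + 1)) * poch q (q * c2) x.toNat
      * (s * t2) ^ N * (t1 * t3 / (t2 * t4)) ^ x * q ^ (x * (x - 1) / 2)
    / (poch q (q * c1) x.toNat * poch q (q ^ (x + 1) * c1 * c2) (N + 1).toNat)

/-- Tratnik polynomial of q-Racah type `T_{i,j}(x,y;c1,c2,c3,c4;N)`; the fifth parameter
`c0 = (q^{2N+3} c1 c2 c3 c4)⁻¹` and its square root `t0 = (s^{2N+3} t1 t2 t3 t4)⁻¹`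
are computed internally. -/
def T (q s c1 c2 c3 c4 t1 t2 t3 t4 : ℂ) (N i j x y : ℤ) : ℂ :=
  if 0 ≤ i ∧ 0 ≤ j ∧ i + j ≤ N then
    p q s c1 c2 c3 t2 (N - j) i x *
      p q s c3 ((q ^ (2 * N + 3) * c1 * c2 * c3 * c4)⁻¹) c4
        ((s ^ (2 * N + 3) * t1 * t2 * t3 * t4)⁻¹) (N - x) j y
  else 0

/-- Griffiths polynomial of q-Racah type `G_{i,j}(x,y;c1,c2,c3,c4;N)`; the fifth parameter
`c0 = (q^{2N+3} c1 c2 c3 c4)⁻¹` and its square root `t0 = (s^{2N+3} t1 t2 t3 t4)⁻¹`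
are computed internally. -/
def G (q s c1 c2 c3 c4 t1 t2 t3 t4 : ℂ) (N i j x y : ℤ) : ℂ :=
  if 0 ≤ i ∧ 0 ≤ j ∧ i + j ≤ N then
    ∑ a ∈ Finset.range ((min (N - j) (N - y)).toNat + 1),
      om q (t1 * t2 * t3 / t4) (a : ℤ) * p q s c1 c2 c3 t2 (N - j) i (a : ℤ) *
        p q s c3 ((q ^ (2 * N + 3) * c1 * c2 * c3 * c4)⁻¹) c4
          ((s ^ (2 * N + 3) * t1 * t2 * t3 * t4)⁻¹) (N - (a : ℤ)) j y *
        p q s c4 c2 c1 t2 (N - y) (a : ℤ) x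
  else 0

end qR

namespace BE
open qR Finset

lemma poch_zero' (q a : ℂ) : poch q a 0 = 1 := by simp [poch]

lemma poch_succ (q a : ℂ) (k : ℕ) : poch q a (k+1) = poch q a k * (1 - a * q^k) := by
  simp [poch, prod_range_succ]

lemma poch_succ' (q a : ℂ) (k : ℕ) : poch q a (k+1) = (1 - a) * poch q (a*q) k := by
  simp only [poch, prod_range_succ']
  rw [mul_comm]
  congr 1
  · simp
  · apply prod_congr rfl; intros; ring

lemma poch_shift (q a : ℂ) (k : ℕ) : (1 - a) * poch q (a*q) k = poch q a k * (1 - a * q^k) := by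
  rw [← poch_succ, poch_succ']

lemma poch_ne (q a : ℂ) (k : ℕ) (h : ∀ l, l < k → a * q^l ≠ 1) : poch q a k ≠ 0 := by
  rw [poch, prod_ne_zero_iff]
  intro l hl
  have := h l (mem_range.1 hl)
  intro h0
  exact this (by linear_combination -h0)

lemma poch_van (q : ℂ) (hq : q ≠ 0) (n k : ℕ) (h : n < k) : poch q ((q^n)⁻¹) k = 0 := by
  rw [poch, prod_eq_zero_iff]
  exact ⟨n, mem_range.2 h, by rw [inv_mul_cancel₀ (pow_ne_zero _ hq)]; ring⟩

def t (q A B X Y d e f : ℂ) (k : ℕ) : ℂ :=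
  poch q A k * poch q B k * poch q X k * poch q Y k * q^k
    / (poch q d k * poch q e k * poch q f k * poch q q k)

lemma R1 (q A B X Y d e f : ℂ) (k : ℕ) (h0 : d ≠ 1) (h1 : d * q^k ≠ 1)  :
    (1-d)*(X-Y) * t q A B X Y d e f k
      = (1-Y)*(X-d) * t q A B X (Y*q) (d*q) e f k - (1-X)*(Y-d) * t q A B (X*q) Y (d*q) e f k := by
  have e1 := poch_shift q X k
  have e2 := poch_shift q Y k
  have e3 := poch_shift q d k
  have h0' : 1 - d ≠ 0 := by intro h; exact h0 (by linear_combination -h)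
  have h1' : 1 - d*q^k ≠ 0 := by intro h; exact h1 (by linear_combination -h)
  have e4 : poch q (d*q) k = poch q d k * (1 - d*q^k) / (1-d) := by
    field_simp; linear_combination e3
  unfold t
  rw [e4]
  have key : (1-Y)*(X-d) * (poch q A k * poch q B k * poch q X k * poch q (Y*q) k * q^k)
     - (1-X)*(Y-d)*(poch q A k * poch q B k * poch q (X*q) k * poch q Y k * q^k)
     = (X-Y) * (1-d*q^k) * (poch q A k * poch q B k * poch q X k * poch q Y k * q^k) := by
    linear_combination (X-d) * (poch q A k * poch q B k * poch q X k * q^k) * e2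
      - (Y-d) * (poch q A k * poch q B k * poch q Y k * q^k) * e1
  rw [mul_div_assoc', mul_div_assoc', mul_div_assoc', div_sub_div_same, key]
  have e5 : poch q d k * (1 - d*q^k) / (1-d) * poch q e k * poch q f k * poch q q k
     = (1-d*q^k)/(1-d) * (poch q d k * poch q e k * poch q f k * poch q q k) := by ring
  rw [e5, mul_comm ((1 - d * q ^ k) / (1 - d)), ← div_div]
  field_simp

lemma aux2 (S u PA PB PX PY Pd Pe Pf Pq a b x y d e f g Q h : ℂ) (_ : Pd ≠ 0) (_ : Pe ≠ 0) (_ : Pf ≠ 0)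
    (_ : Pq ≠ 0) (_ : d ≠ 0) (_ : e ≠ 0) (_ : f ≠ 0) (_ : g ≠ 0) (_ : Q ≠ 0) :
    -(S * u) * (PA*a*(PB*b)*(PX*x)*(PY*y)*Q/(Pd*d*(Pe*e)*(Pf*f)*(Pq*g))) * h * g / Q
      = PA*PB*PX*PY*u/(Pd*Pe*Pf*Pq) * (-S*a*b*x*y*h/(d*e*f)) := by
  field_simp

lemma aux3 (U K n D r : ℂ) (h : D ≠ 0) : (U + K * (n / D - r)) * D = (U - K*r)*D + K*n := by
  field_simp
  ring

/-- partial sums for the forward relation -/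
lemma R3 (q A B X Y d e f : ℂ) (hq : q ≠ 0) (hX : X ≠ 0) (hY : Y ≠ 0) (hXY : X ≠ Y)
    (hbal : d*e*f = q*A*B*X*Y) (m : ℕ)
    (hd : ∀ l, l < m → d*q^l ≠ 1) (he : ∀ l, l < m → e*q^l ≠ 1)
    (hf : ∀ l, l < m → f*q^l ≠ 1) (hqq : ∀ l, 1 ≤ l → l ≤ m → q^l ≠ 1) :
    (1-A)*(1-B)*∑ k ∈ range m, (Y*(1-Y)*((X-d)*(X-e)*(X-f)) * t q (A*q) (B*q) X (Y*q) (d*q) (e*q) (f*q) k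
      - X*(1-X)*((Y-d)*(Y-e)*(Y-f)) * t q (A*q) (B*q) (X*q) Y (d*q) (e*q) (f*q) k
      - X*Y*(X-Y)*((1-d)*(1-e)*(1-f)) * t q A B X Y d e f k)
     = - (X*Y*(X-Y)*((1-d)*(1-e)*(1-f))) * t q A B X Y d e f m * (1 - A*B*q^m)*(1-q^m)/q^m := by
  induction m with
  | zero => simp
  | succ k ih =>
    rw [sum_range_succ, mul_add, ih (fun l hl => hd l (by omega)) (fun l hl => he l (by omega))
      (fun l hl => hf l (by omega)) (fun l h1 h2 => hqq l h1 (by omega))]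
    have s (a : ℂ) := poch_shift q a k
    have n1 : ∀ a : ℂ, a ≠ 1 → 1 - a ≠ 0 := fun a h h' => h (by linear_combination -h')
    have d0 := n1 d (by simpa using hd 0 (by omega))
    have e0 := n1 e (by simpa using he 0 (by omega))
    have f0 := n1 f (by simpa using hf 0 (by omega))
    have dk := n1 _ (hd k (by omega))
    have ek := n1 _ (he k (by omega))
    have fk := n1 _ (hf k (by omega))
    have qk := n1 _ (hqq (k+1) (by omega) (by omega))
    have pd := poch_ne q d k (fun l hl => hd l (by omega))
    have pe := poch_ne q e k (fun l hl => he l (by omega))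
    have pf := poch_ne q f k (fun l hl => hf l (by omega))
    have pq := poch_ne q q k (fun l hl => by
      have := hqq (l+1) (by omega) (by omega); rwa [pow_succ'] at this)
    have E (a : ℂ) (h : 1 - a ≠ 0) : poch q (a*q) k = poch q a k * (1 - a*q^k) / (1-a) := by
      field_simp; linear_combination s a
    unfold t
    rw [E d d0, E e e0, E f f0]
    simp only [poch_succ]
    have qk' : 1 - q*q^k ≠ 0 := by rwa [pow_succ'] at qk
    have key : (1-A)*(1-B)*(Y*(1-Y)*((X-d)*(X-e)*(X-f)) * (poch q (A*q) k*poch q (B*q) k*poch q X k*poch q (Y*q) k)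
       - X*(1-X)*((Y-d)*(Y-e)*(Y-f)) * (poch q (A*q) k*poch q (B*q) k*poch q (X*q) k*poch q Y k))
       = poch q A k * poch q B k * poch q X k * poch q Y k * (1-A*q^k)*(1-B*q^k)*
         (Y*((X-d)*(X-e)*(X-f))*(1-Y*q^k) - X*((Y-d)*(Y-e)*(Y-f))*(1-X*q^k)) := by
      calc _ = ((1-A)*poch q (A*q) k) * ((1-B)*poch q (B*q) k) *
            (Y*((X-d)*(X-e)*(X-f))*((1-Y)*poch q (Y*q) k)*poch q X k
              - X*((Y-d)*(Y-e)*(Y-f))*((1-X)*poch q (X*q) k)*poch q Y k) := by ring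
        _ = _ := by rw [s A, s B, s X, s Y]; ring
    generalize poch q (A*q) k = PAq at *
    generalize poch q (B*q) k = PBq at *
    generalize poch q (X*q) k = PXq at *
    generalize poch q (Y*q) k = PYq at *
    clear s E ih hd he hf hqq
    generalize poch q A k = PA at *
    generalize poch q B k = PB at *
    generalize poch q X k = PX at *
    generalize poch q Y k = PY at *
    generalize poch q d k = Pd at *
    generalize poch q e k = Pe at *
    generalize poch q f k = Pf at *
    generalize poch q q k = Pq at *
    have hK : q^k ≠ 0 := pow_ne_zero _ hq
    rw [pow_succ'] at *
    generalize q^k = K at *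
    have lhs2 : (1-A)*(1-B)*(Y*(1-Y)*((X-d)*(X-e)*(X-f)) * (PAq*PBq*PX*PYq*K/(Pd*(1-d*K)/(1-d)*(Pe*(1-e*K)/(1-e))*(Pf*(1-f*K)/(1-f))*Pq))
       - X*(1-X)*((Y-d)*(Y-e)*(Y-f)) * (PAq*PBq*PXq*PY*K/(Pd*(1-d*K)/(1-d)*(Pe*(1-e*K)/(1-e))*(Pf*(1-f*K)/(1-f))*Pq))
       - X*Y*(X-Y)*((1-d)*(1-e)*(1-f)) * (PA*PB*PX*PY*K/(Pd*Pe*Pf*Pq)))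
      = PA*PB*PX*PY*((1-d)*(1-e)*(1-f))/(Pd*Pe*Pf*Pq) * K *
        ((1-A*K)*(1-B*K)*(Y*((X-d)*(X-e)*(X-f))*(1-Y*K) - X*((Y-d)*(Y-e)*(Y-f))*(1-X*K))/((1-d*K)*(1-e*K)*(1-f*K))
         - (1-A)*(1-B)*X*Y*(X-Y)) := by
      field_simp
      linear_combination key
    rw [lhs2]
    have fin : (- (X*Y*(X-Y)))*(1-A*K)*(1-B*K)*(1-X*K)*(1-Y*K)*(1-A*B*(q*K))
       = ((- (X*Y*(X-Y)))*(1-A*B*K)*(1-K)/1 - K*(1-A)*(1-B)*X*Y*(X-Y)) * ((1-d*K)*(1-e*K)*(1-f*K))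
        + K*((1-A*K)*(1-B*K)*(Y*((X-d)*(X-e)*(X-f))*(1-Y*K) - X*((Y-d)*(Y-e)*(Y-f))*(1-X*K))) := by
      linear_combination (-(X-Y)*(1-A*K)*(1-B*K)*(1-X*K)*(1-Y*K)*K) * hbal
    have a1 : -(X * Y * (X - Y) * ((1 - d) * (1 - e) * (1 - f))) * (PA * PB * PX * PY * K / (Pd * Pe * Pf * Pq)) *
            (1 - A * B * K) * (1 - K) / K = PA*PB*PX*PY*((1-d)*(1-e)*(1-f))/(Pd*Pe*Pf*Pq) *
            (-(X*Y*(X-Y))*(1-A*B*K)*(1-K)) := by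
      field_simp
    have a2 : -(X * Y * (X - Y) * ((1 - d) * (1 - e) * (1 - f))) *
              (PA * (1 - A * K) * (PB * (1 - B * K)) * (PX * (1 - X * K)) * (PY * (1 - Y * K)) * (q * K) /
                (Pd * (1 - d * K) * (Pe * (1 - e * K)) * (Pf * (1 - f * K)) * (Pq * (1 - q * K)))) *
            (1 - A * B * (q * K)) * (1 - q * K) / (q * K) = PA*PB*PX*PY*((1-d)*(1-e)*(1-f))/(Pd*Pe*Pf*Pq) *
            (-(X*Y*(X-Y))*(1-A*K)*(1-B*K)*(1-X*K)*(1-Y*K)*(1-A*B*(q*K))/((1-d*K)*(1-e*K)*(1-f*K))) := by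
      exact aux2 _ _ _ _ _ _ _ _ _ _ _ _ _ _ _ _ _ _ _ _ pd pe pf pq dk ek fk qk' (mul_ne_zero hq hK)
    rw [a1, a2, mul_assoc _ K, ← mul_add]
    congr 1
    rw [eq_div_iff (mul_ne_zero (mul_ne_zero dk ek) fk), aux3 _ _ _ _ _ (mul_ne_zero (mul_ne_zero dk ek) fk)]
    linear_combination -fin

end BE

namespace BE
open qR Finset

lemma aux4 (T C D1 D2 D3 a b x y d e f g u v w p1 p2 p3 K q : ℂ) (_ : d ≠ 0) (_ : e ≠ 0)
    (_ : f ≠ 0) (_ : g ≠ 0) (_ : D1 ≠ 0) (_ : K ≠ 0) (_ : q ≠ 0)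
    (h : C*(d*e*f*g) + (D2*(a*v*p1 - u*b*p2)*d/D1 - D3 * a*b)*(q*K) = C*(a*b)*p3*w) :
    C * T * x * y
      + (D2 * p1 * (T*(a*v)*(x*y)*(q*K)/(D1*e*f*g)) - D2 * p2*(T*(u*b)*(x*y)*(q*K)/(D1*e*f*g))
        - D3 * (T*(a*b)*(x*y)*(q*K)/(d*e*f*g))) = C * (T*(a*b)*(x*y)*(q*K)/(d*e*f*g)) / (q*K) * p3 * w := by
  have : C * T * x * y
      + (D2 * p1 * (T*(a*v)*(x*y)*(q*K)/(D1*e*f*g)) - D2 * p2*(T*(u*b)*(x*y)*(q*K)/(D1*e*f*g))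
        - D3 * (T*(a*b)*(x*y)*(q*K)/(d*e*f*g)))
      = T*x*y/(d*e*f*g) * (C*(d*e*f*g) + (D2*(a*v*p1 - u*b*p2)*d/D1 - D3 * a*b)*(q*K)) := by
    field_simp
  rw [this, h]
  field_simp

lemma R2 (q A B X Y d e f : ℂ) (hq : q ≠ 0)
    (hbal : d*e*f = q^2*A*B*X*Y) (m : ℕ)
    (hd : ∀ l, l < m+1 → d*q^l ≠ 1) (he : ∀ l, l < m → e*q^l ≠ 1)
    (hf : ∀ l, l < m → f*q^l ≠ 1) (hqq : ∀ l, 1 ≤ l → l ≤ m → q^l ≠ 1) :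
    ∑ k ∈ range (m+1), (d*(d-1)*(A*(B*q-e)*(B*q-f)) * t q (A*q) B X Y d e f k
      - d*(d-1)*(B*(A*q-e)*(A*q-f)) * t q A (B*q) X Y d e f k
      - (d-X)*(d-Y)*q^2*A*B*(B-A) * t q (A*q) (B*q) X Y (d*q) e f k)
     = -(d*q^2*A*B*(B-A)) * t q (A*q) (B*q) X Y (d*q) e f m /q^m * (1 - X*q^m) * (1-Y*q^m) := by
  induction m with
  | zero =>
    simp [t, poch_zero']
    linear_combination (d-1)*(-(B-A)) * hbal
  | succ k ih =>
    rw [sum_range_succ, ih (fun l hl => hd l (by omega)) (fun l hl => he l (by omega))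
      (fun l hl => hf l (by omega)) (fun l h1 h2 => hqq l h1 (by omega))]
    have n1 : ∀ a : ℂ, a ≠ 1 → 1 - a ≠ 0 := fun a h h' => h (by linear_combination -h')
    have d0 := n1 d (by simpa using hd 0 (by omega))
    have dk := n1 _ (hd (k+1) (by omega))
    have ek := n1 _ (he k (by omega))
    have fk := n1 _ (hf k (by omega))
    have qk := n1 _ (hqq (k+1) (by omega) (by omega))
    have qk' : 1 - q*q^k ≠ 0 := by rwa [pow_succ'] at qk
    have dk' : 1 - d*q*q^k ≠ 0 := by rwa [pow_succ', ← mul_assoc] at dk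
    have hK : q^k ≠ 0 := pow_ne_zero _ hq
    have e1 : ∀ a b c d' e' f' : ℂ, a * q^k / (c*d'*e'*f') = a / (c*d'*e'*f') * q^k := by
      intros; ring
    set T := poch q (A*q) k * poch q (B*q) k * poch q X k * poch q Y k /
      (poch q (d*q) k * poch q e k * poch q f k * poch q q k) with hT
    have t0 : t q (A*q) (B*q) X Y (d*q) e f k = T * q^k := by rw [hT, t]; ring
    have t1 : t q (A*q) B X Y d e f (k+1) = T*((1-A*q*q^k)*(1-B))*((1-X*q^k)*(1-Y*q^k))*(q*q^k)/((1-d)*(1-e*q^k)*(1-f*q^k)*(1-q*q^k)) := by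
      rw [t, poch_succ, poch_succ' q B, poch_succ q X, poch_succ q Y, poch_succ' q d, poch_succ q e, poch_succ q f, poch_succ q q, hT, pow_succ']
      simp only [div_eq_mul_inv, mul_inv]; ring
    have t2 : t q A (B*q) X Y d e f (k+1) = T*((1-A)*(1-B*q*q^k))*((1-X*q^k)*(1-Y*q^k))*(q*q^k)/((1-d)*(1-e*q^k)*(1-f*q^k)*(1-q*q^k)) := by
      rw [t, poch_succ' q A, poch_succ q (B*q), poch_succ q X, poch_succ q Y, poch_succ' q d, poch_succ q e, poch_succ q f, poch_succ q q, hT, pow_succ']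
      simp only [div_eq_mul_inv, mul_inv]; ring
    have t3 : t q (A*q) (B*q) X Y (d*q) e f (k+1) = T*((1-A*q*q^k)*(1-B*q*q^k))*((1-X*q^k)*(1-Y*q^k))*(q*q^k)/((1-d*q*q^k)*(1-e*q^k)*(1-f*q^k)*(1-q*q^k)) := by
      rw [t, poch_succ q (A*q), poch_succ q (B*q), poch_succ q X, poch_succ q Y, poch_succ q (d*q), poch_succ q e, poch_succ q f, poch_succ q q, hT, pow_succ']
      simp only [div_eq_mul_inv, mul_inv]; ring
    rw [t0, t1, t2, t3, pow_succ' q k]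
    clear_value T
    clear t0 t1 t2 t3 e1 hd he hf hqq ih dk qk
    generalize q^k = K at *
    have a0 : -(d*q^2*A*B*(B-A)) * (T*K)/K*(1-X*K)*(1-Y*K) = -(d*q^2*A*B*(B-A)) * T*(1-X*K)*(1-Y*K) := by
      field_simp
    rw [a0]
    have := aux4 T (-(d*q^2*A*B*(B-A))) (1-d) (d*(d-1)) ((d-X)*(d-Y)*q^2*A*B*(B-A))
      (1-A*q*K) (1-B*q*K) (1-X*K) (1-Y*K) (1-d*q*K) (1-e*K) (1-f*K) (1-q*K) (1-A) (1-B) (1-Y*(q*K))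
      (A*(B*q-e)*(B*q-f)) (B*(A*q-e)*(A*q-f)) (1-X*(q*K)) K q dk' ek fk qk' d0 hK hq (by
        have : (d * (d - 1) * ((1 - A * q * K) * (1 - B) * (A * (B * q - e) * (B * q - f)) - (1 - A) * (1 - B * q * K) * (B * (A * q - e) * (A * q - f))) * (1 - d * q * K) / (1 - d)) = -(d  * ((1 - A * q * K) * (1 - B) * (A * (B * q - e) * (B * q - f)) - (1 - A) * (1 - B * q * K) * (B * (A * q - e) * (A * q - f))) * (1 - d * q * K)) := by
          rw [div_eq_iff d0]; ring
        rw [this]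
        linear_combination (-(B-A)*(1-A*q*K)*(1-B*q*K)*(d*q^2*K^2-q*K)) * hbal)
    exact this
end BE

namespace BE
open qR Finset

def S (q c : ℂ) (K : ℕ) : Prop := ∀ k, 1 ≤ k → k ≤ K → c * q^k ≠ 1

lemma S.ne {q c : ℂ} {K : ℕ} (h : S q c K) (k : ℕ) (h1 : 1 ≤ k) (h2 : k ≤ K) : 1 - c * q^k ≠ 0 :=
  fun h' => h k h1 h2 (by linear_combination -h')

lemma S.mono {q c : ℂ} {K K' : ℕ} (h : S q c K) (h' : K' ≤ K) : S q c K' :=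
  fun k h1 h2 => h k h1 (by omega)

def F (q a b c : ℂ) (N n x : ℕ) : ℂ :=
  ∑ k ∈ range (n+1), t q (q^n)⁻¹ (b*c*q^(n+1)) (q^x)⁻¹ (a*b*q^(x+1)) (q*b) (a*b*c*q^(N+2)) (q^N)⁻¹ k

lemma t_van1 (q B X Y d e f : ℂ) (hq : q ≠ 0) (n k : ℕ) (h : n < k) : t q (q^n)⁻¹ B X Y d e f k = 0 := by
  simp [t, poch_van q hq n k h]

lemma t_van2 (q A B Y d e f : ℂ) (hq : q ≠ 0) (n k : ℕ) (h : n < k) : t q A B (q^n)⁻¹ Y d e f k = 0 := by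
  simp [t, poch_van q hq n k h]

lemma F_eq (q a b c : ℂ) (hq : q ≠ 0) (N n x m : ℕ) (h : n ≤ m ∨ x ≤ m) : F q a b c N n x =
  ∑ k ∈ range (m+1), t q (q^n)⁻¹ (b*c*q^(n+1)) (q^x)⁻¹ (a*b*q^(x+1)) (q*b) (a*b*c*q^(N+2)) (q^N)⁻¹ k := by
  unfold F
  rcases le_total n m with h1 | h1
  · apply sum_subset (range_mono (by omega))
    intro k _ hk
    exact t_van1 _ _ _ _ _ _ _ hq _ _ (by simp at hk; omega)
  · symm
    apply sum_subset (range_mono (by omega))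
    intro k _ hk
    rcases h with h | h
    · exact t_van1 _ _ _ _ _ _ _ hq _ _ (by simp at hk; omega)
    · exact t_van2 _ _ _ _ _ _ _ hq _ _ (by simp at hk; omega)

lemma F_symm (q a b c : ℂ) (hq : q ≠ 0) (N n x : ℕ) : F q a b c N n x = F q c b a N x n := by
  rw [F_eq q a b c hq N n x (max n x) (by simp), F_eq q c b a hq N x n (max n x) (by simp)]
  apply sum_congr rfl
  intro k _
  unfold t
  rw [mul_comm c b, mul_comm b a, show b*c*a = a*b*c by ring]
  ring

lemma F_zero (q a b c : ℂ) (N x : ℕ) : F q a b c N 0 x = 1 := by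
  simp [F, t, poch_zero']

lemma pinv (q : ℂ) (hq : q ≠ 0) (n : ℕ) : (q^(n+1))⁻¹ * q = (q^n)⁻¹ := by
  rw [pow_succ]; field_simp

lemma pinv_ne (q : ℂ) (hq : q ≠ 0) (N l : ℕ) (h1 : S q 1 (N+1)) (hl : l ≤ N) : (q^(N+1))⁻¹ * q^l ≠ 1 := by
  intro h
  refine h1 (N+1-l) (by omega) (by omega) ?_
  rw [one_mul]; rw [inv_mul_eq_one₀ (by positivity)] at h
  have : q^(N+1) = q^(N+1-l)*q^l := by rw [← pow_add]; congr 1; omega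
  rw [h] at this
  exact (mul_right_cancel₀ (pow_ne_zero l hq) (by rw [one_mul, ← this]))

lemma aux5 (A' B' u v Q P1 P2 S F0 T : ℂ) (hA : A' ≠ 0) (hB : B' ≠ 0) (hm : u*v/Q = -(A'*B'))
    (r : A'*B'*(P1 - P2 - S*(F0-T)) = -S*T*u*v/Q) : P1 - P2 - S * F0 = 0 := by
  have : A'*B'*(P1-P2-S*F0) = 0 := by
    have e : -S*T*u*v/Q = -S*T*(u*v/Q) := by ring
    rw [e, hm] at r
    linear_combination r
  simpa [hA, hB] using this

lemma FT1 (q a b c : ℂ) (N n x : ℕ) (hq : q ≠ 0) (ha : a ≠ 0) (hb : b ≠ 0) (hn : n ≤ N)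
    (h1 : S q 1 (N+1)) (hd : S q b (N+1)) (he : S q (a*b*c) (2*N+3))
    (hB : b*c*q^(n+2) ≠ 1) (hXY : a*b*q^(2*x+1) ≠ 1) :
    (1-q*b)*(1-a*b*c*q^(N+3))*(q^(N+1)-1)*q^x*(1-a*b*q^(2*x+1))*F q a b c (N+1) (n+1) x
     = (1-a*b*q^(x+1))*(1-b*q^(x+1))*(1-a*b*c*q^(N+x+3))*(q^(N+1)-q^x)*F q a (q*b) (q*c) N n x
      - (q^x-1)*b*(a*q^x-1)*(q^(x+1)-c*q^(N+3))*(a*b*q^(N+x+2)-1)*F q a (q*b) (q*c) N n (x-1) := by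
  have hqx : q^x ≠ 0 := pow_ne_zero _ hq
  have hqn : q^n ≠ 0 := pow_ne_zero _ hq
  have hqN : q^N ≠ 0 := pow_ne_zero _ hq
  have r := R3 q (q^(n+1))⁻¹ (b*c*q^(n+2)) (q^x)⁻¹ (a*b*q^(x+1)) (q*b) (a*b*c*q^(N+3)) (q^(N+1))⁻¹ hq
    (by positivity) (by positivity)
    (by intro h; apply hXY; 
        have := congrArg (· * q^x) h
        simp only [inv_mul_cancel₀ hqx] at this; rw [this]; ring)
    (by field_simp; ring) (n+1)
    (fun l hl h => hd (l+1) (by omega) (by omega) (by rw [← h]; ring))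
    (fun l hl h => he (N+3+l) (by omega) (by omega) (by rw [← h]; ring))
    (fun l hl h => pinv_ne q hq N l h1 (by omega) h)
    (fun l h2 h3 h => h1 l h2 (by omega) (by rw [one_mul, h]))
  have e0 : F q a b c (N+1) (n+1) x = ∑ k ∈ range (n+1), t q (q^(n+1))⁻¹ (b*c*q^(n+2)) (q^x)⁻¹ (a*b*q^(x+1)) (q*b) (a*b*c*q^(N+3)) (q^(N+1))⁻¹ k + t q (q^(n+1))⁻¹ (b*c*q^(n+2)) (q^x)⁻¹ (a*b*q^(x+1)) (q*b) (a*b*c*q^(N+3)) (q^(N+1))⁻¹ (n+1) := by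
    rw [F, sum_range_succ]
  have e1 : F q a (q*b) (q*c) N n x = ∑ k ∈ range (n+1), t q ((q^(n+1))⁻¹*q) (b*c*q^(n+2)*q) (q^x)⁻¹ (a*b*q^(x+1)*q) (q*b*q) (a*b*c*q^(N+3)*q) ((q^(N+1))⁻¹*q) k := by
    rw [F, pinv q hq, pinv q hq]
    refine sum_congr rfl fun k _ => ?_
    congr 1 <;> ring
  have e2 : (1-(q^x)⁻¹)*F q a (q*b) (q*c) N n (x-1) = (1-(q^x)⁻¹)*∑ k ∈ range (n+1), t q ((q^(n+1))⁻¹*q) (b*c*q^(n+2)*q) ((q^x)⁻¹*q) (a*b*q^(x+1)) (q*b*q) (a*b*c*q^(N+3)*q) ((q^(N+1))⁻¹*q) k := by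
    rcases x with _ | x
    · simp
    · rw [F, pinv q hq, pinv q hq, pinv q hq]
      congr 1
      refine sum_congr rfl fun k _ => ?_
      rw [Nat.add_sub_cancel]; congr 1 <;> ring
  rw [sum_sub_distrib, sum_sub_distrib, ← mul_sum, ← mul_sum, ← mul_sum, ← e1] at r
  have e0' := eq_sub_of_add_eq e0.symm
  rw [e0'] at r
  generalize t q (q^(n+1))⁻¹ (b*c*q^(n+2)) (q^x)⁻¹ (a*b*q^(x+1)) (q*b) (a*b*c*q^(N+3)) (q^(N+1))⁻¹ (n+1) = T at r
  generalize F q a b c (N+1) (n+1) x = F0 at *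
  generalize F q a (q*b) (q*c) N n x = F1 at *
  generalize F q a (q*b) (q*c) N n (x-1) = F2 at *
  generalize ∑ k ∈ range (n+1), t q ((q^(n+1))⁻¹*q) (b*c*q^(n+2)*q) ((q^x)⁻¹*q) (a*b*q^(x+1)) (q*b*q) (a*b*c*q^(N+3)*q) ((q^(N+1))⁻¹*q) k = F2' at *
  have hA : 1 - (q^(n+1))⁻¹ ≠ 0 := by
    have := pinv_ne q hq n 0 (h1.mono (by omega)) (by omega)
    intro h; apply this; rw [pow_zero]; linear_combination -h
  have hBB : 1 - b*c*q^(n+2) ≠ 0 := fun h => hB (by linear_combination -h)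
  have hm : (1 - (q ^ (n + 1))⁻¹ * (b * c * q ^ (n + 2)) * q ^ (n + 1)) * (1 - q ^ (n + 1)) / q ^ (n + 1) = -((1 - (q^(n+1))⁻¹)*(1-b*c*q^(n+2))) := by
    field_simp; ring
  have r3 := aux5 _ _ _ _ _ _ _ _ _ _ hA hBB hm r
  have r4 : (q ^ x)⁻¹ * (1 - (q ^ x)⁻¹) *
              ((a * b * q ^ (x + 1) - q * b) * (a * b * q ^ (x + 1) - a * b * c * q ^ (N + 3)) *
                (a * b * q ^ (x + 1) - (q ^ (N + 1))⁻¹)) *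
            F2' = (q ^ x)⁻¹ * (1 - (q ^ x)⁻¹) *
              ((a * b * q ^ (x + 1) - q * b) * (a * b * q ^ (x + 1) - a * b * c * q ^ (N + 3)) *
                (a * b * q ^ (x + 1) - (q ^ (N + 1))⁻¹)) *
            F2 := by linear_combination -((q ^ x)⁻¹ *
              ((a * b * q ^ (x + 1) - q * b) * (a * b * q ^ (x + 1) - a * b * c * q ^ (N + 3)) *
                (a * b * q ^ (x + 1) - (q ^ (N + 1))⁻¹))) * e2
  rw [r4] at r3
  clear r r4 e2 e1 e0 e0' hm hA hBB hd he h1 hXY hB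
  rw [← sub_eq_zero]
  have := congrArg (fun z => -(q^(2*x)*q^N/(a*b)) * z) r3
  simp only [mul_zero] at this
  rw [← this]
  have p2 : ∀ x, q^(2*x) = q^x*q^x := by intro x; ring
  simp only [pow_add, pow_one, p2]
  generalize q^x = ux at *
  generalize q^N = uN at *
  field_simp
  ring
end BE

namespace BE
open qR Finset

lemma t_perm1 (q A B X Y d e f : ℂ) (k : ℕ) : t q A B X Y d e f k = t q A B X Y f d e k := by
  unfold t; ring
lemma t_perm2 (q A B X Y d e f : ℂ) (k : ℕ) : t q A B X Y d e f k = t q A B X Y e d f k := by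
  unfold t; ring

lemma FT2a (q a b c : ℂ) (N n x : ℕ) (hq : q ≠ 0) (hn : n ≤ N) (h1 : S q 1 (N+1)) :
    (1-q^(N+1))*(1-a*b*q^(2*x+1))*F q a b c (N+1) n x
     = (1-a*b*q^(x+1))*(q^x-q^(N+1))*F q (q*a) b c N n x
      + (1-q^x)*(1-a*b*q^(N+x+2))*F q (q*a) b c N n (x-1) := by
  have hqx : q^x ≠ 0 := pow_ne_zero _ hq
  have hqN : q^N ≠ 0 := pow_ne_zero _ hq
  have r : ∀ k ∈ range (n+1), _ := fun k hk => R1 q (q^n)⁻¹ (b*c*q^(n+1)) (q^x)⁻¹ (a*b*q^(x+1)) (q^(N+1))⁻¹ (q*b) (a*b*c*q^(N+3)) k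
    (by simpa using pinv_ne q hq N 0 h1 (by omega)) (pinv_ne q hq N k h1 (by simp at hk; omega))
  have r := sum_congr rfl r
  rw [sum_sub_distrib, ← mul_sum, ← mul_sum, ← mul_sum] at r
  have e0 : ∑ k ∈ range (n+1), t q (q^n)⁻¹ (b*c*q^(n+1)) (q^x)⁻¹ (a*b*q^(x+1)) (q^(N+1))⁻¹ (q*b) (a*b*c*q^(N+3)) k = F q a b c (N+1) n x := by
    refine sum_congr rfl fun k _ => ?_
    rw [t_perm1, t_perm1]
  have e1 : ∑ k ∈ range (n+1), t q (q^n)⁻¹ (b*c*q^(n+1)) (q^x)⁻¹ (a*b*q^(x+1)*q) ((q^(N+1))⁻¹*q) (q*b) (a*b*c*q^(N+3)) k = F q (q*a) b c N n x := by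
    refine sum_congr rfl fun k _ => ?_
    rw [t_perm1, t_perm1, pinv q hq]
    congr 1 <;> ring
  have e2 : (1-(q^x)⁻¹)*∑ k ∈ range (n+1), t q (q^n)⁻¹ (b*c*q^(n+1)) ((q^x)⁻¹*q) (a*b*q^(x+1)) ((q^(N+1))⁻¹*q) (q*b) (a*b*c*q^(N+3)) k = (1-(q^x)⁻¹)*F q (q*a) b c N n (x-1) := by
    rcases x with _ | x
    · simp
    · rw [F]
      congr 1
      refine sum_congr rfl fun k _ => ?_
      rw [t_perm1, t_perm1, pinv q hq, pinv q hq]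
      rw [Nat.add_sub_cancel]; congr 1 <;> ring
  rw [e0, e1] at r
  generalize F q a b c (N+1) n x = F0 at *
  generalize F q (q*a) b c N n x = F1 at *
  generalize F q (q*a) b c N n (x-1) = F2 at *
  generalize ∑ k ∈ range (n+1), t q (q^n)⁻¹ (b*c*q^(n+1)) ((q^x)⁻¹*q) (a*b*q^(x+1)) ((q^(N+1))⁻¹*q) (q*b) (a*b*c*q^(N+3)) k = F2' at *
  have r2 : (1 - (q ^ (N + 1))⁻¹) * ((q ^ x)⁻¹ - a * b * q ^ (x + 1)) * F0 - 
    ((1 - a * b * q ^ (x + 1)) * ((q ^ x)⁻¹ - (q ^ (N + 1))⁻¹) * F1 -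
      (1 - (q ^ x)⁻¹) * (a * b * q ^ (x + 1) - (q ^ (N + 1))⁻¹) * F2) = 0 := by
    linear_combination r - (a * b * q ^ (x + 1) - (q ^ (N + 1))⁻¹) * e2
  rw [← sub_eq_zero]
  have := congrArg (fun z => -(q^x*q^(N+1)) * z) r2
  simp only [mul_zero] at this
  rw [← this]
  have p2 : ∀ x, q^(2*x) = q^x*q^x := by intro x; ring
  simp only [pow_add, pow_one, p2]
  clear r r2 this e2 e0 e1
  generalize q^x = ux at *
  generalize q^N = uN at *
  field_simp
  ring

lemma FT2b (q a b c : ℂ) (N n x : ℕ) (hq : q ≠ 0) (hn : n ≤ N) (he : S q (a*b*c) (2*N+2)) :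
    (1-a*b*c*q^(N+2))*(1-a*b*q^(2*x+1))*F q a b c N n x
     = (1-a*b*q^(x+1))*(1-a*b*c*q^(N+x+2))*F q (q*a) b c N n x
      + (1-q^x)*(a*b)*(q^(x+1)-c*q^(N+2))*F q (q*a) b c N n (x-1) := by
  have hqx : q^x ≠ 0 := pow_ne_zero _ hq
  have hqN : q^N ≠ 0 := pow_ne_zero _ hq
  have r : ∀ k ∈ range (n+1), _ := fun k hk => R1 q (q^n)⁻¹ (b*c*q^(n+1)) (q^x)⁻¹ (a*b*q^(x+1)) (a*b*c*q^(N+2)) (q*b) (q^N)⁻¹  k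
    (he (N+2) (by omega) (by omega)) (fun h => he (N+2+k) (by omega) (by simp at hk; omega) (by rw [← h]; ring))
  have r := sum_congr rfl r
  rw [sum_sub_distrib, ← mul_sum, ← mul_sum, ← mul_sum] at r
  have e0 : ∑ k ∈ range (n+1), t q (q^n)⁻¹ (b*c*q^(n+1)) (q^x)⁻¹ (a*b*q^(x+1)) (a*b*c*q^(N+2)) (q*b) (q^N)⁻¹ k = F q a b c N n x := by
    refine sum_congr rfl fun k _ => ?_
    rw [t_perm2]
  have e1 : ∑ k ∈ range (n+1), t q (q^n)⁻¹ (b*c*q^(n+1)) (q^x)⁻¹ (a*b*q^(x+1)*q) (a*b*c*q^(N+2)*q) (q*b) (q^N)⁻¹ k = F q (q*a) b c N n x := by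
    refine sum_congr rfl fun k _ => ?_
    rw [t_perm2]
    congr 1 <;> ring
  have e2 : (1-(q^x)⁻¹)*∑ k ∈ range (n+1), t q (q^n)⁻¹ (b*c*q^(n+1)) ((q^x)⁻¹*q) (a*b*q^(x+1)) (a*b*c*q^(N+2)*q) (q*b) (q^N)⁻¹ k = (1-(q^x)⁻¹)*F q (q*a) b c N n (x-1) := by
    rcases x with _ | x
    · simp
    · rw [F]
      congr 1
      refine sum_congr rfl fun k _ => ?_
      rw [t_perm2, pinv q hq]
      rw [Nat.add_sub_cancel]; congr 1 <;> ring
  rw [e0, e1] at r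
  generalize F q a b c N n x = F0 at *
  generalize F q (q*a) b c N n x = F1 at *
  generalize F q (q*a) b c N n (x-1) = F2 at *
  generalize ∑ k ∈ range (n+1), t q (q^n)⁻¹ (b*c*q^(n+1)) ((q^x)⁻¹*q) (a*b*q^(x+1)) (a*b*c*q^(N+2)*q) (q*b) (q^N)⁻¹ k = F2' at *
  have r2 : (1 - (a*b*c*q^(N+2))) * ((q ^ x)⁻¹ - a * b * q ^ (x + 1)) * F0 - 
    ((1 - a * b * q ^ (x + 1)) * ((q ^ x)⁻¹ - (a*b*c*q^(N+2))) * F1 -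
      (1 - (q ^ x)⁻¹) * (a * b * q ^ (x + 1) - (a*b*c*q^(N+2))) * F2) = 0 := by
    linear_combination r - (a * b * q ^ (x + 1) - (a*b*c*q^(N+2))) * e2
  rw [← sub_eq_zero]
  have := congrArg (fun z => (q^x) * z) r2
  simp only [mul_zero] at this
  rw [← this]
  have p2 : ∀ x, q^(2*x) = q^x*q^x := by intro x; ring
  simp only [pow_add, pow_one, p2]
  clear r r2 this e2 e0 e1
  generalize q^x = ux at *
  generalize q^N = uN at *
  field_simp
  ring

lemma pinv_ne' (q : ℂ) (hq : q ≠ 0) (N l : ℕ) (h1 : S q 1 N) (hl : l < N) : (q^N)⁻¹ * q^l ≠ 1 := by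
  obtain ⟨N, rfl⟩ : ∃ m, N = m+1 := ⟨N-1, by omega⟩
  exact pinv_ne q hq N l h1 (by omega)

lemma FT3b (q a b c : ℂ) (M n x : ℕ) (hq : q ≠ 0) (ha : a ≠ 0) (hb : b ≠ 0) (hc : c ≠ 0) (hx : x ≤ M)
    (h1 : S q 1 M) (he : S q b M) (hd : S q (a*b*c) (2*M+2)) :
    (1-a*b*c*q^(M+x+2))*(q^x-c*q^(M+1))*(1-b*c*q^(2*n+2))*F q a b (q*c) M n x
     = q^x*(1-a*b*c*q^(M+2))*((1-c*q^(n+1))*(1-b*c*q^(n+M+2))*F q a b c M n x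
      + c*q*(1-b*q^(n+1))*(q^n-q^M)*F q a b c M (n+1) x) := by
  have hqx : q^x ≠ 0 := pow_ne_zero _ hq
  have hqn : q^n ≠ 0 := pow_ne_zero _ hq
  have hqM : q^M ≠ 0 := pow_ne_zero _ hq
  have r := R2 q (q^(n+1))⁻¹ (b*c*q^(n+1)) (q^x)⁻¹ (a*b*q^(x+1)) (a*b*c*q^(M+2)) (q*b) (q^M)⁻¹ hq
    (by field_simp; ring) x
    (fun l hl h => hd (M+2+l) (by omega) (by omega) (by rw [← h]; ring))
    (fun l hl h => he (l+1) (by omega) (by omega) (by rw [← h]; ring))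
    (fun l hl h => pinv_ne' q hq M l h1 (by omega) h)
    (fun l h2 h3 h => h1 l h2 (by omega) (by rw [one_mul, h]))
  rw [inv_mul_cancel₀ hqx, sub_self, mul_zero, zero_mul, sum_sub_distrib, sum_sub_distrib, ← mul_sum, ← mul_sum, ← mul_sum] at r
  have e0 : ∑ k ∈ range (x+1), t q ((q^(n+1))⁻¹*q) (b*c*q^(n+1)) (q^x)⁻¹ (a*b*q^(x+1)) (a*b*c*q^(M+2)) (q*b) (q^M)⁻¹ k = F q a b c M n x := by
    rw [F_eq q a b c hq M n x x (by simp)]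
    refine sum_congr rfl fun k _ => ?_
    rw [t_perm2, pinv q hq]
  have e1 : ∑ k ∈ range (x+1), t q ((q^(n+1))⁻¹) (b*c*q^(n+1)*q) (q^x)⁻¹ (a*b*q^(x+1)) (a*b*c*q^(M+2)) (q*b) (q^M)⁻¹ k = F q a b c M (n+1) x := by
    rw [F_eq q a b c hq M (n+1) x x (by simp)]
    refine sum_congr rfl fun k _ => ?_
    rw [t_perm2]; congr 1; ring
  have e2 : ∑ k ∈ range (x+1), t q ((q^(n+1))⁻¹*q) (b*c*q^(n+1)*q) (q^x)⁻¹ (a*b*q^(x+1)) (a*b*c*q^(M+2)*q) (q*b) (q^M)⁻¹ k = F q a b (q*c) M n x := by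
    rw [F_eq q a b (q*c) hq M n x x (by simp)]
    refine sum_congr rfl fun k _ => ?_
    rw [t_perm2, pinv q hq]; congr 1 <;> ring
  rw [e0, e1, e2] at r
  clear e0 e1 e2
  generalize F q a b c M n x = F0 at *
  generalize F q a b c M (n+1) x = F1 at *
  generalize F q a b (q*c) M n x = F2 at *
  rw [← sub_eq_zero]
  have := congrArg (fun z => (q^x*q^n/(a*b^2*c*q^2)) * z) r
  simp only [mul_zero] at this
  rw [← this]
  have p2 : ∀ x, q^(2*x) = q^x*q^x := by intro x; ring
  simp only [pow_add, pow_one, p2]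
  clear r this he hd
  generalize q^x = ux at *
  generalize q^n = un at *
  generalize q^M = uM at *
  field_simp
  ring

lemma aux6 (T A B X Y d e f K q : ℂ) (hA : A ≠ 0) (hq : q ≠ 0) (hK : K ≠ 0) (hAK : A*q*K = 1) (hd : 1 - d ≠ 0) (he : 1 - e*K ≠ 0)
    (hf : 1 - f*K ≠ 0) (hqk : 1 - q*K ≠ 0) :
    d*(d-1)*(B*(A*q-e)*(A*q-f)) * (T*((1-A)*(1-B*q*K))*((1-X*K)*(1-Y*K))*(q*K)/((1-d)*(1-e*K)*(1-f*K)*(1-q*K)))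
     = -(d*q^2*A*B*(B-A)) * (T*K)/K * (1-X*K)*(1-Y*K) := by
  have hA' : A = (q*K)⁻¹ := by field_simp; linear_combination hAK
  subst hA'
  have h2 : (q*K)⁻¹*q - e = (1-e*K)/K := by field_simp
  have h3 : (q*K)⁻¹*q - f = (1-f*K)/K := by field_simp
  have h4 : 1 - (q*K)⁻¹ = -(1-q*K)/(q*K) := by field_simp; ring
  have h5 : d - 1 = -(1-d) := by ring
  rw [h2, h3, h4, h5]
  generalize 1 - d = D at *
  generalize 1 - e*K = E at *
  generalize 1 - f*K = G at *
  generalize 1 - q*K = H at *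
  field_simp
  ring

lemma FT3 (q a b c : ℂ) (N n x : ℕ) (hq : q ≠ 0) (ha : a ≠ 0) (hb : b ≠ 0) (hc : c ≠ 0) (hn : n ≤ N)
    (h1 : S q 1 (N+1)) (he : S q b (N+1)) (hd : S q (a*b*c) (2*N+3)) :
    (q^x-q^(N+1))*(1-a*b*q^(N+x+2))*(1-b*c*q^(2*n+2))*F q a b (q*c) N n x
     = q^x*(1-q^(N+1))*(b*q*(1-c*q^(n+1))*(q^n-a*q^(N+1))*F q a b c (N+1) n x
      + (1-b*q^(n+1))*(1-a*b*c*q^(n+N+3))*F q a b c (N+1) (n+1) x) := by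
  have hqx : q^x ≠ 0 := pow_ne_zero _ hq
  have hqn : q^n ≠ 0 := pow_ne_zero _ hq
  have hqN : q^N ≠ 0 := pow_ne_zero _ hq
  have r := R2 q (q^(n+1))⁻¹ (b*c*q^(n+1)) (q^x)⁻¹ (a*b*q^(x+1)) (q^(N+1))⁻¹ (q*b) (a*b*c*q^(N+3)) hq
    (by field_simp; ring) n
    (fun l hl h => pinv_ne q hq N l h1 (by omega) h)
    (fun l hl h => he (l+1) (by omega) (by omega) (by rw [← h]; ring))
    (fun l hl h => hd (N+3+l) (by omega) (by omega) (by rw [← h]; ring))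
    (fun l h2 h3 h => h1 l h2 (by omega) (by rw [one_mul, h]))
  rw [sum_sub_distrib, sum_sub_distrib, ← mul_sum, ← mul_sum, ← mul_sum] at r
  have ex : (q^(N+1))⁻¹*((q^(N+1))⁻¹-1)*((b*c*q^(n+1))*((q^(n+1))⁻¹*q-(q*b))*((q^(n+1))⁻¹*q-(a*b*c*q^(N+3)))) * t q (q^(n+1))⁻¹ (b*c*q^(n+1)*q) (q^x)⁻¹ (a*b*q^(x+1)) (q^(N+1))⁻¹ (q*b) (a*b*c*q^(N+3)) (n+1) = -((q^(N+1))⁻¹*q^2*(q^(n+1))⁻¹*(b*c*q^(n+1))*((b*c*q^(n+1))-(q^(n+1))⁻¹)) * t q ((q^(n+1))⁻¹*q) (b*c*q^(n+1)*q) (q^x)⁻¹ (a*b*q^(x+1)) ((q^(N+1))⁻¹*q) (q*b) (a*b*c*q^(N+3)) n /q^n * (1 - (q^x)⁻¹*q^n) * (1-(a*b*q^(x+1))*q^n) := by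
    have n1 : ∀ a : ℂ, a ≠ 1 → 1 - a ≠ 0 := fun a h h' => h (by linear_combination -h')
    have z1 : 1 - (q^(N+1))⁻¹ ≠ 0 := n1 _ (by simpa using pinv_ne q hq N 0 h1 (by omega))
    have z2 : 1 - q*b*q^n ≠ 0 := n1 _ (fun h => he (n+1) (by omega) (by omega) (by rw [← h]; ring))
    have z3 : 1 - a*b*c*q^(N+3)*q^n ≠ 0 := n1 _ (fun h => hd (N+3+n) (by omega) (by omega) (by rw [← h]; ring))
    have z4 : 1 - q*q^n ≠ 0 := n1 _ (fun h => h1 (n+1) (by omega) (by omega) (by rw [one_mul, pow_succ', h]))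
    have z5 : (q^(n+1))⁻¹*q*q^n = 1 := by field_simp; ring
    rw [t, t, poch_succ', poch_succ, poch_succ, poch_succ, poch_succ', poch_succ, poch_succ, poch_succ, pow_succ' q n]
    rw [pow_succ' q n] at z5
    convert aux6 (poch q ((q^(n+1))⁻¹*q) n * poch q (b*c*q^(n+1)*q) n * poch q (q^x)⁻¹ n * poch q (a*b*q^(x+1)) n / (poch q ((q^(N+1))⁻¹*q) n * poch q (q*b) n * poch q (a*b*c*q^(N+3)) n * poch q q n)) (q*q^n)⁻¹ (b*c*(q*q^n)) (q^x)⁻¹ (a*b*q^(x+1)) (q^(N+1))⁻¹ (q*b) (a*b*c*q^(N+3)) (q^n) q (by positivity) hq hqn z5 z1 z2 z3 z4 using 2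
    · rw [pow_succ' q n]; simp only [div_eq_mul_inv, mul_inv]; ring
    · rw [pow_succ' q n]; simp only [div_eq_mul_inv, mul_inv]; ring
  have e0 : ∑ k ∈ range (n+1), t q ((q^(n+1))⁻¹*q) (b*c*q^(n+1)) (q^x)⁻¹ (a*b*q^(x+1)) (q^(N+1))⁻¹ (q*b) (a*b*c*q^(N+3)) k = F q a b c (N+1) n x := by
    refine sum_congr rfl fun k _ => ?_
    rw [t_perm1, t_perm1, pinv q hq]
  have e1 : ∑ k ∈ range (n+1), t q ((q^(n+1))⁻¹) (b*c*q^(n+1)*q) (q^x)⁻¹ (a*b*q^(x+1)) (q^(N+1))⁻¹ (q*b) (a*b*c*q^(N+3)) k = F q a b c (N+1) (n+1) x - t q (q^(n+1))⁻¹ (b*c*q^(n+1)*q) (q^x)⁻¹ (a*b*q^(x+1)) (q^(N+1))⁻¹ (q*b) (a*b*c*q^(N+3)) (n+1) := by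
    rw [eq_sub_iff_add_eq, ← sum_range_succ, F]
    refine sum_congr rfl fun k _ => ?_
    rw [t_perm1, t_perm1]; congr 1; ring
  have e2 : ∑ k ∈ range (n+1), t q ((q^(n+1))⁻¹*q) (b*c*q^(n+1)*q) (q^x)⁻¹ (a*b*q^(x+1)) ((q^(N+1))⁻¹*q) (q*b) (a*b*c*q^(N+3)) k = F q a b (q*c) N n x := by
    refine sum_congr rfl fun k _ => ?_
    rw [t_perm1, t_perm1, pinv q hq, pinv q hq]; congr 1 <;> ring
  rw [e0, e1, e2, ← ex] at r
  clear e0 e1 e2 ex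
  generalize t q (q^(n+1))⁻¹ (b*c*q^(n+1)*q) (q^x)⁻¹ (a*b*q^(x+1)) (q^(N+1))⁻¹ (q*b) (a*b*c*q^(N+3)) (n+1) = T at r
  generalize F q a b c (N+1) n x = F0 at *
  generalize F q a b c (N+1) (n+1) x = F1 at *
  generalize F q a b (q*c) N n x = F2 at *
  rw [mul_sub, ← sub_eq_zero] at r
  rw [← sub_eq_zero]
  have := congrArg (fun z => (q^x*q^n*q^(2*N)*q/(b*c)) * z) r
  simp only [mul_zero] at this
  rw [← this]
  have p2 : ∀ x, q^(2*x) = q^x*q^x := by intro x; ring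
  simp only [pow_add, pow_one, p2]
  clear r this he hd
  generalize q^x = ux at *
  generalize q^n = un at *
  generalize q^N = uN at *
  field_simp
  ring
end BE

namespace BE
open qR Finset

def Om0 (q a b c : ℂ) (N n : ℕ) : ℂ :=
  poch q q N / (poch q q n * poch q q (N-n)) * (1-b*c*q^(2*n+1)) * poch q (a*b*c*q^(N+2)) n
    * poch q (q*a) (N-n) / poch q (b*c*q^(n+1)) (N+1)

def Q (q a b c : ℂ) (N n x : ℕ) : ℂ := if n ≤ N ∧ x ≤ N then Om0 q a b c N n * F q a b c N n x else 0

lemma Q_eq {q a b c : ℂ} {N n x : ℕ} (h : n ≤ N) (h' : x ≤ N) :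
    Q q a b c N n x = Om0 q a b c N n * F q a b c N n x := if_pos ⟨h, h'⟩
lemma Q_n {q a b c : ℂ} {N n x : ℕ} (h : N < n) : Q q a b c N n x = 0 := if_neg (by omega)
lemma Q_x {q a b c : ℂ} {N n x : ℕ} (h : N < x) : Q q a b c N n x = 0 := if_neg (by omega)

lemma OmT1 (q a b c : ℂ) (N n : ℕ) (h1 : 1 - q^(n+1) ≠ 0) (h2 : 1-b*c*q^(n+2) ≠ 0) :
    (1-q^(n+1))*(1-b*c*q^(n+2))*Om0 q a b c (N+1) (n+1) = (1-q^(N+1))*(1-a*b*c*q^(N+3))*Om0 q a (q*b) (q*c) N n := by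
  unfold Om0
  rw [Nat.add_sub_add_right, poch_succ q q N, poch_succ q q n, poch_succ' q (a*b*c*q^(N+1+2)), poch_succ' q (b*c*q^(n+1+1)),
    show a*b*c*q^(N+1+2)*q = a*(q*b)*(q*c)*q^(N+2) by ring, show b*c*q^(n+1+1)*q = q*b*(q*c)*q^(n+1) by ring,
    show b*c*q^(2*(n+1)+1) = q*b*(q*c)*q^(2*n+1) by ring, ← pow_succ', ← pow_succ']
  simp only [div_eq_mul_inv, mul_inv]
  have z1 := mul_inv_cancel₀ h1
  have z2 := mul_inv_cancel₀ h2
  rw [show n+2 = n+1+1 from rfl] at *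
  generalize (1-q^(n+1))⁻¹ = i1 at *
  generalize (1-b*c*q^(n+1+1))⁻¹ = i2 at *
  have e3 : (1-q^(n+1))*i1*((1-b*c*q^(n+1+1))*i2) = 1 := by rw [z1, z2, one_mul]
  linear_combination ((1-q^(N+1))*(1-a*b*c*q^(N+3)) * (poch q q N * ((poch q q n)⁻¹*(poch q q (N-n))⁻¹) * (1-q*b*(q*c)*q^(2*n+1)) * poch q (a*(q*b)*(q*c)*q^(N+2)) n * poch q (q*a) (N-n) * (poch q (q*b*(q*c)*q^(n+1)) (N+1))⁻¹)) * e3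

lemma OmT2a (q a b c : ℂ) (N n : ℕ) (hn : n ≤ N) (h1 : 1 - q^(N+1-n) ≠ 0) (h2 : 1-b*c*q^(n+N+2) ≠ 0) :
    (1-q^(N+1-n))*(1-b*c*q^(n+N+2))*Om0 q a b c (N+1) n = (1-q^(N+1))*(1-q*a)*Om0 q (q*a) b c N n := by
  obtain ⟨m, rfl⟩ := Nat.exists_eq_add_of_le hn
  unfold Om0
  have e1 : n + m + 1 - n = m + 1 := by omega
  have e2 : n + m - n = m := by omega
  rw [e1] at h1
  rw [e1, e2, poch_succ q q (n+m), poch_succ q q m, poch_succ' q (q*a), poch_succ q _ (n+m+1), 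
    show a*b*c*q^(n+m+1+2) = q*a*b*c*q^(n+m+2) by ring, show q*a*q = q*(q*a) by ring,
    show b*c*q^(n+1)*q^(n+m+1) = b*c*q^(n+(n+m)+2) by ring, ← pow_succ', ← pow_succ']
  simp only [div_eq_mul_inv, mul_inv]
  have z1 := mul_inv_cancel₀ h1
  have z2 := mul_inv_cancel₀ h2
  generalize (1-q^(m+1))⁻¹ = i1 at *
  generalize (1-b*c*q^(n+(n+m)+2))⁻¹ = i2 at *
  have e3 : (1-q^(m+1))*i1*((1-b*c*q^(n+(n+m)+2))*i2) = 1 := by rw [z1, z2, one_mul]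
  linear_combination ((1-q^(n+m+1))*(1-q*a) * (poch q q (n+m) * ((poch q q n)⁻¹*(poch q q m)⁻¹) * (1-b*c*q^(2*n+1)) * poch q (q*a*b*c*q^(n+m+2)) n * poch q (q*(q*a)) m * (poch q (b*c*q^(n+1)) (n+m+1))⁻¹)) * e3

lemma OmT2b (q a b c : ℂ) (N n : ℕ) (hn : n ≤ N) :
    (1-a*b*c*q^(N+2+n))*(q^n-a*q^(N+1))*Om0 q a b c N n = q^n*(1-a*b*c*q^(N+2))*(1-q*a)*Om0 q (q*a) b c N n := by
  obtain ⟨m, rfl⟩ := Nat.exists_eq_add_of_le hn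
  unfold Om0
  have e2 : n + m - n = m := by omega
  have e3 := poch_shift q (q*a) m
  have e4 := poch_shift q (a*b*c*q^(n+m+2)) n
  rw [e2, show q*(q*a) = q*a*q by ring, show q*a*b*c*q^(n+m+2) = a*b*c*q^(n+m+2)*q by ring]
  rw [show a*b*c*q^(n+m+2)*q^n = a*b*c*q^(n+m+2+n) by ring] at e4
  simp only [div_eq_mul_inv]
  generalize poch q q (n+m) * (poch q q n * poch q q m)⁻¹ = z
  generalize (poch q (b*c*q^(n+1)) (n+m+1))⁻¹ = w
  linear_combination (-q^n*z*(1-b*c*q^(2*n+1))*w)*((1-a*b*c*q^(n+m+2))*poch q (a*b*c*q^(n+m+2)*q) n*e3 + (1-q*a*q^m)*poch q (q*a) m*e4)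

lemma OmT3 (q a b c : ℂ) (N n : ℕ) (hn : n ≤ N) (h1 : 1 - q^(N+1-n) ≠ 0) (h2 : 1-b*c*q^(n+1) ≠ 0) :
    (q^n-q^(N+1))*(1-b*c*q^(n+1))*(1-b*c*q^(2*n+2))*Om0 q a b c (N+1) n = (1-q^(N+1))*(1-b*c*q^(2*n+1))*(q^n-a*q^(N+1))*Om0 q a b (q*c) N n := by
  obtain ⟨m, rfl⟩ := Nat.exists_eq_add_of_le hn
  unfold Om0
  have e1 : n + m + 1 - n = m + 1 := by omega
  have e2 : n + m - n = m := by omega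
  rw [e1] at h1
  rw [e1, e2, poch_succ q q (n+m), poch_succ q q m, poch_succ q (q*a), poch_succ' q _ (n+m+1), 
    show a*b*c*q^(n+m+1+2) = a*b*(q*c)*q^(n+m+2) by ring, 
    show b*c*q^(n+1)*q = b*(q*c)*q^(n+1) by ring, ← pow_succ', ← pow_succ']
  simp only [div_eq_mul_inv, mul_inv]
  have z1 := mul_inv_cancel₀ h1
  have z2 := mul_inv_cancel₀ h2
  generalize (1-q^(m+1))⁻¹ = i1 at *
  generalize (1-b*c*q^(n+1))⁻¹ = i2 at *
  have e3 : (1-q^(m+1))*i1*((1-b*c*q^(n+1))*i2) = 1 := by rw [z1, z2, one_mul]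
  linear_combination (q^n*(1-q^(n+m+1))*(1-q*a*q^m)*(1-b*c*q^(2*n+2)) * (poch q q (n+m) * ((poch q q n)⁻¹*(poch q q m)⁻¹) * (1-b*c*q^(2*n+1)) * poch q (a*b*(q*c)*q^(n+m+2)) n * poch q (q*a) m * (poch q (b*(q*c)*q^(n+1)) (n+m+1))⁻¹)) * e3

lemma OmT3' (q a b c : ℂ) (N n : ℕ) (hn : n ≤ N) (h1 : 1 - q^(n+1) ≠ 0) (h2 : 1-b*c*q^(n+N+3) ≠ 0) :
    (1-q^(n+1))*(1-b*c*q^(n+N+3))*(1-b*c*q^(2*n+2))*Om0 q a b c (N+1) (n+1) = (1-q^(N+1))*(1-b*c*q^(2*n+3))*(1-a*b*c*q^(n+N+3))*Om0 q a b (q*c) N n := by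
  obtain ⟨m, rfl⟩ := Nat.exists_eq_add_of_le hn
  unfold Om0
  have e1 : n + m + 1 - (n+1) = m := by omega
  have e2 : n + m - n = m := by omega
  rw [e1, e2, poch_succ q q (n+m), poch_succ q q n, poch_succ q _ n, poch_succ q _ (n+m+1), 
    show a*b*c*q^(n+m+1+2) = a*b*(q*c)*q^(n+m+2) by ring, 
    show b*c*q^(n+1+1) = b*(q*c)*q^(n+1) by ring, ← pow_succ', ← pow_succ', show b*(q*c)*q^(n+1)*q^(n+m+1) = b*c*q^(n+(n+m)+3) by ring]
  simp only [div_eq_mul_inv, mul_inv]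
  have z1 := mul_inv_cancel₀ h1
  have z2 := mul_inv_cancel₀ h2
  generalize (1-q^(n+1))⁻¹ = i1 at *
  generalize (1-b*c*q^(n+(n+m)+3))⁻¹ = i2 at *
  have e3 : (1-q^(n+1))*i1*((1-b*c*q^(n+(n+m)+3))*i2) = 1 := by rw [z1, z2, one_mul]
  linear_combination ((1-q^(n+m+1))*(1-a*b*c*q^(n+(n+m)+3))*(1-b*c*q^(2*n+2)) * (poch q q (n+m) * ((poch q q n)⁻¹*(poch q q m)⁻¹) * (1-b*c*q^(2*n+3)) * poch q (a*b*(q*c)*q^(n+m+2)) n * poch q (q*a) m * (poch q (b*(q*c)*q^(n+1)) (n+m+1))⁻¹)) * e3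

/- T3b : level M; n ≤ M -/
lemma OmT3b (q a b c : ℂ) (M n : ℕ) (hn : n ≤ M) (h2 : 1-b*c*q^(n+1) ≠ 0) (h3 : 1 - b*c*q^(n+M+2) ≠ 0)
    (h4 : 1 - a*b*c*q^(M+2) ≠ 0) :
    (1-b*c*q^(n+1))*(1-b*c*q^(2*n+2))*(1-a*b*c*q^(M+n+2))*Om0 q a b c M n = (1-b*c*q^(2*n+1))*(1-b*c*q^(n+M+2))*(1-a*b*c*q^(M+2))*Om0 q a b (q*c) M n := by
  unfold Om0
  have e3 := poch_shift q (a*b*c*q^(M+2)) n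
  have e4 := poch_shift q (b*c*q^(n+1)) (M+1)
  rw [show a*b*c*q^(M+2)*q = a*b*(q*c)*q^(M+2) by ring, show a*b*c*q^(M+2)*q^n = a*b*c*q^(M+n+2) by ring] at e3
  rw [show b*c*q^(n+1)*q = b*(q*c)*q^(n+1) by ring, show b*c*q^(n+1)*q^(M+1) = b*c*q^(n+M+2) by ring] at e4
  have e5 : (poch q (b*(q*c)*q^(n+1)) (M+1)) = (poch q (b*c*q^(n+1)) (M+1))*(1-b*c*q^(n+M+2))/(1-b*c*q^(n+1)) := by
    rw [← e4]; field_simp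
  have e6 : poch q (a*b*(q*c)*q^(M+2)) n = poch q (a*b*c*q^(M+2)) n * (1-a*b*c*q^(M+n+2))/(1-a*b*c*q^(M+2)) := by
    rw [← e3]; field_simp
  rw [e5, e6]
  simp only [div_eq_mul_inv, mul_inv, inv_inv]
  have z3 := mul_inv_cancel₀ h3
  have z4 := mul_inv_cancel₀ h4
  generalize (1-b*c*q^(n+M+2))⁻¹ = i1 at *
  generalize (1-a*b*c*q^(M+2))⁻¹ = i2 at *
  have e3 : (1-b*c*q^(n+M+2))*i1*((1-a*b*c*q^(M+2))*i2) = 1 := by rw [z3, z4, one_mul]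
  linear_combination (-(1-b*c*q^(2*n+1))*(poch q q M * ((poch q q n)⁻¹*(poch q q (M-n))⁻¹) * (1-b*c*q^(2*n+2)) * poch q (a*b*c*q^(M+2)) n * poch q (q*a) (M-n) * (poch q (b*c*q^(n+1)) (M+1))⁻¹*(1-a*b*c*q^(M+n+2))*(1-b*c*q^(n+1)))) * e3

lemma OmT3b' (q a b c : ℂ) (M n : ℕ) (hn : n < M) (h1 : 1 - q^(n+1) ≠ 0) (h2 : 1 - q^(M-n) ≠ 0) :
    (1-q^(n+1))*(q^n-a*q^M)*(1-b*c*q^(2*n+2))*Om0 q a b c M (n+1) = (q^n-q^M)*(1-b*c*q^(2*n+3))*(1-a*b*c*q^(M+2))*Om0 q a b (q*c) M n := by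
  obtain ⟨m, rfl⟩ := Nat.exists_eq_add_of_le' hn
  unfold Om0
  have e1 : m + (n+1) - (n+1) = m := by omega
  have e2 : m + (n+1) - n = m + 1 := by omega
  simp only [Nat.succ_eq_add_one] at *
  rw [e2] at h2
  rw [e1, e2, poch_succ q q n, poch_succ q q m, poch_succ' q _ n, poch_succ q (q*a) m, 
    show a*b*c*q^(m+(n+1)+2)*q = a*b*(q*c)*q^(m+(n+1)+2) by ring, 
    show b*c*q^(n+1+1) = b*(q*c)*q^(n+1) by ring, ← pow_succ', ← pow_succ']
  simp only [div_eq_mul_inv, mul_inv]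
  have z1 := mul_inv_cancel₀ h1
  have z2 := mul_inv_cancel₀ h2
  generalize (1-q^(n+1))⁻¹ = i1 at *
  generalize (1-q^(m+1))⁻¹ = i2 at *
  linear_combination (poch q q (m+(n+1)) * ((poch q q n)⁻¹*(poch q q m)⁻¹) * (1-b*c*q^(2*n+3)) * (1-b*c*q^(2*n+2)) * (1-a*b*c*q^(m+(n+1)+2))*poch q (a*b*(q*c)*q^(m+(n+1)+2)) n * poch q (q*a) m * (1-q*a*q^m)*q^n*(poch q (b*(q*c)*q^(n+1)) (m+(n+1)+1))⁻¹) * (z1 - z2)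
end BE

namespace BE
open qR Finset

lemma QT1 (q a b c : ℂ) (N n x : ℕ) (hq : q ≠ 0) (ha : a ≠ 0) (hb : b ≠ 0) (h1 : S q 1 (N+1)) (hd : S q b (N+1))
    (he : S q (a*b*c) (2*N+3)) (hbc : S q (b*c) (N+2)) (hab : S q (a*b) (2*N+3)) :
    (1-q^(n+1))*(1-b*c*q^(n+2))*(1-q*b)*q^x*(1-a*b*q^(2*x+1))*Q q a b c (N+1) (n+1) x
      = (1-a*b*q^(x+1))*(1-b*q^(x+1))*(1-a*b*c*q^(N+x+3))*(q^x-q^(N+1))*Q q a (q*b) (q*c) N n x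
        + (q^x-1)*b*(a*q^x-1)*(q^(x+1)-c*q^(N+3))*(a*b*q^(N+x+2)-1)*Q q a (q*b) (q*c) N n (x-1) := by
  rcases Nat.lt_or_ge N n with hn | hn
  · rw [Q_n hn, Q_n hn, Q_n (by omega)]; ring
  rcases Nat.lt_or_ge (N+1) x with hx | hx
  · rw [Q_x hx, Q_x (by omega), Q_x (by omega)]; ring
  have k : (q^x-q^(N+1))*Q q a (q*b) (q*c) N n x = (q^x-q^(N+1))*(Om0 q a (q*b) (q*c) N n * F q a (q*b) (q*c) N n x) := by
    rcases Nat.lt_or_ge N x with h | h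
    · rw [show x = N+1 by omega]; ring
    · rw [Q_eq hn h]
  rw [Q_eq (x := x-1) hn (by omega), Q_eq (by omega) hx]
  have e1 := OmT1 q a b c N n (by simpa using h1.ne (n+1) (by omega) (by omega)) (hbc.ne (n+2) (by omega) (by omega))
  have e2 := FT1 q a b c N n x hq ha hb hn h1 hd he (hbc _ (by omega) (by omega)) (hab _ (by omega) (by omega))
  linear_combination ((1-q*b)*q^x*(1-a*b*q^(2*x+1))*F q a b c (N+1) (n+1) x)*e1 - Om0 q a (q*b) (q*c) N n * e2 - (1-a*b*q^(x+1))*(1-b*q^(x+1))*(1-a*b*c*q^(N+x+3))*k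

lemma QT2a (q a b c : ℂ) (M n x : ℕ) (hq : q ≠ 0) (hx : x ≤ M) (h1 : S q 1 M) (hbc : S q (b*c) (2*M+1)) :
    (q^n-q^M)*(1-b*c*q^(n+M+1))*(1-a*b*q^(2*x+1))*Q q a b c M n x
     = q^n*(1-q*a)*((1-a*b*q^(x+1))*(q^x-q^M)*Q q (q*a) b c (M-1) n x+(1-q^x)*(1-a*b*q^(M+x+1))*Q q (q*a) b c (M-1) n (x-1)) := by
  rcases M with _ | N
  · obtain rfl : x = 0 := by omega
    rcases n with _ | n
    · simp
    · rw [Q_n (by omega)]; simp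
  rw [show N+1-1 = N from rfl]
  rcases Nat.lt_or_ge N n with hn | hn
  · rw [Q_n hn, Q_n hn]
    rcases Nat.lt_or_ge (N+1) n with hn' | hn'
    · rw [Q_n hn']; ring
    · rw [show n = N+1 by omega]; ring
  have k : (q^x-q^(N+1))*Q q (q*a) b c N n x = (q^x-q^(N+1))*(Om0 q (q*a) b c N n * F q (q*a) b c N n x) := by
    rcases Nat.lt_or_ge N x with h | h
    · rw [show x = N+1 by omega]; ring
    · rw [Q_eq hn h]
  rw [Q_eq (x := x-1) hn (by omega), Q_eq (by omega) hx]
  have e1 := OmT2a q a b c N n hn (by simpa using h1.ne (N+1-n) (by omega) (by omega)) (hbc.ne (n+N+2) (by omega) (by omega))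
  have e2 := FT2a q a b c N n x hq hn h1
  have e3 : q^(N+1) = q^n*q^(N+1-n) := by rw [← pow_add]; congr 1; omega
  have e1' : (q^n-q^(N+1))*(1-b*c*q^(n+N+2))*Om0 q a b c (N+1) n = q^n*(1-q^(N+1))*(1-q*a)*Om0 q (q*a) b c N n := by
    linear_combination (-(1-b*c*q^(n+N+2))*Om0 q a b c (N+1) n)*e3 + q^n*e1
  linear_combination (1-a*b*q^(2*x+1))*F q a b c (N+1) n x * e1' + q^n*(1-q*a)*Om0 q (q*a) b c N n*e2 - q^n*(1-q*a)*(1-a*b*q^(x+1))*k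

lemma QT2b (q a b c : ℂ) (M n x : ℕ) (hq : q ≠ 0) (hx : x ≤ M) (he : S q (a*b*c) (2*M+2)) :
    (1-a*b*c*q^(M+2+n))*(q^n-a*q^(M+1))*(1-a*b*q^(2*x+1))*Q q a b c M n x
     = q^n*(1-q*a)*((1-a*b*q^(x+1))*(1-a*b*c*q^(M+x+2))*Q q (q*a) b c M n x+(1-q^x)*(a*b)*(q^(x+1)-c*q^(M+2))*Q q (q*a) b c M n (x-1)) := by
  rcases Nat.lt_or_ge M n with hn | hn
  · rw [Q_n hn, Q_n hn, Q_n hn]; ring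
  rw [Q_eq hn hx, Q_eq hn hx, Q_eq hn (by omega)]
  have e1 := OmT2b q a b c M n hn
  have e2 := FT2b q a b c M n x hq hn he
  linear_combination (1-a*b*q^(2*x+1))*F q a b c M n x * e1 + q^n*(1-q*a)*Om0 q (q*a) b c M n*e2

def U (q a b c : ℂ) (M n x : ℕ) : ℂ := (1-b*c*q^(n+1))*(1-c*q^(n+1))/(1-b*c*q^(2*n+1))*Q q a b c M n x
def V (q a b c : ℂ) (M n x : ℕ) : ℂ := (1-q^(n+1))*(1-b*q^(n+1))/(1-b*c*q^(2*n+3))*Q q a b c M (n+1) x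

lemma auxU (d D k O O' u X: ℂ) (hd : d ≠ 0) (hD : D ≠ 0) (h : k*u*D*O = X*d*O') : k*(u/d*O) = X*O'/D := by
  field_simp; linear_combination h

lemma QT3 (q a b c : ℂ) (M n x : ℕ) (hq : q ≠ 0) (ha : a ≠ 0) (hb : b ≠ 0) (hc : c ≠ 0) (hx : x ≤ M) (h1 : S q 1 M) (he : S q b M)
    (hd : S q (a*b*c) (2*M+1)) (hbc : S q (b*c) (2*M+1)) :
    (q^x-q^M)*(1-a*b*q^(M+x+1))*Q q a b (q*c) (M-1) n x = q^x*((q^n-q^M)*(b*q)*U q a b c M n x+(1-b*c*q^(M+n+2))*V q a b c M n x) := by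
  unfold U V
  rcases M with _ | N
  · obtain rfl : x = 0 := by omega
    rw [Q_n (n := n+1) (by omega)]
    rcases n with _ | n
    · simp
    · rw [Q_n (c := c) (n := n+1) (by omega)]; simp
  rw [show N+1-1 = N from rfl]
  rcases Nat.lt_or_ge N n with hn | hn
  · rw [Q_n hn, Q_n (n := n+1) (by omega)]
    rcases Nat.lt_or_ge (N+1) n with hn' | hn'
    · rw [Q_n hn']; ring
    · rw [show n = N+1 by omega]; ring
  have k : (q^x-q^(N+1))*Q q a b (q*c) N n x = (q^x-q^(N+1))*(Om0 q a b (q*c) N n * F q a b (q*c) N n x) := by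
    rcases Nat.lt_or_ge N x with h | h
    · rw [show x = N+1 by omega]; ring
    · rw [Q_eq hn h]
  rw [Q_eq (n := n+1) (by omega) hx, Q_eq (n := n) (by omega) hx]
  have n1 := hbc.ne (2*n+1) (by omega) (by omega)
  have n2 := hbc.ne (2*n+2) (by omega) (by omega)
  have n3 := hbc.ne (2*n+3) (by omega) (by omega)
  have e1 := auxU _ _ _ _ _ _ _ n1 n2 (OmT3 q a b c N n hn (by simpa using h1.ne (N+1-n) (by omega) (by omega)) (hbc.ne (n+1) (by omega) (by omega)) |>.trans
     (show _ = ((1-q^(N+1))*(q^n-a*q^(N+1)))*(1-b*c*q^(2*n+1))*Om0 q a b (q*c) N n by ring))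
  have e1' := auxU (1-b*c*q^(2*n+3)) (1-b*c*q^(2*n+2)) (1-b*c*q^(n+N+3)) (Om0 q a b c (N+1) (n+1)) (Om0 q a b (q*c) N n) (1-q^(n+1)) ((1-q^(N+1))*(1-a*b*c*q^(n+N+3))) n3 n2 
    (by linear_combination (OmT3' q a b c N n hn (by simpa using h1.ne (n+1) (by omega) (by omega)) (hbc.ne (n+N+3) (by omega) (by omega))))
  have e2 := FT3 q a b c N n x hq ha hb hc hn h1 he hd
  have e2' : (q^x-q^(N+1))*(1-a*b*q^(N+x+2))*F q a b (q*c) N n x = q^x*(1-q^(N+1))*(b*q*(1-c*q^(n+1))*(q^n-a*q^(N+1))*F q a b c (N+1) n x + (1-b*q^(n+1))*(1-a*b*c*q^(n+N+3))*F q a b c (N+1) (n+1) x)/(1-b*c*q^(2*n+2)) := by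
    rw [eq_div_iff n2, ← e2]; ring
  clear e2
  simp only [div_eq_mul_inv] at *
  linear_combination (1-a*b*q^(N+x+2))*k + Om0 q a b (q*c) N n*e2' - q^x*(b*q)*(1-c*q^(n+1))*F q a b c (N+1) n x*e1 - q^x*(1-b*q^(n+1))*F q a b c (N+1) (n+1) x*e1'

lemma QT3b (q a b c : ℂ) (M n x : ℕ) (hq : q ≠ 0) (ha : a ≠ 0) (hb : b ≠ 0) (hc : c ≠ 0) (hx : x ≤ M) (h1 : S q 1 M) (he : S q b M)
    (hd : S q (a*b*c) (2*M+2)) (hbc : S q (b*c) (2*M+2)) :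
    (1-a*b*c*q^(M+x+2))*(q^x-c*q^(M+1))*Q q a b (q*c) M n x = q^x*((1-a*b*c*q^(M+n+2))*U q a b c M n x+(q^n-a*q^M)*(c*q)*V q a b c M n x) := by
  unfold U V
  rcases Nat.lt_or_ge M n with hn | hn
  · rw [Q_n hn, Q_n (n := n+1) (by omega), Q_n hn]; ring
  have n1 := hbc.ne (2*n+1) (by omega) (by omega)
  have n2 := hbc.ne (2*n+2) (by omega) (by omega)
  have e1 := auxU (1-b*c*q^(2*n+1)) (1-b*c*q^(2*n+2)) (1-a*b*c*q^(M+n+2)) (Om0 q a b c M n) (Om0 q a b (q*c) M n) (1-b*c*q^(n+1)) ((1-b*c*q^(n+M+2))*(1-a*b*c*q^(M+2))) n1 n2 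
    (by linear_combination (OmT3b q a b c M n hn (hbc.ne (n+1) (by omega) (by omega)) (hbc.ne (n+M+2) (by omega) (by omega)) (hd.ne (M+2) (by omega) (by omega))))
  have e2 := FT3b q a b c M n x hq ha hb hc hx h1 he hd
  have e2' : (1-a*b*c*q^(M+x+2))*(q^x-c*q^(M+1))*F q a b (q*c) M n x = q^x*(1-a*b*c*q^(M+2))*((1-c*q^(n+1))*(1-b*c*q^(n+M+2))*F q a b c M n x + c*q*(1-b*q^(n+1))*(q^n-q^M)*F q a b c M (n+1) x)/(1-b*c*q^(2*n+2)) := by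
    rw [eq_div_iff n2, ← e2]; ring
  clear e2
  rw [Q_eq hn hx, Q_eq hn hx]
  rcases Nat.lt_or_ge n M with hn' | hn'
  · rw [Q_eq (n := n+1) (by omega) hx]
    have n3 := hbc.ne (2*n+3) (by omega) (by omega)
    have e1' := auxU (1-b*c*q^(2*n+3)) (1-b*c*q^(2*n+2)) (q^n-a*q^M) (Om0 q a b c M (n+1)) (Om0 q a b (q*c) M n) (1-q^(n+1)) ((q^n-q^M)*(1-a*b*c*q^(M+2))) n3 n2 
      (by linear_combination (OmT3b' q a b c M n hn' (by simpa using h1.ne (n+1) (by omega) (by omega)) (by simpa using h1.ne (M-n) (by omega) (by omega))))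
    simp only [div_eq_mul_inv] at *
    linear_combination Om0 q a b (q*c) M n*e2' - q^x*(1-c*q^(n+1))*F q a b c M n x*e1 - q^x*(c*q)*(1-b*q^(n+1))*F q a b c M (n+1) x*e1'
  · obtain rfl : n = M := by omega
    rw [Q_n (n := n+1) (by omega)]
    simp only [div_eq_mul_inv] at *
    linear_combination Om0 q a b (q*c) n n*e2' - q^x*(1-c*q^(n+1))*F q a b c n n x*e1

lemma Q_zero (q a b c : ℂ) (N x : ℕ) (hx : x ≤ N) (hN : poch q q N ≠ 0) (hbc : 1 - b*c*q ≠ 0) : 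
    Q q a b c N 0 x = poch q (q*a) N / poch q (b*c*q^2) N := by
  rw [Q_eq (by omega) hx, F_zero]
  unfold Om0
  rw [poch_succ']
  simp only [poch_zero', Nat.sub_zero, one_mul, mul_one, mul_zero, zero_add, pow_one]
  rw [show b*c*q*q = b*c*q^2 by ring, div_self hN]
  field_simp
end BE

namespace BE
open qR Finset

structure G (q c0 c1 c2 c3 c4 : ℂ) (N : ℕ) : Prop where
  hq : q ≠ 0
  n0 : c0 ≠ 0
  n1 : c1 ≠ 0
  n2 : c2 ≠ 0
  n3 : c3 ≠ 0
  n4 : c4 ≠ 0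
  pr : c0*c1*c2*c3*c4*q^(2*N+3) = 1
  s1 : S q 1 N
  hg : ∀ e0 e1 e2 e3 e4 : ℕ, e0 ≤ 1 → e1 ≤ 1 → e2 ≤ 1 → e3 ≤ 1 → e4 ≤ 1 → 1 ≤ e0+e1+e2+e3+e4 → e0+e1+e2+e3+e4 ≤ 4 →
    S q (c0^e0*c1^e1*c2^e2*c3^e3*c4^e4) (2*N+5)

lemma G.get {q c0 c1 c2 c3 c4 : ℂ} {N : ℕ} (g : G q c0 c1 c2 c3 c4 N) (e0 e1 e2 e3 e4 : ℕ) {c : ℂ} {K : ℕ} 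
    (hc : c = c0^e0*c1^e1*c2^e2*c3^e3*c4^e4) (hK : K ≤ 2*N+5) (h : e0 ≤ 1 ∧ e1 ≤ 1 ∧ e2 ≤ 1 ∧ e3 ≤ 1 ∧ e4 ≤ 1 ∧ 1 ≤ e0+e1+e2+e3+e4 ∧ e0+e1+e2+e3+e4 ≤ 4 := by decide) : S q c K := by
  rw [hc]
  obtain ⟨a1, a2, a3, a4, a5, a6, a7⟩ := h
  exact (g.hg e0 e1 e2 e3 e4 a1 a2 a3 a4 a5 a6 a7).mono hK

lemma G.down' {q c0 c1 c2 c3 c4 : ℂ} {N : ℕ} (g : G q c0 c1 c2 c3 c4 (N+1)) (f0 f1 f2 f3 f4 : ℕ) (hf : f0+f1+f2+f3+f4 = 2) :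
    G q (q^f0*c0) (q^f1*c1) (q^f2*c2) (q^f3*c3) (q^f4*c4) N := by
  have hq := g.hq
  have := g.n0
  have := g.n1
  have := g.n2
  have := g.n3
  have := g.n4
  refine ⟨hq, by positivity, by positivity, by positivity, by positivity, by positivity, ?_, g.s1.mono (by omega), ?_⟩
  · rw [← g.pr]
    have : q^(2*(N+1)+3) = q^f0*q^f1*q^f2*q^f3*q^f4*q^(2*N+3) := by
      simp only [← pow_add]; congr 1; omega
    rw [this]; ring
  · intro e0 e1 e2 e3 e4 h0 h1 h2 h3 h4 h5 h6 k hk1 hk2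
    have b0 : e0*f0 ≤ f0 := by nlinarith
    have b1 : e1*f1 ≤ f1 := by nlinarith
    have b2 : e2*f2 ≤ f2 := by nlinarith
    have b3 : e3*f3 ≤ f3 := by nlinarith
    have b4 : e4*f4 ≤ f4 := by nlinarith
    have := g.hg e0 e1 e2 e3 e4 h0 h1 h2 h3 h4 h5 h6 (k + (e0*f0+e1*f1+e2*f2+e3*f3+e4*f4)) (by omega) (by omega)
    intro h
    apply this
    rw [← h]
    simp only [mul_pow, ← pow_mul, pow_add]
    rw [mul_comm f0, mul_comm f1, mul_comm f2, mul_comm f3, mul_comm f4]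
    ring

lemma G.down {q c0 c1 c2 c3 c4 : ℂ} {N : ℕ} (g : G q c0 c1 c2 c3 c4 (N+1)) (f0 f1 f2 f3 f4 : ℕ) {d0 d1 d2 d3 d4 : ℂ}
    (h0 : d0 = q^f0*c0) (h1 : d1 = q^f1*c1) (h2 : d2 = q^f2*c2) (h3 : d3 = q^f3*c3) (h4 : d4 = q^f4*c4)
    (hf : f0+f1+f2+f3+f4 = 2 := by decide) : G q d0 d1 d2 d3 d4 N := by
  rw [h0, h1, h2, h3, h4]; exact g.down' f0 f1 f2 f3 f4 hf

lemma G.symm {q c0 c1 c2 c3 c4 : ℂ} {N : ℕ} (g : G q c0 c1 c2 c3 c4 N) : G q c4 c3 c2 c1 c0 N := by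
  refine ⟨g.hq, g.n4, g.n3, g.n2, g.n1, g.n0, by rw [← g.pr]; ring, g.s1, ?_⟩
  intro e0 e1 e2 e3 e4 h0 h1 h2 h3 h4 h5 h6
  exact g.get e4 e3 e2 e1 e0 (by ring) le_rfl (by omega)

lemma BC_aux (A K C' B' B1 B2 u1 u2 u3 u4 v1 v2 v3 v4 g1 g2 r X1 X2 d w1 w2 : ℂ) (hA : A ≠ 0)
    (e1 : K*B' = g1*u1*u2*B1 + g2*u3*u4*B2) (e2 : v1*v2*d*C' = A*r*X1) (e3 : v3*v4*d*C' = A*r*X2)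
    (k1 : A*u1*(A*u2) = w1*(v1*v2)) (k2 : A*u3*(A*u4) = w2*(v3*v4)) : A*(K*d)*(B'*C') = r*(g1*w1*B1*X1+g2*w2*B2*X2) := by
  apply mul_left_cancel₀ hA
  linear_combination A^2*d*C'*e1 + g1*B1*d*C'*k1 + g2*B2*d*C'*k2 + g1*w1*B1*e2 + g2*w2*B2*e3

lemma BC (q c0 c1 c2 c3 c4 : ℂ) (N j a x y : ℕ) (g : G q c0 c1 c2 c3 c4 (N+1)) (ha : a ≤ N) (hxy : x+y ≤ N+1) :
    q^a*((1-q^(j+1))*(1-c0*c4*q^(j+2))*(1-q*c0)*q^y*(1-c1*c0*q^(2*y+1))*(1-c4*c3*q^(2*x+1)))*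
      (Q q c1 c0 c4 (N+1-a) (j+1) y * Q q c4 c3 c2 (N+1-y) a x) =
    (1-q*c4)*(((1-c1*c0*q^(y+1))*(1-c0*q^(y+1)))*(-c0*c1*c4*q^(N+1)*q^(2*y+2))*Q q c1 (q*c0) (q*c4) (N-a) j y *
        ((1-c4*c3*q^(x+1))*(q^x-q^(N+1-y))*Q q (q*c4) c3 c2 (N-y) a x + (1-q^x)*(1-c4*c3*q^(N+1-y+x+1))*Q q (q*c4) c3 c2 (N-y) a (x-1))
     + ((q^y-1)*c0*(c1*q^y-1))*(c0*c1*q^(N+1)*q^(2*y+2))*Q q c1 (q*c0) (q*c4) (N-a) j (y-1) * 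
        ((1-c4*c3*q^(x+1))*(1-c4*c3*c2*q^(N+1-y+x+2))*Q q (q*c4) c3 c2 (N+1-y) a x + (1-q^x)*(c4*c3)*(q^(x+1)-c2*q^(N+1-y+2))*Q q (q*c4) c3 c2 (N+1-y) a (x-1))) := by
  have t1 := QT1 q c1 c0 c4 (N-a) j y g.hq g.n1 g.n0 (g.s1.mono (by omega)) (g.get 1 0 0 0 0 (by ring) (by omega))
    (g.get 1 1 0 0 1 (by ring) (by omega)) (g.get 1 0 0 0 1 (by ring) (by omega)) (g.get 1 1 0 0 0 (by ring) (by omega))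
  have t2 := QT2a q c4 c3 c2 (N+1-y) a x g.hq (by omega) (g.s1.mono (by omega)) (g.get 0 0 1 1 0 (by ring) (by omega))
  have t3 := QT2b q c4 c3 c2 (N+1-y) a x g.hq (by omega) (g.get 0 0 1 1 1 (by ring) (by omega))
  rw [show N-a+1 = N+1-a by omega] at t1
  rw [show N+1-y-1 = N-y by omega] at t2
  refine BC_aux (q^a) _ _ _ _ _ _ _ _ _ _ _ _ _ _ _ _ _ _ _ _ _ (pow_ne_zero _ g.hq) t1 t2 t3 ?_ ?_
  all_goals
    obtain ⟨m, rfl⟩ := Nat.exists_eq_add_of_le ha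
    obtain ⟨M, hM⟩ := Nat.exists_eq_add_of_le (show y ≤ a+m+1 by omega)
    have pr := g.pr
    have hN : q^a*q^m*q = q^y*q^M := by rw [← pow_add, ← pow_succ, hM, pow_add]
    rw [show a+m+1-y = M by omega, show a+m-a = m by omega]
    try rw [show a+m+1-a = m+1 by omega]
    rw [show 2*(a+m+1)+3 = (y+M)*2+3 by omega] at pr
    rw [hM]
    simp only [pow_add, pow_mul, pow_one, mul_comm 2 y] at *
    generalize q^a = A at *
    generalize q^m = B at *
    generalize q^y = Y at *
    generalize q^M = P at *
  · have f1 : A*(1-c1*c0*c4*(B*Y*q^3)) = -c0*c1*c4*Y*P*Y*q^2*(1-c3*c2*(A*P*q)) := by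
      linear_combination -A*pr - c0*c1*c4*Y*q^2*hN
    have f2 : A*(Y-B*q) = Y*(A-P) := by linear_combination -hN
    rw [f1, f2]; ring
  · have f3 : A*(Y*q-c4*(B*q^3)) = Y*q*(A-c4*(P*q)) := by linear_combination -c4*q^2*hN
    have f4 : A*(c1*c0*(B*Y*q^2)-1) = c0*c1*Y*P*Y*q*(1-c4*c3*c2*(P*q^2*A)) := by
      linear_combination A*pr + c0*c1*Y*q*hN
    rw [f3, f4]; ring
end BE

namespace BE
open qR Finset

def Sm (q c0 c1 c2 c3 c4 : ℂ) (N i j x y : ℕ) : ℂ := ∑ a ∈ range (N+1), 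
  Q q c3 c2 c1 (N-j) i a * (Q q c1 c0 c4 (N-a) j y * Q q c4 c3 c2 (N-y) a x) * (c1*q^N)^a
def Rm (q c0 c1 c2 c3 c4 : ℂ) (N i j x y : ℕ) : ℂ := Q q c3 c4 c0 (N-i) j x * Q q c0 c1 c2 (N-x) i y
def wL (q c0 c1 c2 c3 c4 : ℂ) (N i j x y : ℕ) : ℂ := 
  (c0*c1*c4*q^(N+2))^i * (c3*c4*q^(N+1))^j * (c1*c2*c4*q^(N+2))^x * (c1*c4*q^(N+1))^y
   * poch q (q*c0) j * poch q (q*c2) i * poch q (q*c0) y * poch q (q*c3) x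
def wR (q c1 c4 : ℂ) (N i j x y : ℕ) : ℂ := 
  poch q (q*c4) j * poch q (q*c1) i * poch q (q*c1) y * poch q (q*c4) x * (c1*c4*q^(N+1))^N
def Main (q c0 c1 c2 c3 c4 : ℂ) (N i j x y : ℕ) : Prop :=
  Sm q c0 c1 c2 c3 c4 N i j x y * wL q c0 c1 c2 c3 c4 N i j x y = Rm q c0 c1 c2 c3 c4 N i j x y * wR q c1 c4 N i j x y

lemma Sm_triv (q c0 c1 c2 c3 c4 : ℂ) (N i j x y : ℕ) (h : N < x + y) : Sm q c0 c1 c2 c3 c4 N i j x y = 0 := by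
  apply sum_eq_zero
  intro a _
  rcases Nat.lt_or_ge N y with h' | h'
  · rw [Q_x (x := y) (by omega)]; ring
  · rw [Q_x (x := x) (by omega)]; ring

lemma Rm_triv (q c0 c1 c2 c3 c4 : ℂ) (N i j x y : ℕ) (h : N < x + y) : Rm q c0 c1 c2 c3 c4 N i j x y = 0 := by
  unfold Rm
  rcases Nat.lt_or_ge N x with h' | h'
  · rw [Q_x (x := x) (by omega)]; ring
  · rw [Q_x (x := y) (by omega)]; ring

lemma Main_triv (q c0 c1 c2 c3 c4 : ℂ) (N i j x y : ℕ) (h : N < x + y) : Main q c0 c1 c2 c3 c4 N i j x y := by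
  unfold Main; rw [Sm_triv _ _ _ _ _ _ _ _ _ _ _ h, Rm_triv _ _ _ _ _ _ _ _ _ _ _ h]; ring

lemma lev (q a b c : ℂ) (N y n x : ℕ) : (q^y-1)*Q q a b c (N+1-y) n x = (q^y-1)*Q q a b c (N-(y-1)) n x := by
  rcases y with _ | y
  · simp
  · rw [Nat.add_sub_add_right]; rfl

lemma BC' (q c0 c1 c2 c3 c4 : ℂ) (N j a x y : ℕ) (g : G q c0 c1 c2 c3 c4 (N+1)) (ha : a ≤ N) (hxy : x+y ≤ N+1) :
    q^a*((1-q^(j+1))*(1-c0*c4*q^(j+2))*(1-q*c0)*q^y*(1-c1*c0*q^(2*y+1))*(1-c4*c3*q^(2*x+1)))*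
      (Q q c1 c0 c4 (N+1-a) (j+1) y * Q q c4 c3 c2 (N+1-y) a x) =
    (1-q*c4)*(((1-c1*c0*q^(y+1))*(1-c0*q^(y+1)))*(-c0*c1*c4*q^(N+1)*q^(2*y+2))* 
        ((1-c4*c3*q^(x+1))*(q^x-q^(N+1-y))*(Q q c1 (q*c0) (q*c4) (N-a) j y *Q q (q*c4) c3 c2 (N-y) a x) + (1-q^x)*(1-c4*c3*q^(N+1-y+x+1))*(Q q c1 (q*c0) (q*c4) (N-a) j y *Q q (q*c4) c3 c2 (N-y) a (x-1)))
     + ((q^y-1)*c0*(c1*q^y-1))*(c0*c1*q^(N+1)*q^(2*y+2))* 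
        ((1-c4*c3*q^(x+1))*(1-c4*c3*c2*q^(N+1-y+x+2))*(Q q c1 (q*c0) (q*c4) (N-a) j (y-1) * Q q (q*c4) c3 c2 (N-(y-1)) a x) + (1-q^x)*(c4*c3)*(q^(x+1)-c2*q^(N+1-y+2))*(Q q c1 (q*c0) (q*c4) (N-a) j (y-1) * Q q (q*c4) c3 c2 (N-(y-1)) a (x-1)))) := by
  rw [BC q c0 c1 c2 c3 c4 N j a x y g ha hxy]
  have h1 := lev q (q*c4) c3 c2 N y a x
  have h2 := lev q (q*c4) c3 c2 N y a (x-1)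
  generalize Q q c1 (q*c0) (q*c4) (N-a) j (y-1) = B
  linear_combination (1-q*c4)*(c0*(c1*q^y-1))*(c0*c1*q^(N+1)*q^(2*y+2))*B*((1-c4*c3*q^(x+1))*(1-c4*c3*c2*q^(N+1-y+x+2))*h1 + (1-q^x)*(c4*c3)*(q^(x+1)-c2*q^(N+1-y+2))*h2)

lemma Sm_j (q c0 c1 c2 c3 c4 : ℂ) (N i j x y : ℕ) (g : G q c0 c1 c2 c3 c4 (N+1)) (hxy : x+y ≤ N+1) :
    ((1-q^(j+1))*(1-c0*c4*q^(j+2))*(1-q*c0)*q^y*(1-c1*c0*q^(2*y+1))*(1-c4*c3*q^(2*x+1)))* Sm q c0 c1 c2 c3 c4 (N+1) i (j+1) x y =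
    (1-q*c4)*(((1-c1*c0*q^(y+1))*(1-c0*q^(y+1)))*(-c0*c1*c4*q^(N+1)*q^(2*y+2))* 
        ((1-c4*c3*q^(x+1))*(q^x-q^(N+1-y))*Sm q (q*c0) c1 c2 c3 (q*c4) N i j x y + (1-q^x)*(1-c4*c3*q^(N+1-y+x+1))*Sm q (q*c0) c1 c2 c3 (q*c4) N i j (x-1) y)
     + ((q^y-1)*c0*(c1*q^y-1))*(c0*c1*q^(N+1)*q^(2*y+2))* 
        ((1-c4*c3*q^(x+1))*(1-c4*c3*c2*q^(N+1-y+x+2))*Sm q (q*c0) c1 c2 c3 (q*c4) N i j x (y-1) + (1-q^x)*(c4*c3)*(q^(x+1)-c2*q^(N+1-y+2))*Sm q (q*c0) c1 c2 c3 (q*c4) N i j (x-1) (y-1))) := by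
  unfold Sm
  rw [sum_range_succ, Q_n (N := N+1-(N+1)) (n := j+1) (by omega), zero_mul, mul_zero, zero_mul, add_zero]
  simp only [mul_sum, ← sum_add_distrib]
  apply sum_congr rfl
  intro a ha
  have := BC' q c0 c1 c2 c3 c4 N j a x y g (by simp at ha; omega) hxy
  rw [Nat.add_sub_add_right, show (c1*q^(N+1))^a = (c1*q^N)^a*q^a by rw [← mul_pow]; ring]
  generalize (c1*q^N)^a = w at *
  linear_combination w * Q q c3 c2 c1 (N-j) i a * this

lemma Rm_j (q c0 c1 c2 c3 c4 : ℂ) (N i j x y : ℕ) (g : G q c0 c1 c2 c3 c4 (N+1)) (hi : i ≤ N) (hxy : x+y ≤ N+1) :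
    q^i*((1-q^(j+1))*(1-c4*c0*q^(j+2))*(1-q*c4)*q^x*(1-c3*c4*q^(2*x+1))*(1-c0*c1*q^(2*y+1)))* Rm q c0 c1 c2 c3 c4 (N+1) i (j+1) x y =
    (1-q*c0)*(((1-c3*c4*q^(x+1))*(1-c4*q^(x+1)))*(-c4*c3*c0*q^(N+1)*q^(2*x+2))* 
        ((1-c0*c1*q^(y+1))*(q^y-q^(N+1-x))*Rm q (q*c0) c1 c2 c3 (q*c4) N i j x y + (1-q^y)*(1-c0*c1*q^(N+1-x+y+1))*Rm q (q*c0) c1 c2 c3 (q*c4) N i j x (y-1))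
     + ((q^x-1)*c4*(c3*q^x-1))*(c4*c3*q^(N+1)*q^(2*x+2))* 
        ((1-c0*c1*q^(y+1))*(1-c0*c1*c2*q^(N+1-x+y+2))*Rm q (q*c0) c1 c2 c3 (q*c4) N i j (x-1) y + (1-q^y)*(c0*c1)*(q^(y+1)-c2*q^(N+1-x+2))*Rm q (q*c0) c1 c2 c3 (q*c4) N i j (x-1) (y-1))) := 
  BC' q c4 c3 c2 c1 c0 N j i y x g.symm hi (by omega)
end BE

namespace BE
open qR Finset

lemma J_aux (q c0 c1 c2 c3 c4 X Y Z I Wl Wr s00 s10 s01 s11 r00 r10 r01 r11 : ℂ)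
    (pr : c0*c1*c2*c3*c4*((X*Y*Z)^2*q^3) = 1)
    (T00 : (1-q*c4)^2*I*Wl*(1-c0*(Y*q))*c1*s00 = (1-q*c0)^2*c3*(1-c4*(X*q))*Wr*r00)
    (T10 : (1-X)*((1-q*c4)^2*I*Wl*(1-c0*(Y*q))*c1*s10) = (1-X)*((1-q*c0)^2*c3*(c1*c2*c4*(X*Y*Z*q^2))*(1-c3*X)*Wr*r10))
    (T01 : (Y-1)*((1-q*c4)^2*I*Wl*(1-c1*Y)*s01) = (Y-1)*((1-q*c0)^2*(c3*c4*(X*Y*Z*q))*(1-c4*(X*q))*Wr*r01))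
    (T11 : (1-X)*(Y-1)*((1-q*c4)^2*I*Wl*(1-c1*Y)*s11) = (1-X)*(Y-1)*((1-q*c0)^2*(c3*c4*(X*Y*Z*q))*(c1*c2*c4*(X*Y*Z*q^2))*(1-c3*X)*Wr*r11)) :
    (1-q*c4)*X*I*Wl*((1-q*c4)*(((1-c1*c0*(Y*q))*(1-c0*(Y*q)))*(-c0*c1*c4*(X*Y*Z)*(Y^2*q^2))* 
        ((1-c4*c3*(X*q))*(X-X*Z)*s00 + (1-X)*(1-c4*c3*(X*Z*X*q))*s10)
     + ((Y-1)*c0*(c1*Y-1))*(c0*c1*(X*Y*Z)*(Y^2*q^2))* 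
        ((1-c4*c3*(X*q))*(1-c4*c3*c2*(X*Z*X*q^2))*s01 + (1-X)*(c4*c3)*((X*q)-c2*(X*Z*q^2))*s11)))
    = (1-q*c0)*Y*Wr*((1-q*c0)*(((1-c3*c4*(X*q))*(1-c4*(X*q)))*(-c4*c3*c0*(X*Y*Z)*(X^2*q^2))* 
        ((1-c0*c1*(Y*q))*(Y-Y*Z)*r00 + (1-Y)*(1-c0*c1*(Y*Z*Y*q))*r01)
     + ((X-1)*c4*(c3*X-1))*(c4*c3*(X*Y*Z)*(X^2*q^2))* 
        ((1-c0*c1*(Y*q))*(1-c0*c1*c2*(Y*Z*Y*q^2))*r10 + (1-Y)*(c0*c1)*((Y*q)-c2*(Y*Z*q^2))*r11))) := by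
  have t00 : (1-q*c4)*X*I*Wl*((1-q*c4)*(((1-c1*c0*(Y*q))*(1-c0*(Y*q)))*(-c0*c1*c4*(X*Y*Z)*(Y^2*q^2))* 
        ((1-c4*c3*(X*q))*(X-X*Z)*s00))) = (1-q*c0)*Y*Wr*((1-q*c0)*(((1-c3*c4*(X*q))*(1-c4*(X*q)))*(-c4*c3*c0*(X*Y*Z)*(X^2*q^2))* 
        ((1-c0*c1*(Y*q))*(Y-Y*Z)*r00))) := by
    linear_combination X*(1-c1*c0*(Y*q))*(-c0*c4*(X*Y*Z)*(Y^2*q^2))*(1-c4*c3*(X*q))*(X-X*Z)*T00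
  have t10 : (1-q*c4)*X*I*Wl*((1-q*c4)*(((1-c1*c0*(Y*q))*(1-c0*(Y*q)))*(-c0*c1*c4*(X*Y*Z)*(Y^2*q^2))* 
        ((1-X)*(1-c4*c3*(X*Z*X*q))*s10))) = (1-q*c0)*Y*Wr*((1-q*c0)*(((X-1)*c4*(c3*X-1))*(c4*c3*(X*Y*Z)*(X^2*q^2))* 
        ((1-c0*c1*(Y*q))*(1-c0*c1*c2*(Y*Z*Y*q^2))*r10))) := by
    linear_combination X*(1-c1*c0*(Y*q))*(-c0*c4*(X*Y*Z)*(Y^2*q^2))*(1-c4*c3*(X*Z*X*q))*T10 + (1-q*c0)^2*Y*Wr*(X-1)*c4*(c3*X-1)*(c4*c3*(X*Y*Z)*(X^2*q^2))*(1-c0*c1*(Y*q))*r10*pr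
  have t01 : (1-q*c4)*X*I*Wl*((1-q*c4)*(((Y-1)*c0*(c1*Y-1))*(c0*c1*(X*Y*Z)*(Y^2*q^2))* 
        ((1-c4*c3*(X*q))*(1-c4*c3*c2*(X*Z*X*q^2))*s01))) = (1-q*c0)*Y*Wr*((1-q*c0)*(((1-c3*c4*(X*q))*(1-c4*(X*q)))*(-c4*c3*c0*(X*Y*Z)*(X^2*q^2))* 
        ((1-Y)*(1-c0*c1*(Y*Z*Y*q))*r01))) := by
    linear_combination -X*c0*(c0*c1*(X*Y*Z)*(Y^2*q^2))*(1-c4*c3*(X*q))*(1-c4*c3*c2*(X*Z*X*q^2))*T01 + (1-q*c0)^2*Y*Wr*c3*c4*c0*(X*Y*Z)*(X^2*q^2)*(1-c4*c3*(X*q))*(1-c4*(X*q))*(Y-1)*r01*pr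
  have t11 : (1-q*c4)*X*I*Wl*((1-q*c4)*(((Y-1)*c0*(c1*Y-1))*(c0*c1*(X*Y*Z)*(Y^2*q^2))* 
        ((1-X)*(c4*c3)*((X*q)-c2*(X*Z*q^2))*s11))) = (1-q*c0)*Y*Wr*((1-q*c0)*(((X-1)*c4*(c3*X-1))*(c4*c3*(X*Y*Z)*(X^2*q^2))* 
        ((1-Y)*(c0*c1)*((Y*q)-c2*(Y*Z*q^2))*r11))) := by
    linear_combination -X*c0*(c0*c1*(X*Y*Z)*(Y^2*q^2))*(c4*c3)*((X*q)-c2*(X*Z*q^2))*T11 + (1-q*c0)*Y*Wr*((1-q*c0)*(((X-1)*c4*(c3*X-1))*(c4*c3*(X*Y*Z)*(X^2*q^2))* 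
        ((1-Y)*(c0*c1)*((Y*q)-c2*(Y*Z*q^2))*r11)))*pr
  linear_combination t00 + t10 + t01 + t11

lemma L00 (q c0 c1 c2 c3 c4 : ℂ) (N i j x y : ℕ) : q^i*wL q c0 c1 c2 c3 c4 (N+1) i (j+1) x y*(1-c0*q^(y+1)) = 
    (c3*c4*q^(N+2))*(1-q*c0)^2*wL q (q*c0) c1 c2 c3 (q*c4) N i j x y := by
  unfold wL
  have e := poch_shift q (q*c0) y
  rw [show q*c0*q^y = c0*q^(y+1) by ring, show q*c0*q = q*(q*c0) by ring] at e
  rw [poch_succ' q (q*c0) j, show q*c0*q = q*(q*c0) by ring,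
    show q*c0*c1*(q*c4)*q^(N+2) = c0*c1*c4*q^(N+1+2)*q by ring,
    show c3*(q*c4)*q^(N+1) = c3*c4*q^(N+1+1) by ring,
    show c1*c2*(q*c4)*q^(N+2) = c1*c2*c4*q^(N+1+2) by ring,
    show c1*(q*c4)*q^(N+1) = c1*c4*q^(N+1+1) by ring, mul_pow _ q i, pow_succ _ j]
  generalize (c0*c1*c4*q^(N+1+2))^i = p1
  generalize (c3*c4*q^(N+1+1))^j = p2
  generalize (c1*c2*c4*q^(N+1+2))^x = p3
  generalize (c1*c4*q^(N+1+1))^y = p4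
  linear_combination -q^i*p1*p2*(c3*c4*q^(N+2))*p3*p4*(1-q*c0)*poch q (q*(q*c0)) j*poch q (q*c2) i*poch q (q*c3) x*e

lemma L10 (q c0 c1 c2 c3 c4 : ℂ) (N i j x y : ℕ) : wL q c0 c1 c2 c3 c4 N i j (x+1) y =
   c1*c2*c4*q^(N+2)*(1-c3*q^(x+1))*wL q c0 c1 c2 c3 c4 N i j x y := by
  unfold wL
  rw [pow_succ _ x, poch_succ]
  ring

lemma L01 (q c0 c1 c2 c3 c4 : ℂ) (N i j x y : ℕ) : q^i*wL q c0 c1 c2 c3 c4 (N+1) i (j+1) x (y+1) = 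
    (c3*c4*q^(N+2))*(c1*c4*q^(N+2))*(1-q*c0)^2*wL q (q*c0) c1 c2 c3 (q*c4) N i j x y := by
  unfold wL
  rw [poch_succ' q (q*c0) j, poch_succ' q (q*c0) y, show q*c0*q = q*(q*c0) by ring,
    show q*c0*c1*(q*c4)*q^(N+2) = c0*c1*c4*q^(N+1+2)*q by ring,
    show c3*(q*c4)*q^(N+1) = c3*c4*q^(N+1+1) by ring,
    show c1*c2*(q*c4)*q^(N+2) = c1*c2*c4*q^(N+1+2) by ring,
    show c1*(q*c4)*q^(N+1) = c1*c4*q^(N+1+1) by ring, mul_pow _ q i, pow_succ _ j, pow_succ _ y]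
  ring

lemma R10 (q c1 c4 : ℂ) (N i j x y : ℕ) : wR q c1 c4 (N+1) i (j+1) (x+1) y = (1-q*c4)^2*(c1*c4*q^(N+2))*wR q c1 (q*c4) N i j x y := by
  unfold wR
  rw [poch_succ' q (q*c4) j, poch_succ' q (q*c4) x, show q*c4*q = q*(q*c4) by ring, show c1*(q*c4)*q^(N+1) = c1*c4*q^(N+1+1) by ring, pow_succ _ N]
  ring

lemma R00 (q c1 c4 : ℂ) (N i j x y : ℕ) : wR q c1 c4 (N+1) i (j+1) x y*(1-c4*q^(x+1)) = (1-q*c4)^2*(c1*c4*q^(N+2))*wR q c1 (q*c4) N i j x y := by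
  rw [← R10]; unfold wR; rw [poch_succ q _ x]; ring

lemma R01 (q c1 c4 : ℂ) (N i j x y : ℕ) : wR q c1 c4 N i j x (y+1) = (1-c1*q^(y+1))*wR q c1 c4 N i j x y := by
  unfold wR; rw [poch_succ q _ y]; ring

lemma J_step (q c0 c1 c2 c3 c4 : ℂ) (N i j x y : ℕ) (g : G q c0 c1 c2 c3 c4 (N+1)) (hij : i+(j+1) ≤ N+1)
    (ih : ∀ x y, Main q (q*c0) c1 c2 c3 (q*c4) N i j x y) : Main q c0 c1 c2 c3 c4 (N+1) i (j+1) x y := by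
  rcases Nat.lt_or_ge (N+1) (x+y) with hxy | hxy
  · exact Main_triv _ _ _ _ _ _ _ _ _ _ _ hxy
  have h1 := Sm_j q c0 c1 c2 c3 c4 N i j x y g hxy
  have h2 := Rm_j q c0 c1 c2 c3 c4 N i j x y g (by omega) hxy
  unfold Main at *
  have T00 : (1-q*c4)^2*q^i*wL q c0 c1 c2 c3 c4 (N+1) i (j+1) x y*(1-c0*q^(y+1))*c1*Sm q (q*c0) c1 c2 c3 (q*c4) N i j x y
     = (1-q*c0)^2*c3*(1-c4*q^(x+1))*wR q c1 c4 (N+1) i (j+1) x y * Rm q (q*c0) c1 c2 c3 (q*c4) N i j x y := by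
    linear_combination (1-q*c4)^2*c1*Sm q (q*c0) c1 c2 c3 (q*c4) N i j x y*L00 q c0 c1 c2 c3 c4 N i j x y - (1-q*c0)^2*c3*Rm q (q*c0) c1 c2 c3 (q*c4) N i j x y*R00 q c1 c4 N i j x y
      + (1-q*c4)^2*c1*(c3*c4*q^(N+2))*(1-q*c0)^2*ih x y
  have T10 : (1-q^x)*((1-q*c4)^2*q^i*wL q c0 c1 c2 c3 c4 (N+1) i (j+1) x y*(1-c0*q^(y+1))*c1*Sm q (q*c0) c1 c2 c3 (q*c4) N i j (x-1) y)
     = (1-q^x)*((1-q*c0)^2*c3*(c1*c2*c4*q^(N+3))*(1-c3*q^x)*wR q c1 c4 (N+1) i (j+1) x y * Rm q (q*c0) c1 c2 c3 (q*c4) N i j (x-1) y) := by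
    rcases x with _ | x
    · simp
    congr 1
    rw [Nat.add_sub_cancel]
    have a1 := L00 q c0 c1 c2 c3 c4 N i j (x+1) y
    rw [L10 q (q*c0)] at a1
    have a2 := R10 q c1 c4 N i j x y
    linear_combination (1-q*c4)^2*c1*Sm q (q*c0) c1 c2 c3 (q*c4) N i j x y*a1 - (1-q*c0)^2*c3*(c1*c2*c4*q^(N+3))*(1-c3*q^(x+1))*Rm q (q*c0) c1 c2 c3 (q*c4) N i j x y*a2
      + (1-q*c4)^2*c1*(c3*c4*q^(N+2))*(1-q*c0)^2*(c1*c2*c4*q^(N+3))*(1-c3*q^(x+1))*ih x y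
  have T01 : (q^y-1)*((1-q*c4)^2*q^i*wL q c0 c1 c2 c3 c4 (N+1) i (j+1) x y*(1-c1*q^y)*Sm q (q*c0) c1 c2 c3 (q*c4) N i j x (y-1))
     = (q^y-1)*((1-q*c0)^2*(c3*c4*q^(N+2))*(1-c4*q^(x+1))*wR q c1 c4 (N+1) i (j+1) x y * Rm q (q*c0) c1 c2 c3 (q*c4) N i j x (y-1)) := by
    rcases y with _ | y
    · simp
    congr 1
    rw [Nat.add_sub_cancel]
    have a1 := L01 q c0 c1 c2 c3 c4 N i j x y
    have a2 := R00 q c1 c4 N i j x (y+1)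
    rw [R01 q c1 (q*c4)] at a2
    linear_combination (1-q*c4)^2*(1-c1*q^(y+1))*Sm q (q*c0) c1 c2 c3 (q*c4) N i j x y*a1 - (1-q*c0)^2*(c3*c4*q^(N+2))*Rm q (q*c0) c1 c2 c3 (q*c4) N i j x y*a2
      + (1-q*c4)^2*(c3*c4*q^(N+2))*(c1*c4*q^(N+2))*(1-q*c0)^2*(1-c1*q^(y+1))*ih x y
  have T11 : (1-q^x)*(q^y-1)*((1-q*c4)^2*q^i*wL q c0 c1 c2 c3 c4 (N+1) i (j+1) x y*(1-c1*q^y)*Sm q (q*c0) c1 c2 c3 (q*c4) N i j (x-1) (y-1))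
     = (1-q^x)*(q^y-1)*((1-q*c0)^2*(c3*c4*q^(N+2))*(c1*c2*c4*q^(N+3))*(1-c3*q^x)*wR q c1 c4 (N+1) i (j+1) x y * Rm q (q*c0) c1 c2 c3 (q*c4) N i j (x-1) (y-1)) := by
    rcases x with _ | x
    · simp
    rcases y with _ | y
    · simp
    congr 1
    rw [Nat.add_sub_cancel, Nat.add_sub_cancel]
    have a1 := L01 q c0 c1 c2 c3 c4 N i j (x+1) y
    rw [L10 q (q*c0)] at a1
    have a2 := R10 q c1 c4 N i j x (y+1)
    rw [R01 q c1 (q*c4)] at a2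
    linear_combination (1-q*c4)^2*(1-c1*q^(y+1))*Sm q (q*c0) c1 c2 c3 (q*c4) N i j x y*a1 - (1-q*c0)^2*(c3*c4*q^(N+2))*(c1*c2*c4*q^(N+3))*(1-c3*q^(x+1))*Rm q (q*c0) c1 c2 c3 (q*c4) N i j x y*a2
      + (1-q*c4)^2*(c3*c4*q^(N+2))*(c1*c4*q^(N+2))*(1-q*c0)^2*(c1*c2*c4*q^(N+3))*(1-c3*q^(x+1))*(1-c1*q^(y+1))*ih x y
  obtain ⟨z, hz⟩ := Nat.exists_eq_add_of_le hxy
  have pr := g.pr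
  have k0 : (1-q^(j+1))*(1-c0*c4*q^(j+2))*(1-c1*c0*q^(2*y+1))*(1-c4*c3*q^(2*x+1))*(1-q*c0)*(1-q*c4)*q^x*q^y*q^i ≠ 0 := by
    have := g.hq
    have n1 : 1-q^(j+1) ≠ 0 := by simpa using g.s1.ne (j+1) (by omega) (by omega)
    have n2 := (g.get 1 0 0 0 1 (c := c0*c4) (by ring) le_rfl).ne (j+2) (by omega) (by omega)
    have n3 := (g.get 1 1 0 0 0 (c := c1*c0) (by ring) le_rfl).ne (2*y+1) (by omega) (by omega)
    have n4 := (g.get 0 0 0 1 1 (c := c4*c3) (by ring) le_rfl).ne (2*x+1) (by omega) (by omega)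
    have n5 : 1 - q*c0 ≠ 0 := by simpa [mul_comm] using (g.get 1 0 0 0 0 (c := c0) (by ring) le_rfl).ne 1 (by omega) (by omega)
    have n6 : 1 - q*c4 ≠ 0 := by simpa [mul_comm] using (g.get 0 0 0 0 1 (c := c4) (by ring) le_rfl).ne 1 (by omega) (by omega)
    positivity
  apply mul_left_cancel₀ k0
  rw [show N+1-y = x+z by omega] at h1
  rw [show N+1-x = y+z by omega] at h2
  rw [show 2*(N+1)+3 = (x+y+z)*2+3 by omega] at pr
  have e1 : q^(N+1) = q^x*q^y*q^z := by rw [hz]; ring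
  have e2 : q^(N+2) = q^x*q^y*q^z*q := by rw [← e1]; ring
  have e3 : q^(N+3) = q^x*q^y*q^z*q^2 := by rw [← e1]; ring
  clear k0 ih hz g hxy hij
  generalize wL q c0 c1 c2 c3 c4 (N+1) i (j+1) x y = Wl at *
  generalize wR q c1 c4 (N+1) i (j+1) x y = Wr at *
  generalize Sm q c0 c1 c2 c3 c4 (N+1) i (j+1) x y = s at *
  generalize Rm q c0 c1 c2 c3 c4 (N+1) i (j+1) x y = r at *
  generalize Sm q (q*c0) c1 c2 c3 (q*c4) N i j x y = s00 at *
  generalize Sm q (q*c0) c1 c2 c3 (q*c4) N i j (x-1) y = s10 at *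
  generalize Sm q (q*c0) c1 c2 c3 (q*c4) N i j x (y-1) = s01 at *
  generalize Sm q (q*c0) c1 c2 c3 (q*c4) N i j (x-1) (y-1) = s11 at *
  generalize Rm q (q*c0) c1 c2 c3 (q*c4) N i j x y = r00 at *
  generalize Rm q (q*c0) c1 c2 c3 (q*c4) N i j (x-1) y = r10 at *
  generalize Rm q (q*c0) c1 c2 c3 (q*c4) N i j x (y-1) = r01 at *
  generalize Rm q (q*c0) c1 c2 c3 (q*c4) N i j (x-1) (y-1) = r11 at *
  rw [e1] at h1 h2
  rw [e2] at T01 T11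
  rw [e3] at T10 T11
  clear e1 e2 e3
  rw [mul_comm 2 x, mul_comm 2 y] at *
  simp only [pow_add, pow_mul, pow_one] at *
  generalize q^x = X at *
  generalize q^y = Y at *
  generalize q^z = Z at *
  generalize q^i = I at *
  generalize q^j = J at *
  have := J_aux q c0 c1 c2 c3 c4 X Y Z I Wl Wr s00 s10 s01 s11 r00 r10 r01 r11 pr T00 T10 T01 T11
  rw [← h1, ← h2] at this
  linear_combination this
end BE

namespace BE
open qR Finset

lemma shiftsum (f g A : ℕ → ℂ) (N : ℕ) (hf : f (N+1) = 0) (hg : g 0 = 0) :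
    ∑ a ∈ range (N+1+1), (f a * A a + g a * A (a-1)) = ∑ a ∈ range (N+1), A a * (f a + g (a+1)) := by
  rw [sum_add_distrib, sum_range_succ, sum_range_succ' (fun a => g a * A (a-1)), hf, hg]
  simp only [Nat.add_sub_cancel, mul_add, sum_add_distrib]
  simp [mul_comm]

def bp (q c0 c1 c4 : ℂ) (m : ℕ) : ℂ := poch q (q*c1) m / poch q (c0*c4*q^2) m

lemma BQ (q c0 c1 c2 c3 c4 : ℂ) (N a x y : ℕ) (ha : a ≤ N) (hy : y ≤ N) (h1 : S q 1 N) (h2 : 1-c0*c4*q ≠ 0) :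
    Q q c1 c0 c4 (N-a) 0 y * Q q c4 c3 c2 (N-y) a x = bp q c0 c1 c4 (N-a) * Q q c4 c3 c2 (N-y) a x := by
  rcases Nat.lt_or_ge (N-a) y with h | h
  · rw [Q_n (n := a) (by omega)]; ring
  · rw [Q_zero _ _ _ _ _ _ h (poch_ne _ _ _ (fun l hl => ?_)) h2]; rfl
    have := h1 (l+1) (by omega) (by omega)
    rwa [one_mul, pow_succ'] at this

lemma BR_aux (q c0 c1 c2 c3 c4 A X Y P b b1 b2 u v C1 C0 a1 a2 : ℂ) (pr : c0*c1*c2*c3*c4*((Y*P)^2*q^3) = 1) 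
    (hb1 : (1-c1*c2*c3*(Y*P*A*q^2))*a1*b1 = -c1*c2*c3*(Y*P*q^2)*(1-q*c1)*b)
    (hb2 : (A*q^2-c1*(Y*P*q^2))*a2*b2 = q*(1-q*c1)*b)
    (r3 : (X-P)*(1-c4*c3*(P*X*q))*C1 = X*((A-P)*(c3*q)*u+(1-c3*c2*(P*A*q^2))*v))
    (r3b : (1-c4*c3*c2*(P*X*q^2))*(X-c2*(P*q))*C0 = X*((1-c4*c3*c2*(P*A*q^2))*u+(A-c4*P)*(c2*q)*v)) :
    X*(1-c0*c1*(Y^2*q))*((1-c1*c2*c3*(Y*P*A*q^2))*(A-Y*P)*a1*u*b1 + c2*(A*q^2-c1*(Y*P*q^2))*(c2*c3*(Y*P*A*q^2)-1)*a2*v*b2*(c1*(Y*P)))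
     = (1-q*c1)*(-c1*c2*(Y*P*q*Y)*(1-c0*c1*(Y*q))*((X-P)*(1-c4*c3*(P*X*q)))*(b*C1) + c0*c1^2*c2*c3*((Y*P)^2*q^3*Y)*((1-Y)*(1-c4*c3*c2*(P*X*q^2))*(X-c2*(P*q)))*(b*C0)) := by
  have k : X*(1-c0*c1*(Y^2*q))*((-c1*c2*c3*(Y*P*q^2))*(A-Y*P)*u + c2*q*(c2*c3*(Y*P*A*q^2)-1)*v*(c1*(Y*P))) = 
     -c1*c2*(Y*P*q*Y)*(1-c0*c1*(Y*q))*((X-P)*(1-c4*c3*(P*X*q)))*(C1) + c0*c1^2*c2*c3*((Y*P)^2*q^3*Y)*((1-Y)*(1-c4*c3*c2*(P*X*q^2))*(X-c2*(P*q)))*(C0) := by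
    have z1 : -c1*c2*(Y*P*q*Y)*(1-c0*c1*(Y*q))*((X-P)*(1-c4*c3*(P*X*q)))*(C1) = -c1*c2*(Y*P*q*Y)*(1-c0*c1*(Y*q))*(X*((A-P)*(c3*q)*u+(1-c3*c2*(P*A*q^2))*v)) := by rw [← r3]; ring
    have z2 : c0*c1^2*c2*c3*((Y*P)^2*q^3*Y)*((1-Y)*(1-c4*c3*c2*(P*X*q^2))*(X-c2*(P*q)))*(C0) = c0*c1^2*c2*c3*((Y*P)^2*q^3*Y)*(1-Y)*(X*((1-c4*c3*c2*(P*A*q^2))*u+(A-c4*P)*(c2*q)*v)) := by rw [← r3b]; ring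
    rw [z1, z2]
    have cu : (1-c0*c1*(Y^2*q))*((-c1*c2*c3*(Y*P*q^2))*(A-Y*P)) = -c1*c2*(Y*P*q*Y)*(1-c0*c1*(Y*q))*((A-P)*(c3*q)) + c0*c1^2*c2*c3*((Y*P)^2*q^3*Y)*(1-Y)*(1-c4*c3*c2*(P*A*q^2)) := by
      linear_combination (c1*c2*c3*Y*P*q^2*A*(1-Y))*pr
    have cv : (1-c0*c1*(Y^2*q))*(c2*q*(c2*c3*(Y*P*A*q^2)-1)*(c1*(Y*P))) = -c1*c2*(Y*P*q*Y)*(1-c0*c1*(Y*q))*(1-c3*c2*(P*A*q^2)) + c0*c1^2*c2*c3*((Y*P)^2*q^3*Y)*(1-Y)*((A-c4*P)*(c2*q)) := by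
      linear_combination (c1*c2*Y*P*q*(1-Y))*pr
    linear_combination X*u*cu + X*v*cv
  linear_combination (1-q*c1)*b*k + X*(1-c0*c1*(Y^2*q))*(A-Y*P)*u*hb1 + X*(1-c0*c1*(Y^2*q))*c2*(c2*c3*(Y*P*A*q^2)-1)*v*(c1*(Y*P))*hb2

lemma BR (q c0 c1 c2 c3 c4 : ℂ) (N a x y : ℕ) (g : G q c0 c1 c2 c3 c4 (N+1)) (ha : a ≤ N) (hxy : x+y ≤ N+1) :
    q^x*(1-c0*c1*q^(2*y+1))*(
      (1-c3*c2*q^(a+1))*(1-c2*q^(a+1))*(1-c3*c2*c1*q^(N+a+3))*(q^a-q^(N+1))/(q^a*(1-c3*c2*q^(2*a+1)))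
         *(Q q c1 c0 c4 (N+1-a) 0 y * Q q c4 c3 c2 (N+1-y) a x)
      + (q^(a+1)-1)*c2*(c3*q^(a+1)-1)*(q^(a+1+1)-c1*q^(N+3))*(c3*c2*q^(N+(a+1)+2)-1)/(q^(a+1)*(1-c3*c2*q^(2*(a+1)+1)))
         *(Q q c1 c0 c4 (N+1-(a+1)) 0 y * Q q c4 c3 c2 (N+1-y) (a+1) x)*(c1*q^(N+1)))
    = (1-q*c1)*(-c1*c2*(q^(N+1)*q*q^y)*(1-c0*c1*q^(y+1))*((q^x-q^(N+1-y))*(1-c4*c3*q^(N+1-y+x+1)))*(Q q (q*c1) c0 c4 (N-a) 0 y * Q q c4 c3 (q*c2) (N-y) a x)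
       + c0*c1^2*c2*c3*((q^(N+1))^2*q^3*q^y)*((1-q^y)*(1-c4*c3*c2*q^(N+1-y+x+2))*(q^x-c2*q^(N+1-y+1)))*(Q q (q*c1) c0 c4 (N-a) 0 (y-1) * Q q c4 c3 (q*c2) (N-(y-1)) a x)) := by
  have hq := g.hq
  have s04 : 1-c0*c4*q ≠ 0 := by simpa using (g.get 1 0 0 0 1 (c := c0*c4) (by ring) le_rfl).ne 1 (by omega) (by omega)
  have b1 := BQ q c0 c1 c2 c3 c4 (N+1) a x y (by omega) (by omega) g.s1 s04
  have b2 := BQ q c0 c1 c2 c3 c4 (N+1) (a+1) x y (by omega) (by omega) g.s1 s04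
  have b3 : (q^x-q^(N+1-y))*(Q q (q*c1) c0 c4 (N-a) 0 y * Q q c4 c3 (q*c2) (N-y) a x) = (q^x-q^(N+1-y))*(bp q c0 (q*c1) c4 (N-a) * Q q c4 c3 (q*c2) (N-y) a x) := by
    rcases Nat.lt_or_ge N y with h | h
    · rw [show N+1-y = x by omega]; ring
    · rw [BQ q c0 (q*c1) (q*c2) c3 c4 N a x y ha h (g.s1.mono (by omega)) s04]
  have b4 := BQ q c0 (q*c1) (q*c2) c3 c4 N a x (y-1) ha (by omega) (g.s1.mono (by omega)) s04
  have b5 := lev q c4 c3 (q*c2) N y a x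
  have r3 := QT3 q c4 c3 c2 (N+1-y) a x hq g.n4 g.n3 g.n2 (by omega) (g.s1.mono (by omega)) (g.get 0 0 0 1 0 (by ring) (by omega)) (g.get 0 0 1 1 1 (by ring) (by omega)) (g.get 0 0 1 1 0 (by ring) (by omega))
  have r3b := QT3b q c4 c3 c2 (N+1-y) a x hq g.n4 g.n3 g.n2 (by omega) (g.s1.mono (by omega)) (g.get 0 0 0 1 0 (by ring) (by omega)) (g.get 0 0 1 1 1 (by ring) (by omega)) (g.get 0 0 1 1 0 (by ring) (by omega))
  rw [show N+1-y-1 = N-y by omega] at r3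
  rw [b1, b2, b4]
  have hu : (1-c3*c2*q^(a+1))*(1-c2*q^(a+1))*(1-c3*c2*c1*q^(N+a+3))*(q^a-q^(N+1))/(q^a*(1-c3*c2*q^(2*a+1)))
         *(bp q c0 c1 c4 (N+1-a) * Q q c4 c3 c2 (N+1-y) a x) = (1-c1*c2*c3*q^(N+a+3))*(q^a-q^(N+1))*(q^a)⁻¹*U q c4 c3 c2 (N+1-y) a x*bp q c0 c1 c4 (N+1-a) := by
    unfold U
    rw [mul_inv_rev _ _ |> fun h => div_eq_mul_inv _ (q^a*(1-c3*c2*q^(2*a+1))) |>.trans (by rw [h]), div_eq_mul_inv]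
    ring
  have hv : (q^(a+1)-1)*c2*(c3*q^(a+1)-1)*(q^(a+1+1)-c1*q^(N+3))*(c3*c2*q^(N+(a+1)+2)-1)/(q^(a+1)*(1-c3*c2*q^(2*(a+1)+1)))
         *(bp q c0 c1 c4 (N+1-(a+1)) * Q q c4 c3 c2 (N+1-y) (a+1) x)*(c1*q^(N+1)) = c2*(q^(a+2)-c1*q^(N+3))*(c2*c3*q^(N+a+3)-1)*(q^(a+1))⁻¹*V q c4 c3 c2 (N+1-y) a x*bp q c0 c1 c4 (N-a)*(c1*q^(N+1)) := by
    unfold V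
    rw [Nat.add_sub_add_right, mul_inv_rev _ _ |> fun h => div_eq_mul_inv _ (q^(a+1)*(1-c3*c2*q^(2*(a+1)+1))) |>.trans (by rw [h]), div_eq_mul_inv, show 2*(a+1)+1 = 2*a+3 by omega, show N+(a+1)+2 = N+a+3 by omega]
    ring
  rw [hu, hv]
  obtain ⟨m, rfl⟩ := Nat.exists_eq_add_of_le ha
  have pr := g.pr
  have hb1 : (1-c0*c4*q^(m+2))*bp q c0 c1 c4 (m+1) = (1-q*c1)*bp q c0 (q*c1) c4 m := by
    unfold bp
    have n1 := (g.get 1 0 0 0 1 (c := c0*c4) (by ring) le_rfl).ne (m+2) (by omega) (by omega)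
    rw [poch_succ' q (q*c1), poch_succ q (c0*c4*q^2), show c0*c4*q^2*q^m = c0*c4*q^(m+2) by ring, show q*c1*q = q*(q*c1) by ring, div_eq_mul_inv, mul_inv, div_eq_mul_inv]
    linear_combination (1-q*c1)*poch q (q*(q*c1)) m*(poch q (c0*c4*q^2) m)⁻¹*(mul_inv_cancel₀ n1)
  have hb2 : (1-c1*q^(m+1))*bp q c0 c1 c4 m = (1-q*c1)*bp q c0 (q*c1) c4 m := by
    unfold bp
    have := poch_shift q (q*c1) m
    rw [show q*c1*q = q*(q*c1) by ring] at this
    simp only [div_eq_mul_inv]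
    linear_combination -(poch q (c0*c4*q^2) m)⁻¹*this
  obtain ⟨M, hM⟩ := Nat.exists_eq_add_of_le (show y ≤ a+m+1 by omega)
  have hN : q^a*q^m*q = q^y*q^M := by rw [← pow_add, ← pow_succ, hM, pow_add]
  have hqa : q^a ≠ 0 := pow_ne_zero _ hq
  clear hu hv b1 b2 b4
  rw [show a+m-a = m by omega] at *
  rw [show a+m+1-a = m+1 by omega, show a+m+1-y = M by omega] at *
  rw [show 2*(a+m+1)+3 = (y+M)*2+3 by omega] at pr
  rw [show a+m+a+3 = y+M+a+2 by omega, show a+m+3 = y+M+2 by omega, show a+m+1 = y+M from hM, show q^(2*y+1) = (q^y)^2*q by ring]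
  simp only [pow_add, pow_mul, pow_one] at *
  generalize U q c4 c3 c2 M a x = u at *
  generalize V q c4 c3 c2 M a x = v at *
  generalize bp q c0 (q*c1) c4 m = b at *
  generalize bp q c0 c1 c4 m = bb2 at *
  generalize bp q c0 c1 c4 (m+1) = bb1 at *
  generalize Q q (q*c1) c0 c4 m 0 y * Q q c4 c3 (q*c2) (a+m-y) a x = BC1 at *
  generalize Q q c4 c3 (q*c2) (a+m-y) a x = C1 at *
  generalize Q q c4 c3 (q*c2) (a+m-(y-1)) a x = C0' at *
  generalize Q q c4 c3 (q*c2) M a x = C0 at *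
  generalize q^a = A at *
  generalize q^m = B at *
  generalize q^y = Y at *
  generalize q^M = P at *
  generalize q^x = X at *
  have ia := mul_inv_cancel₀ hqa
  have iq := mul_inv_cancel₀ hq
  rw [mul_inv]
  have := BR_aux q c0 c1 c2 c3 c4 A X Y P b bb1 bb2 u v C1 C0 A⁻¹ (A⁻¹*q⁻¹) pr ?_ ?_ r3 r3b
  · rw [this]
    linear_combination -(1-q*c1)*c1*c2*(Y*P*q*Y)*(1-c0*c1*(Y*q))*(1-c4*c3*(P*X*q))*(-b3) - (1-q*c1)*c0*c1^2*c2*c3*((Y*P)^2*q^3*Y)*(1-c4*c3*c2*(P*X*q^2))*(X-c2*(P*q))*b*b5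
  · generalize A⁻¹ = Ai at *
    have f1 : (1-c1*c2*c3*(Y*P*A*q^2)) = -c1*c2*c3*(Y*P*A*q^2)*(1-c0*c4*(B*q^2)) := by
      linear_combination -pr - c0*c1*c2*c3*c4*Y*P*q^3*hN
    rw [f1]
    linear_combination -c1*c2*c3*(Y*P*A*q^2)*Ai*hb1 - c1*c2*c3*(Y*P*q^2)*(1-q*c1)*b*ia
  · generalize A⁻¹ = Ai at *
    generalize q⁻¹ = qi at *
    have f2 : (A*q^2-c1*(Y*P*q^2)) = A*q^2*(1-c1*(B*q)) := by linear_combination c1*q^2*hN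
    rw [f2]
    linear_combination A*q^2*Ai*qi*hb2 + q*(1-q*c1)*b*(q*qi*ia+iq)
end BE

namespace BE
open qR Finset

lemma Sm_i (q c0 c1 c2 c3 c4 : ℂ) (N i x y : ℕ) (g : G q c0 c1 c2 c3 c4 (N+1)) (hxy : x+y ≤ N+1) :
    ((1-q^(i+1))*(1-c2*c1*q^(i+2))*(1-q*c2))*(q^x*(1-c0*c1*q^(2*y+1)))* Sm q c0 c1 c2 c3 c4 (N+1) (i+1) 0 x y =
    (1-q*c1)*(-c1*c2*(q^(N+1)*q*q^y)*(1-c0*c1*q^(y+1))*((q^x-q^(N+1-y))*(1-c4*c3*q^(N+1-y+x+1)))*Sm q c0 (q*c1) (q*c2) c3 c4 N i 0 x y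
       + c0*c1^2*c2*c3*((q^(N+1))^2*q^3*q^y)*((1-q^y)*(1-c4*c3*c2*q^(N+1-y+x+2))*(q^x-c2*q^(N+1-y+1)))*Sm q c0 (q*c1) (q*c2) c3 c4 N i 0 x (y-1)) := by
  have hq := g.hq
  have key : ((1-q^(i+1))*(1-c2*c1*q^(i+2))*(1-q*c2)) * Sm q c0 c1 c2 c3 c4 (N+1) (i+1) 0 x y = 
     ∑ a ∈ range (N+1+1), (
      ((1-c3*c2*q^(a+1))*(1-c2*q^(a+1))*(1-c3*c2*c1*q^(N+a+3))*(q^a-q^(N+1))/(q^a*(1-c3*c2*q^(2*a+1)))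
         *(Q q c1 c0 c4 (N+1-a) 0 y * Q q c4 c3 c2 (N+1-y) a x)*(c1*q^(N+1))^a) * Q q c3 (q*c2) (q*c1) N i a
      + ((q^a-1)*c2*(c3*q^a-1)*(q^(a+1)-c1*q^(N+3))*(c3*c2*q^(N+a+2)-1)/(q^a*(1-c3*c2*q^(2*a+1)))
         *(Q q c1 c0 c4 (N+1-a) 0 y * Q q c4 c3 c2 (N+1-y) a x)*(c1*q^(N+1))^a) * Q q c3 (q*c2) (q*c1) N i (a-1)) := by
    unfold Sm
    rw [mul_sum]
    apply sum_congr rfl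
    intro a ha
    rw [mem_range] at ha
    have h := QT1 q c3 c2 c1 N i a hq g.n3 g.n2 g.s1 (g.get 0 0 1 0 0 (by ring) (by omega)) (g.get 0 1 1 1 0 (by ring) (by omega)) (g.get 0 1 1 0 0 (by ring) (by omega)) (g.get 0 0 1 1 0 (by ring) (by omega))
    have nd := (g.get 0 0 1 1 0 (c := c3*c2) (by ring) le_rfl).ne (2*a+1) (by omega) (by omega)
    have nq : q^a ≠ 0 := pow_ne_zero _ hq
    rw [Nat.sub_zero]
    generalize Q q c1 c0 c4 (N+1-a) 0 y * Q q c4 c3 c2 (N+1-y) a x = B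
    generalize (c1*q^(N+1))^a = w
    have nn : q^a*(1-c3*c2*q^(2*a+1)) ≠ 0 := mul_ne_zero nq nd
    simp only [div_eq_mul_inv]
    have hi := mul_inv_cancel₀ nn
    generalize (q^a*(1-c3*c2*q^(2*a+1)))⁻¹ = v at *
    linear_combination B*w*v*h - ((1-q^(i+1))*(1-c2*c1*q^(i+2))*(1-q*c2))*B*w*Q q c3 c2 c1 (N+1) (i+1) a*hi
  rw [shiftsum _ _ _ _ (by simp) (by simp)] at key
  have key2 : ((1-q^(i+1))*(1-c2*c1*q^(i+2))*(1-q*c2))*(q^x*(1-c0*c1*q^(2*y+1)))* Sm q c0 c1 c2 c3 c4 (N+1) (i+1) 0 x y = (q^x*(1-c0*c1*q^(2*y+1))) * (((1-q^(i+1))*(1-c2*c1*q^(i+2))*(1-q*c2)) * Sm q c0 c1 c2 c3 c4 (N+1) (i+1) 0 x y) := by ring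
  rw [key2, key]
  unfold Sm
  simp only [mul_sum, ← sum_add_distrib]
  apply sum_congr rfl
  intro a ha
  rw [mem_range] at ha
  have h := BR q c0 c1 c2 c3 c4 N a x y g (by omega) hxy
  rw [show q*c1*q^N = c1*q^(N+1) by ring, Nat.sub_zero, pow_succ (c1*q^(N+1)) a]
  generalize (c1*q^(N+1))^a = w
  linear_combination w*Q q c3 (q*c2) (q*c1) N i a * h

lemma Rm_i (q c0 c1 c2 c3 c4 : ℂ) (N i x y : ℕ) (g : G q c0 c1 c2 c3 c4 (N+1)) (hxy : x+y ≤ N+1) :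
    ((1-q^(i+1))*(1-c1*c2*q^(i+2))*(1-q*c1))*(q^y*(1-c0*c1*q^(2*y+1)))* Rm q c0 c1 c2 c3 c4 (N+1) (i+1) 0 x y =
    (1-c0*c1*q^(y+1))*(1-c1*q^(y+1))*(1-c0*c1*c2*q^(N+1-x+y+2))*(q^y-q^(N+1-x))*Rm q c0 (q*c1) (q*c2) c3 c4 N i 0 x y
     +(q^y-1)*c1*(c0*q^y-1)*(q^(y+1)-c2*q^(N+1-x+2))*(c0*c1*q^(N+1-x+y+1)-1)*Rm q c0 (q*c1) (q*c2) c3 c4 N i 0 x (y-1) := by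
  unfold Rm
  rcases Nat.lt_or_ge N x with hx | hx
  · have hy : y = 0 := by omega
    subst hy
    rw [show N+1-x = 0 by omega, Q_n (N := 0) (n := i+1) (by omega)]
    simp
  · have h := QT1 q c0 c1 c2 (N-x) i y g.hq g.n0 g.n1 (g.s1.mono (by omega)) (g.get 0 1 0 0 0 (by ring) (by omega)) (g.get 1 1 1 0 0 (by ring) (by omega)) (g.get 0 1 1 0 0 (by ring) (by omega)) (g.get 1 1 0 0 0 (by ring) (by omega))
    rw [Nat.add_sub_add_right, show N+1-x = N-x+1 by omega]
    rw [show N-x+y+3 = N-x+1+y+2 by ring, show N-x+y+2 = N-x+1+y+1 by ring, show N-x+3 = N-x+1+2 by ring] at h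
    linear_combination Q q c3 c4 c0 (N-i) 0 x * h

lemma I_aux (q c0 c1 c2 c3 c4 X Y Z Wl Wr s0 s1 r0 r1 : ℂ)
    (pr : c0*c1*c2*c3*c4*((X*Y*Z)^2*q^3) = 1)
    (T0 : (1-q*c1)^2*Wl*X*s0 = c0*q*(1-q*c2)*(1-c1*(Y*q))*Wr*r0)
    (T1 : (1-Y)*((1-q*c1)^2*Wl*X*s1) = (1-Y)*(c0*q*(1-q*c2)*(c1*c4*(X*Y*Z*q))*(1-c0*Y)*Wr*r1)) :
    (1-q*c1)*Y*X*Wl*((1-q*c1)*(-c1*c2*(X*Y*Z*q*Y)*(1-c0*c1*(Y*q))*((X-X*Z)*(1-c4*c3*(X*Z*X*q)))*s0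
       + c0*c1^2*c2*c3*((X*Y*Z)^2*q^3*Y)*((1-Y)*(1-c4*c3*c2*(X*Z*X*q^2))*(X-c2*(X*Z*q)))*s1))
    = (1-q*c2)*X^2*Wr*((1-c0*c1*(Y*q))*(1-c1*(Y*q))*(1-c0*c1*c2*(Y*Z*Y*q^2))*(Y-Y*Z)*r0
     +(Y-1)*c1*(c0*Y-1)*(Y*q-c2*(Y*Z*q^2))*(c0*c1*(Y*Z*Y*q)-1)*r1) := by
  have t0 : (1-q*c1)*Y*X*Wl*((1-q*c1)*(-c1*c2*(X*Y*Z*q*Y)*(1-c0*c1*(Y*q))*((X-X*Z)*(1-c4*c3*(X*Z*X*q)))*s0)) = 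
     (1-q*c2)*X^2*Wr*((1-c0*c1*(Y*q))*(1-c1*(Y*q))*(1-c0*c1*c2*(Y*Z*Y*q^2))*(Y-Y*Z)*r0) := by
    linear_combination Y*(-c1*c2*(X*Y*Z*q*Y)*(1-c0*c1*(Y*q))*((X-X*Z)*(1-c4*c3*(X*Z*X*q))))*T0 + (1-q*c2)*X^2*Wr*(1-c0*c1*Y*q)*(1-c1*Y*q)*(Y-Y*Z)*r0*pr
  have t1 : (1-q*c1)*Y*X*Wl*((1-q*c1)*(c0*c1^2*c2*c3*((X*Y*Z)^2*q^3*Y)*((1-Y)*(1-c4*c3*c2*(X*Z*X*q^2))*(X-c2*(X*Z*q)))*s1)) = 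
     (1-q*c2)*X^2*Wr*((Y-1)*c1*(c0*Y-1)*(Y*q-c2*(Y*Z*q^2))*(c0*c1*(Y*Z*Y*q)-1)*r1) := by
    linear_combination Y*(c0*c1^2*c2*c3*((X*Y*Z)^2*q^3*Y)*((1-c4*c3*c2*(X*Z*X*q^2))*(X-c2*(X*Z*q))))*T1 + (1-q*c2)*X^2*Wr*(1-Y)*(1-c0*Y)*c1*Y*q*(1-c2*Z*q)*r1*((c0*c1*Y^2*Z*q)*(1-c2*c3*c4*X^2*Z*q^2)-1)*pr
  linear_combination t0 + t1
end BE

namespace BE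
open qR Finset

lemma LI0 (q c0 c1 c2 c3 c4 : ℂ) (N i x y : ℕ) : wL q c0 c1 c2 c3 c4 (N+1) (i+1) 0 x y*q^x = 
    (c0*c1*c4*q^(N+3))*(1-q*c2)*wL q c0 (q*c1) (q*c2) c3 c4 N i 0 x y := by
  unfold wL
  rw [poch_succ' q (q*c2) i, show q*c2*q = q*(q*c2) by ring,
    show c0*(q*c1)*c4*q^(N+2) = c0*c1*c4*q^(N+1+2) by ring,
    show q*c1*(q*c2)*c4*q^(N+2) = c1*c2*c4*q^(N+1+2)*q by ring,
    show q*c1*c4*q^(N+1) = c1*c4*q^(N+1+1) by ring, mul_pow _ q x, pow_succ _ i]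
  ring

lemma LI1 (q c0 c1 c2 c3 c4 : ℂ) (N i j x y : ℕ) : wL q c0 c1 c2 c3 c4 N i j x (y+1) = 
    (c1*c4*q^(N+1))*(1-c0*q^(y+1))*wL q c0 c1 c2 c3 c4 N i j x y := by
  unfold wL
  rw [pow_succ _ y, poch_succ q _ y]
  ring

lemma RI1 (q c1 c4 : ℂ) (N i x y : ℕ) : wR q c1 c4 (N+1) (i+1) 0 x (y+1) = (1-q*c1)^2*(c1*c4*q^(N+2))*wR q (q*c1) c4 N i 0 x y := by
  unfold wR
  rw [poch_succ' q (q*c1) i, poch_succ' q (q*c1) y, show q*c1*q = q*(q*c1) by ring, show (q*c1)*c4*q^(N+1) = c1*c4*q^(N+1+1) by ring, pow_succ _ N]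
  ring

lemma RI0 (q c1 c4 : ℂ) (N i x y : ℕ) : wR q c1 c4 (N+1) (i+1) 0 x y*(1-c1*q^(y+1)) = (1-q*c1)^2*(c1*c4*q^(N+2))*wR q (q*c1) c4 N i 0 x y := by
  rw [← RI1]; unfold wR; rw [poch_succ q _ y]; ring

lemma I_step (q c0 c1 c2 c3 c4 : ℂ) (N i x y : ℕ) (g : G q c0 c1 c2 c3 c4 (N+1)) (hi : i ≤ N)
    (ih : ∀ x y, Main q c0 (q*c1) (q*c2) c3 c4 N i 0 x y) : Main q c0 c1 c2 c3 c4 (N+1) (i+1) 0 x y := by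
  rcases Nat.lt_or_ge (N+1) (x+y) with hxy | hxy
  · exact Main_triv _ _ _ _ _ _ _ _ _ _ _ hxy
  have h1 := Sm_i q c0 c1 c2 c3 c4 N i x y g hxy
  have h2 := Rm_i q c0 c1 c2 c3 c4 N i x y g hxy
  unfold Main at *
  have T0 : (1-q*c1)^2*wL q c0 c1 c2 c3 c4 (N+1) (i+1) 0 x y*q^x*Sm q c0 (q*c1) (q*c2) c3 c4 N i 0 x y
     = c0*q*(1-q*c2)*(1-c1*q^(y+1))*wR q c1 c4 (N+1) (i+1) 0 x y * Rm q c0 (q*c1) (q*c2) c3 c4 N i 0 x y := by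
    linear_combination (1-q*c1)^2*Sm q c0 (q*c1) (q*c2) c3 c4 N i 0 x y*LI0 q c0 c1 c2 c3 c4 N i x y - c0*q*(1-q*c2)*Rm q c0 (q*c1) (q*c2) c3 c4 N i 0 x y*RI0 q c1 c4 N i x y
      + (1-q*c1)^2*(c0*c1*c4*q^(N+3))*(1-q*c2)*ih x y
  have T1 : (1-q^y)*((1-q*c1)^2*wL q c0 c1 c2 c3 c4 (N+1) (i+1) 0 x y*q^x*Sm q c0 (q*c1) (q*c2) c3 c4 N i 0 x (y-1))
     = (1-q^y)*(c0*q*(1-q*c2)*(c1*c4*q^(N+2))*(1-c0*q^y)*wR q c1 c4 (N+1) (i+1) 0 x y * Rm q c0 (q*c1) (q*c2) c3 c4 N i 0 x (y-1)) := by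
    rcases y with _ | y
    · simp
    congr 1
    rw [Nat.add_sub_cancel]
    have a1 := LI0 q c0 c1 c2 c3 c4 N i x (y+1)
    rw [LI1 q c0 (q*c1) (q*c2)] at a1
    have a2 := RI1 q c1 c4 N i x y
    linear_combination (1-q*c1)^2*Sm q c0 (q*c1) (q*c2) c3 c4 N i 0 x y*a1 - c0*q*(1-q*c2)*(c1*c4*q^(N+2))*(1-c0*q^(y+1))*Rm q c0 (q*c1) (q*c2) c3 c4 N i 0 x y*a2
      + (1-q*c1)^2*(c0*c1*c4*q^(N+3))*(1-q*c2)*(c1*c4*q^(N+2))*(1-c0*q^(y+1))*ih x y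
  obtain ⟨z, hz⟩ := Nat.exists_eq_add_of_le hxy
  have pr := g.pr
  have k0 : ((1-q^(i+1))*(1-c2*c1*q^(i+2)))*(1-c0*c1*q^(2*y+1))*(1-q*c2)*(1-q*c1)*(q^x)^2*q^y ≠ 0 := by
    have := g.hq
    have n1 : 1-q^(i+1) ≠ 0 := by simpa using g.s1.ne (i+1) (by omega) (by omega)
    have n2 := (g.get 0 1 1 0 0 (c := c2*c1) (by ring) le_rfl).ne (i+2) (by omega) (by omega)
    have n3 := (g.get 1 1 0 0 0 (c := c0*c1) (by ring) le_rfl).ne (2*y+1) (by omega) (by omega)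
    have n5 : 1 - q*c2 ≠ 0 := by simpa [mul_comm] using (g.get 0 0 1 0 0 (c := c2) (by ring) le_rfl).ne 1 (by omega) (by omega)
    have n6 : 1 - q*c1 ≠ 0 := by simpa [mul_comm] using (g.get 0 1 0 0 0 (c := c1) (by ring) le_rfl).ne 1 (by omega) (by omega)
    positivity
  apply mul_left_cancel₀ k0
  rw [show N+1-y = x+z by omega] at h1
  rw [show N+1-x = y+z by omega] at h2
  rw [show 2*(N+1)+3 = (x+y+z)*2+3 by omega] at pr
  have e1 : q^(N+1) = q^x*q^y*q^z := by rw [hz]; ring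
  have e2 : q^(N+2) = q^x*q^y*q^z*q := by rw [← e1]; ring
  clear k0 ih hz g hxy hi
  generalize wL q c0 c1 c2 c3 c4 (N+1) (i+1) 0 x y = Wl at *
  generalize wR q c1 c4 (N+1) (i+1) 0 x y = Wr at *
  generalize Sm q c0 c1 c2 c3 c4 (N+1) (i+1) 0 x y = s at *
  generalize Rm q c0 c1 c2 c3 c4 (N+1) (i+1) 0 x y = r at *
  generalize Sm q c0 (q*c1) (q*c2) c3 c4 N i 0 x y = s0 at *
  generalize Sm q c0 (q*c1) (q*c2) c3 c4 N i 0 x (y-1) = s1 at *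
  generalize Rm q c0 (q*c1) (q*c2) c3 c4 N i 0 x y = r0 at *
  generalize Rm q c0 (q*c1) (q*c2) c3 c4 N i 0 x (y-1) = r1 at *
  rw [e1] at h1
  rw [e2] at T1
  clear e1 e2
  rw [mul_comm 2 y] at *
  simp only [pow_add, pow_mul, pow_one] at *
  generalize q^x = X at *
  generalize q^y = Y at *
  generalize q^z = Z at *
  generalize q^i = I at *
  have := I_aux q c0 c1 c2 c3 c4 X Y Z Wl Wr s0 s1 r0 r1 pr T0 T1
  rw [← h1, ← h2] at this
  linear_combination this
end BE

namespace BE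
open qR Finset

def Om1 (q a b c : ℂ) (N n : ℕ) : ℂ := poch q q N/(poch q q n*poch q q (N-n))*poch q (a*b*c*q^(N+2)) n*poch q (q*a) (N-n)/poch q (b*c*q^(n+1)) (N+1)
def Vw (q c0 c1 c2 c3 c4 : ℂ) (M y a : ℕ) : ℂ := bp q c0 c1 c4 (M+y-a)*Om1 q c4 c3 c2 M a*(c1*q^(M+y))^a

lemma invk {D' D k l : ℂ} (h : D'*l = D*k) (n1 : D' ≠ 0) (n2 : D ≠ 0) : D'⁻¹*k = D⁻¹*l := by
  field_simp
  linear_combination -h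

lemma pne {q c : ℂ} {K : ℕ} (h : S q c K) (r k : ℕ) (hr : 1 ≤ r) (hk : r+k ≤ K+1) : poch q (c*q^r) k ≠ 0 := by
  apply poch_ne
  intro l hl
  have := h (r+l) (by omega) (by omega)
  rwa [pow_add, ← mul_assoc] at this

lemma pne1 {q c : ℂ} {K : ℕ} (h : S q c K) (k : ℕ) (hk : k ≤ K) : poch q (q*c) k ≠ 0 := by
  have := pne h 1 k le_rfl (by omega)
  rwa [pow_one, mul_comm] at this

lemma VX1 (q c0 c1 c2 c3 c4 : ℂ) (m y a : ℕ) (g : G q c0 c1 c2 c3 c4 (a+m+y+1)) :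
    Vw q c0 c1 c2 c3 c4 (a+m+1) y a*((1-c0*c4*q^2)*(1-q^(m+1))*(1-c4*c3*c2*q^(a+m+3+a))*(1-c3*c2*q^(a+1))) =
    Vw q c0 c1 c2 (q*c3) (q*c4) (a+m) y a*(q^a*(1-c1*q^(m+y+1))*(1-q^(a+m+1))*(1-c4*c3*c2*q^(a+m+3))*(1-q*c4)) := by
  have z1 : poch q (q*c1) (m+y+1) = poch q (q*c1) (m+y)*(1-c1*q^(m+y+1)) := by rw [poch_succ]; ring
  have z2 : (poch q (c0*c4*q^2) (m+y+1))⁻¹*(1-c0*c4*q^2) = (poch q (c0*(q*c4)*q^2) (m+y))⁻¹*1 := by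
    have s := g.get 1 0 0 0 1 (c := c0*c4) (by ring) le_rfl
    apply invk _ (pne s _ _ (by omega) (by omega))
    · rw [show c0*(q*c4)*q^2 = c0*c4*q^3 by ring]; exact (pne s _ _ (by omega) (by omega))
    · rw [poch_succ', show c0*c4*q^2*q = c0*(q*c4)*q^2 by ring]; ring
  have z3 : poch q q (a+m+1) = poch q q (a+m)*(1-q^(a+m+1)) := by rw [poch_succ]; ring
  have z4 : (poch q q (m+1))⁻¹*(1-q^(m+1)) = (poch q q m)⁻¹*1 := by
    have s := pne1 (g.s1.mono le_rfl) m (by omega)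
    have s' := pne1 (g.s1.mono le_rfl) (m+1) (by omega)
    rw [mul_one] at s s'
    apply invk _ s' s
    rw [poch_succ]; ring
  have z5 : poch q (c4*c3*c2*q^(a+m+1+2)) a*(1-c4*c3*c2*q^(a+m+3+a)) = (1-c4*c3*c2*q^(a+m+3))*poch q (q*c4*(q*c3)*c2*q^(a+m+2)) a := by
    have := poch_shift q (c4*c3*c2*q^(a+m+3)) a
    rw [show c4*c3*c2*q^(a+m+3)*q = q*c4*(q*c3)*c2*q^(a+m+2) by ring] at this
    rw [this]; ring
  have z6 : poch q (q*c4) (m+1) = (1-q*c4)*poch q (q*(q*c4)) m := by rw [poch_succ', mul_comm (q*c4) q]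
  have z7 : (poch q (c3*c2*q^(a+1)) (a+m+1+1))⁻¹*(1-c3*c2*q^(a+1)) = (poch q (q*c3*c2*q^(a+1)) (a+m+1))⁻¹*1 := by
    have s := g.get 0 0 1 1 0 (c := c3*c2) (by ring) le_rfl
    apply invk _ (pne s _ _ (by omega) (by omega))
    · rw [show q*c3*c2*q^(a+1) = c3*c2*q^(a+2) by ring]; exact (pne s _ _ (by omega) (by omega))
    · rw [poch_succ', show c3*c2*q^(a+1)*q = q*c3*c2*q^(a+1) by ring]; ring
  unfold Vw Om1 bp
  rw [show a+m+1+y-a = m+y+1 by omega, show a+m+1-a = m+1 by omega, show a+m+y-a = m+y by omega, show a+m-a = m by omega,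
    show c1*q^(a+m+1+y) = c1*q^(a+m+y)*q by ring, mul_pow _ q a]
  simp only [div_eq_mul_inv, mul_inv]
  calc _ = poch q (q*c1) (m+y+1)*((poch q (c0*c4*q^2) (m+y+1))⁻¹*(1-c0*c4*q^2))*(poch q q (a+m+1)*((poch q q a)⁻¹*((poch q q (m+1))⁻¹*(1-q^(m+1))))*(poch q (c4*c3*c2*q^(a+m+1+2)) a*(1-c4*c3*c2*q^(a+m+3+a)))*poch q (q*c4) (m+1)*((poch q (c3*c2*q^(a+1)) (a+m+1+1))⁻¹*(1-c3*c2*q^(a+1))))*((c1*q^(a+m+y))^a*q^a) := by ring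
    _ = _ := by rw [z1, z2, z3, z4, z5, z6, z7]; ring

lemma VX2 (q c0 c1 c2 c3 c4 : ℂ) (m y a : ℕ) (g : G q c0 c1 c2 c3 c4 (a+m+y+1)) :
    Vw q c0 c1 c2 c3 c4 (a+m+1) y (a+1)*((1-c0*c4*q^2)*(1-q^(a+1))*(1-c4*q^(m+1))*(1-c3*c2*q^(a+m+a+3))) =
    Vw q c0 c1 c2 (q*c3) (q*c4) (a+m) y a*(q^a*(c1*q^(a+m+y+1))*(1-c0*c4*q^(m+y+2))*(1-q^(a+m+1))*(1-c4*c3*c2*q^(a+m+3))*(1-q*c4)) := by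
  have z2 : (poch q (c0*c4*q^2) (m+y))⁻¹*(1-c0*c4*q^2) = (poch q (c0*(q*c4)*q^2) (m+y))⁻¹*(1-c0*c4*q^(m+y+2)) := by
    have s := g.get 1 0 0 0 1 (c := c0*c4) (by ring) le_rfl
    apply invk _ (pne s _ _ (by omega) (by omega))
    · rw [show c0*(q*c4)*q^2 = c0*c4*q^3 by ring]; exact (pne s _ _ (by omega) (by omega))
    · have := poch_shift q (c0*c4*q^2) (m+y)
      rw [show c0*c4*q^2*q = c0*(q*c4)*q^2 by ring] at this
      linear_combination -this
  have z3 : poch q q (a+m+1) = poch q q (a+m)*(1-q^(a+m+1)) := by rw [poch_succ]; ring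
  have z4 : (poch q q (a+1))⁻¹*(1-q^(a+1)) = (poch q q a)⁻¹*1 := by
    have s := pne1 (g.s1.mono le_rfl) a (by omega)
    have s' := pne1 (g.s1.mono le_rfl) (a+1) (by omega)
    rw [mul_one] at s s'
    apply invk _ s' s
    rw [poch_succ]; ring
  have z5 : poch q (c4*c3*c2*q^(a+m+1+2)) (a+1) = (1-c4*c3*c2*q^(a+m+3))*poch q (q*c4*(q*c3)*c2*q^(a+m+2)) a := by
    rw [poch_succ', show c4*c3*c2*q^(a+m+1+2)*q = q*c4*(q*c3)*c2*q^(a+m+2) by ring]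
  have z6 : poch q (q*c4) m*(1-c4*q^(m+1)) = (1-q*c4)*poch q (q*(q*c4)) m := by 
    have := poch_shift q (q*c4) m
    rw [mul_comm (q*c4) q] at this
    rw [this]; ring
  have z7 : (poch q (c3*c2*q^(a+1+1)) (a+m+1+1))⁻¹*(1-c3*c2*q^(a+m+a+3)) = (poch q (q*c3*c2*q^(a+1)) (a+m+1))⁻¹*1 := by
    have s := g.get 0 0 1 1 0 (c := c3*c2) (by ring) le_rfl
    apply invk _ (pne s _ _ (by omega) (by omega))
    · rw [show q*c3*c2*q^(a+1) = c3*c2*q^(a+2) by ring]; exact (pne s _ _ (by omega) (by omega))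
    · rw [poch_succ, show c3*c2*q^(a+1+1) = q*c3*c2*q^(a+1) by ring]; ring
  unfold Vw Om1 bp
  rw [show a+m+1+y-(a+1) = m+y by omega, show a+m+1-(a+1) = m by omega, show a+m+y-a = m+y by omega, show a+m-a = m by omega,
    show c1*q^(a+m+1+y) = c1*q^(a+m+y)*q by ring, mul_pow _ q (a+1), pow_succ _ a, pow_succ q a]
  simp only [div_eq_mul_inv, mul_inv]
  calc _ = poch q (q*c1) (m+y)*((poch q (c0*c4*q^2) (m+y))⁻¹*(1-c0*c4*q^2))*(poch q q (a+m+1)*((poch q q (a+1))⁻¹*(1-q^(a+1))*((poch q q m)⁻¹))*poch q (c4*c3*c2*q^(a+m+1+2)) (a+1)*(poch q (q*c4) m*(1-c4*q^(m+1)))*((poch q (c3*c2*q^(a+1+1)) (a+m+1+1))⁻¹*(1-c3*c2*q^(a+m+a+3))))*((c1*q^(a+m+y))^a*(c1*q^(a+m+y))*(q^a*q)) := by ring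
    _ = _ := by rw [z2, z3, z4, z5, z6, z7]; ring

lemma VY1 (q c0 c1 c2 c3 c4 : ℂ) (m y a : ℕ) (g : G q c0 c1 c2 c3 c4 (a+m+y+1)) :
    Vw q c0 c1 c2 c3 c4 (a+m+1) y a*((1-c0*c4*q^2)*(1-q^(m+1))*(1-c3*c2*q^(a+1))) =
    Vw q (q*c0) c1 (q*c2) c3 c4 (a+m) y a*(q^a*(1-c1*q^(m+y+1))*(1-q^(a+m+1))*(1-c4*q^(m+1))) := by
  have z1 : poch q (q*c1) (m+y+1) = poch q (q*c1) (m+y)*(1-c1*q^(m+y+1)) := by rw [poch_succ]; ring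
  have z2 : (poch q (c0*c4*q^2) (m+y+1))⁻¹*(1-c0*c4*q^2) = (poch q (q*c0*c4*q^2) (m+y))⁻¹*1 := by
    have s := g.get 1 0 0 0 1 (c := c0*c4) (by ring) le_rfl
    apply invk _ (pne s _ _ (by omega) (by omega))
    · rw [show q*c0*c4*q^2 = c0*c4*q^3 by ring]; exact (pne s _ _ (by omega) (by omega))
    · rw [poch_succ', show c0*c4*q^2*q = q*c0*c4*q^2 by ring]; ring
  have z3 : poch q q (a+m+1) = poch q q (a+m)*(1-q^(a+m+1)) := by rw [poch_succ]; ring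
  have z4 : (poch q q (m+1))⁻¹*(1-q^(m+1)) = (poch q q m)⁻¹*1 := by
    have s := pne1 (g.s1.mono le_rfl) m (by omega)
    have s' := pne1 (g.s1.mono le_rfl) (m+1) (by omega)
    rw [mul_one] at s s'
    apply invk _ s' s
    rw [poch_succ]; ring
  have z6 : poch q (q*c4) (m+1) = poch q (q*c4) m*(1-c4*q^(m+1)) := by rw [poch_succ]; ring
  have z7 : (poch q (c3*c2*q^(a+1)) (a+m+1+1))⁻¹*(1-c3*c2*q^(a+1)) = (poch q (c3*(q*c2)*q^(a+1)) (a+m+1))⁻¹*1 := by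
    have s := g.get 0 0 1 1 0 (c := c3*c2) (by ring) le_rfl
    apply invk _ (pne s _ _ (by omega) (by omega))
    · rw [show c3*(q*c2)*q^(a+1) = c3*c2*q^(a+2) by ring]; exact (pne s _ _ (by omega) (by omega))
    · rw [poch_succ', show c3*c2*q^(a+1)*q = c3*(q*c2)*q^(a+1) by ring]; ring
  unfold Vw Om1 bp
  rw [show a+m+1+y-a = m+y+1 by omega, show a+m+1-a = m+1 by omega, show a+m+y-a = m+y by omega, show a+m-a = m by omega,
    show c1*q^(a+m+1+y) = c1*q^(a+m+y)*q by ring, mul_pow _ q a, show c4*c3*(q*c2)*q^(a+m+2) = c4*c3*c2*q^(a+m+1+2) by ring]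
  simp only [div_eq_mul_inv, mul_inv]
  calc _ = poch q (q*c1) (m+y+1)*((poch q (c0*c4*q^2) (m+y+1))⁻¹*(1-c0*c4*q^2))*(poch q q (a+m+1)*((poch q q a)⁻¹*((poch q q (m+1))⁻¹*(1-q^(m+1))))*(poch q (c4*c3*c2*q^(a+m+1+2)) a)*poch q (q*c4) (m+1)*((poch q (c3*c2*q^(a+1)) (a+m+1+1))⁻¹*(1-c3*c2*q^(a+1))))*((c1*q^(a+m+y))^a*q^a) := by ring
    _ = _ := by rw [z1, z2, z3, z4, z6, z7]; ring

lemma VY2 (q c0 c1 c2 c3 c4 : ℂ) (m y a : ℕ) (g : G q c0 c1 c2 c3 c4 (a+m+y+1)) :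
    Vw q c0 c1 c2 c3 c4 (a+m+1) y (a+1)*((1-c0*c4*q^2)*(1-q^(a+1))*(1-c3*c2*q^(a+m+a+3))) =
    Vw q (q*c0) c1 (q*c2) c3 c4 (a+m) y a*(q^a*(c1*q^(a+m+y+1))*(1-c0*c4*q^(m+y+2))*(1-q^(a+m+1))*(1-c4*c3*c2*q^(a+m+3+a))) := by
  have z2 : (poch q (c0*c4*q^2) (m+y))⁻¹*(1-c0*c4*q^2) = (poch q (q*c0*c4*q^2) (m+y))⁻¹*(1-c0*c4*q^(m+y+2)) := by
    have s := g.get 1 0 0 0 1 (c := c0*c4) (by ring) le_rfl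
    apply invk _ (pne s _ _ (by omega) (by omega))
    · rw [show q*c0*c4*q^2 = c0*c4*q^3 by ring]; exact (pne s _ _ (by omega) (by omega))
    · have := poch_shift q (c0*c4*q^2) (m+y)
      rw [show c0*c4*q^2*q = q*c0*c4*q^2 by ring] at this
      linear_combination -this
  have z3 : poch q q (a+m+1) = poch q q (a+m)*(1-q^(a+m+1)) := by rw [poch_succ]; ring
  have z4 : (poch q q (a+1))⁻¹*(1-q^(a+1)) = (poch q q a)⁻¹*1 := by
    have s := pne1 (g.s1.mono le_rfl) a (by omega)
    have s' := pne1 (g.s1.mono le_rfl) (a+1) (by omega)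
    rw [mul_one] at s s'
    apply invk _ s' s
    rw [poch_succ]; ring
  have z5 : poch q (c4*c3*c2*q^(a+m+1+2)) (a+1) = poch q (c4*c3*c2*q^(a+m+1+2)) a*(1-c4*c3*c2*q^(a+m+3+a)) := by
    rw [poch_succ]; ring
  have z7 : (poch q (c3*c2*q^(a+1+1)) (a+m+1+1))⁻¹*(1-c3*c2*q^(a+m+a+3)) = (poch q (c3*(q*c2)*q^(a+1)) (a+m+1))⁻¹*1 := by
    have s := g.get 0 0 1 1 0 (c := c3*c2) (by ring) le_rfl
    apply invk _ (pne s _ _ (by omega) (by omega))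
    · rw [show c3*(q*c2)*q^(a+1) = c3*c2*q^(a+2) by ring]; exact (pne s _ _ (by omega) (by omega))
    · rw [poch_succ, show c3*c2*q^(a+1+1) = c3*(q*c2)*q^(a+1) by ring]; ring
  unfold Vw Om1 bp
  rw [show a+m+1+y-(a+1) = m+y by omega, show a+m+1-(a+1) = m by omega, show a+m+y-a = m+y by omega, show a+m-a = m by omega,
    show c1*q^(a+m+1+y) = c1*q^(a+m+y)*q by ring, mul_pow _ q (a+1), pow_succ _ a, pow_succ q a, show c4*c3*(q*c2)*q^(a+m+2) = c4*c3*c2*q^(a+m+1+2) by ring]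
  simp only [div_eq_mul_inv, mul_inv]
  calc _ = poch q (q*c1) (m+y)*((poch q (c0*c4*q^2) (m+y))⁻¹*(1-c0*c4*q^2))*(poch q q (a+m+1)*((poch q q (a+1))⁻¹*(1-q^(a+1))*((poch q q m)⁻¹))*poch q (c4*c3*c2*q^(a+m+1+2)) (a+1)*(poch q (q*c4) m)*((poch q (c3*c2*q^(a+1+1)) (a+m+1+1))⁻¹*(1-c3*c2*q^(a+m+a+3))))*((c1*q^(a+m+y))^a*(c1*q^(a+m+y))*(q^a*q)) := by ring
    _ = _ := by rw [z2, z3, z4, z5, z7]; ring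
end BE

namespace BE
open qR Finset

def T (q c0 c1 c2 c3 c4 : ℂ) (M y x : ℕ) : ℂ := ∑ a ∈ range (M+1), Vw q c0 c1 c2 c3 c4 M y a*(1-c3*c2*q^(2*a+1)) * F q c4 c3 c2 M a x

lemma TX_aux (q c0 c1 c2 c3 c4 A m Y v v' v0 : ℂ) (hA : A ≠ 0) (hq : q ≠ 0)
    (pr : c0*c1*c2*c3*c4*((A*m*Y*q)^2*q^3) = 1)
    (h1 : v*((1-c0*c4*q^2)*(1-m*q)*(1-c4*c3*c2*(A*m*q^3*A))*(1-c3*c2*(A*q))) = v0*(A*(1-c1*(m*Y*q))*(1-A*m*q)*(1-c4*c3*c2*(A*m*q^3))*(1-q*c4)))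
    (h2 : v'*((1-c0*c4*q^2)*(1-A*q)*(1-c4*(m*q))*(1-c3*c2*(A*m*A*q^3))) = v0*(A*(c1*(A*m*Y*q))*(1-c0*c4*(m*Y*q^2))*(1-A*m*q)*(1-c4*c3*c2*(A*m*q^3))*(1-q*c4))) :
    (c2*q*(1-c0*c4*q^2))*(v*((1-c2*c3*(A*q))*(1-c3*(A*q))*(1-c2*c3*c4*(A*m*A*q^3))*(A*m*q-A))/A - v'*((A*q-1)*c3*(c2*(A*q)-1)*(A*q*q-c4*(A*m*q^3))*(c2*c3*(A*m*(A*q)*q^2)-1))/(A*q))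
      = (-(1-c1*c2*(A*m*Y*q^2))*(1-q*c4)*(1-A*m*q)*(1-c2*c3*c4*(A*m*q^3)))*(v0*(1-q*c3*c2*(A^2*q))) := by
  have e1 : v*((1-c2*c3*(A*q))*(1-c3*(A*q))*(1-c2*c3*c4*(A*m*A*q^3))*(A*m*q-A))/A = v*((1-c2*c3*(A*q))*(1-c3*(A*q))*(1-c2*c3*c4*(A*m*A*q^3))*(m*q-1)) := by
    field_simp
  have e2 : v'*((A*q-1)*c3*(c2*(A*q)-1)*(A*q*q-c4*(A*m*q^3))*(c2*c3*(A*m*(A*q)*q^2)-1))/(A*q) = v'*((A*q-1)*c3*(c2*(A*q)-1)*(q*(1-c4*(m*q)))*(c2*c3*(A*m*(A*q)*q^2)-1)) := by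
    field_simp
  rw [e1, e2]
  linear_combination -c2*q*(1-c3*(A*q))*h1 + c2*q*c3*q*(1-c2*(A*q))*h2 + v0*(1-q*c4)*(1-A*m*q)*(1-c2*c3*c4*(A*m*q^3))*(c2*q*A-1)*pr

lemma TX (q c0 c1 c2 c3 c4 : ℂ) (M y x : ℕ) (hx : x ≤ M) (g : G q c0 c1 c2 c3 c4 (M+y+1)) :
    T q c0 c1 c2 c3 c4 (M+1) y (x+1)*((1-q*c3)*(1-c0*c4*q^2)*(c2*q)) = (1-q*c4)*(1-c1*c2*q^(M+y+2))*T q c0 c1 c2 (q*c3) (q*c4) M y x := by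
  have hq := g.hq
  have nk : (1-c2*c3*c4*q^(M+3))*(q^(M+1)-1) ≠ 0 := by
    have n1 := (g.get 0 0 1 1 1 (c := c2*c3*c4) (by ring) le_rfl).ne (M+3) (by omega) (by omega)
    have n2 := g.s1.ne (M+1) (by omega) (by omega)
    apply mul_ne_zero n1
    intro h; apply n2; linear_combination -h
  apply mul_left_cancel₀ nk
  have key : (1-q*c3)*(1-c2*c3*c4*q^(M+3))*(q^(M+1)-1)*T q c0 c1 c2 c3 c4 (M+1) y (x+1) =
    ∑ a ∈ range (M+1+1), ((Vw q c0 c1 c2 c3 c4 (M+1) y a*((1-c2*c3*q^(a+1))*(1-c3*q^(a+1))*(1-c2*c3*c4*q^(M+a+3))*(q^(M+1)-q^a))/q^a)*F q c2 (q*c3) (q*c4) M x a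
      + (-(Vw q c0 c1 c2 c3 c4 (M+1) y a*((q^a-1)*c3*(c2*q^a-1)*(q^(a+1)-c4*q^(M+3))*(c2*c3*q^(M+a+2)-1))/q^a))*F q c2 (q*c3) (q*c4) M x (a-1)) := by
    unfold T
    rw [mul_sum]
    apply sum_congr rfl
    intro a ha
    rw [mem_range] at ha
    have h := FT1 q c2 c3 c4 M x a hq g.n2 g.n3 hx (g.s1.mono (by omega)) (g.get 0 0 0 1 0 (by ring) (by omega)) (g.get 0 0 1 1 1 (by ring) (by omega)) ((g.get 0 0 0 1 1 (c := c3*c4) (by ring) le_rfl) (x+2) (by omega) (by omega)) ((g.get 0 0 1 1 0 (c := c2*c3) (by ring) le_rfl) (2*a+1) (by omega) (by omega))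
    rw [F_symm q c4 c3 c2 hq]
    have nq : q^a ≠ 0 := pow_ne_zero _ hq
    have hi := mul_inv_cancel₀ nq
    simp only [div_eq_mul_inv]
    generalize (q^a)⁻¹ = v at *
    generalize Vw q c0 c1 c2 c3 c4 (M+1) y a = w
    linear_combination w*v*h - w*(1-q*c3)*(1-c2*c3*c4*q^(M+3))*(q^(M+1)-1)*(1-c3*c2*q^(2*a+1))*F q c2 c3 c4 (M+1) (x+1) a*hi
  rw [shiftsum _ _ _ _ (by simp) (by simp)] at key
  have k2 : (1-c2*c3*c4*q^(M+3))*(q^(M+1)-1)*(T q c0 c1 c2 c3 c4 (M+1) y (x+1)*((1-q*c3)*(1-c0*c4*q^2)*(c2*q))) = (c2*q*(1-c0*c4*q^2))*((1-q*c3)*(1-c2*c3*c4*q^(M+3))*(q^(M+1)-1)*T q c0 c1 c2 c3 c4 (M+1) y (x+1)) := by ring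
  rw [k2, key]
  unfold T
  simp only [mul_sum]
  apply sum_congr rfl
  intro a ha
  rw [mem_range] at ha
  obtain ⟨m, rfl⟩ := Nat.exists_eq_add_of_le (show a ≤ M by omega)
  have h1 := VX1 q c0 c1 c2 c3 c4 m y a g
  have h2 := VX2 q c0 c1 c2 c3 c4 m y a g
  have pr := g.pr
  rw [F_symm q (q*c4) (q*c3) c2 hq]
  rw [show 2*(a+m+y+1)+3 = (a+m+y+1)*2+3 by ring] at pr
  generalize Vw q c0 c1 c2 c3 c4 (a+m+1) y a = v at *
  generalize Vw q c0 c1 c2 c3 c4 (a+m+1) y (a+1) = v' at *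
  generalize Vw q c0 c1 c2 (q*c3) (q*c4) (a+m) y a = v0 at *
  generalize F q c2 (q*c3) (q*c4) (a+m) x a = f
  have nq : q^a ≠ 0 := pow_ne_zero _ hq
  rw [mul_comm 2 a]
  clear nk key k2 g
  simp only [pow_add, pow_mul, pow_one] at *
  generalize q^a = A at *
  generalize q^m = B at *
  generalize q^y = Y at *
  have := TX_aux q c0 c1 c2 c3 c4 A B Y v v' v0 nq hq pr h1 h2
  linear_combination f*this

lemma TY_aux (q c0 c1 c2 c3 c4 A m Y v v' v0 : ℂ)  (hA : A ≠ 0)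
    (pr : c0*c1*c2*c3*c4*((A*m*Y*q)^2*q^3) = 1)
    (h1 : v*((1-c0*c4*q^2)*(1-m*q)*(1-c3*c2*(A*q))) = v0*(A*(1-c1*(m*Y*q))*(1-A*m*q)*(1-c4*(m*q))))
    (h2 : v'*((1-c0*c4*q^2)*(1-A*q)*(1-c3*c2*(A*m*A*q^3))) = v0*(A*(c1*(A*m*Y*q))*(1-c0*c4*(m*Y*q^2))*(1-A*m*q)*(1-c4*c3*c2*(A*m*q^3*A)))) :
    (c2*c3*q^2*(1-c0*c4*q^2))*(v*((A*m*q-A)*(1-c3*c2*(A*q))) - v'*((1-c3*c2*(A*m*(A*q)*q^2))*(1-A*q)))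
      = ((1-c1*c2*c3*c4*(A*m*q^4*(A*m*Y)))*(1-A*m*q))*(v0*(1-c3*(q*c2)*(A^2*q))) := by
  linear_combination -c2*c3*q^2*A*h1 - c2*c3*q^2*h2 + v0*(1-A*m*q)*(1-c2*c3*q^2*A^2*m*c4*q)*pr

lemma TY (q c0 c1 c2 c3 c4 : ℂ) (M y : ℕ) (g : G q c0 c1 c2 c3 c4 (M+y+1)) :
    T q c0 c1 c2 c3 c4 (M+1) y 0*(c0*c2*c3*q^(y+3)*(1-c0*c4*q^2)) = (1-c0*q^(y+1))*T q (q*c0) c1 (q*c2) c3 c4 M y 0 := by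
  have hq := g.hq
  have nk : (q^(M+1)-1) ≠ 0 := by
    have n2 := g.s1.ne (M+1) (by omega) (by omega)
    intro h; apply n2; linear_combination -h
  apply mul_left_cancel₀ nk
  have key : (q^(M+1)-1)*T q c0 c1 c2 c3 c4 (M+1) y 0 =
    ∑ a ∈ range (M+1+1), ((Vw q c0 c1 c2 c3 c4 (M+1) y a*((q^(M+1)-q^a)*(1-c3*c2*q^(a+1))))*(fun _ => (1:ℂ)) a
      + (-(Vw q c0 c1 c2 c3 c4 (M+1) y a*((1-c3*c2*q^(M+a+2))*(1-q^a))))*(fun _ => (1:ℂ)) (a-1)) := by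
    unfold T
    rw [mul_sum]
    apply sum_congr rfl
    intro a ha
    rw [F_symm q c4 c3 c2 hq, F_zero]
    ring
  rw [shiftsum _ _ _ _ (by simp) (by simp)] at key
  have k2 : (q^(M+1)-1)*(T q c0 c1 c2 c3 c4 (M+1) y 0*(c0*c2*c3*q^(y+3)*(1-c0*c4*q^2))) = c0*q^(y+1)*((c2*c3*q^2*(1-c0*c4*q^2))*((q^(M+1)-1)*T q c0 c1 c2 c3 c4 (M+1) y 0)) := by ring
  rw [k2, key]
  unfold T
  simp only [mul_sum]
  apply sum_congr rfl
  intro a ha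
  rw [mem_range] at ha
  obtain ⟨m, rfl⟩ := Nat.exists_eq_add_of_le (show a ≤ M by omega)
  have h1 := VY1 q c0 c1 c2 c3 c4 m y a g
  have h2 := VY2 q c0 c1 c2 c3 c4 m y a g
  have pr := g.pr
  rw [F_symm q c4 c3 (q*c2) hq, F_zero]
  rw [show 2*(a+m+y+1)+3 = (a+m+y+1)*2+3 by ring] at pr
  generalize Vw q c0 c1 c2 c3 c4 (a+m+1) y a = v at *
  generalize Vw q c0 c1 c2 c3 c4 (a+m+1) y (a+1) = v' at *
  generalize Vw q (q*c0) c1 (q*c2) c3 c4 (a+m) y a = v0 at *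
  have nq : q^a ≠ 0 := pow_ne_zero _ hq
  rw [mul_comm 2 a]
  clear nk key k2 g
  simp only [pow_add, pow_mul, pow_one] at *
  generalize q^a = A at *
  generalize q^m = B at *
  generalize q^y = Y at *
  have := TY_aux q c0 c1 c2 c3 c4 A B Y v v' v0 nq pr h1 h2
  linear_combination c0*(Y*q)*this - (1-A*B*q)*(v0*(1-c3*(q*c2)*(A^2*q)))*pr
end BE

namespace BE
open qR Finset

lemma Sm00 (q c0 c1 c2 c3 c4 : ℂ) (M y x : ℕ) (hx : x ≤ M) (g : G q c0 c1 c2 c3 c4 (M+y)) :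
    Sm q c0 c1 c2 c3 c4 (M+y) 0 0 x y = poch q (q*c3) (M+y)/poch q (c1*c2*q^2) (M+y)*T q c0 c1 c2 c3 c4 M y x := by
  unfold Sm T
  rw [← sum_subset (s₁ := range (M+1)) (range_subset_range.2 (by omega)), mul_sum]
  · apply sum_congr rfl
    intro a ha
    rw [mem_range] at ha
    have s04 : 1-c0*c4*q ≠ 0 := by simpa using (g.get 1 0 0 0 1 (c := c0*c4) (by ring) le_rfl).ne 1 (by omega) (by omega)
    have s12 : 1-c2*c1*q ≠ 0 := by simpa using (g.get 0 1 1 0 0 (c := c2*c1) (by ring) le_rfl).ne 1 (by omega) (by omega)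
    have pq := pne1 g.s1 (M+y) le_rfl
    rw [mul_one] at pq
    rw [BQ q c0 c1 c2 c3 c4 (M+y) a x y (by omega) (by omega) g.s1 s04, Nat.sub_zero, Q_zero q c3 c2 c1 (M+y) a (by omega) pq s12, Nat.add_sub_cancel,
      Q_eq (by omega) hx]
    unfold Om0 Vw Om1
    rw [mul_comm c2 c1]
    ring
  · intro a _ ha
    rw [mem_range] at ha
    rw [Q_n (N := M+y-y) (n := a) (by omega)]; ring

lemma T0 (y : ℕ) (q c1 c3 c4 : ℂ) : ∀ (M : ℕ) (c0 c2 : ℂ) (_ : G q c0 c1 c2 c3 c4 (M+y)),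
    T q c0 c1 c2 c3 c4 M y 0*(poch q (c0*c4*q^2) (M+y)*poch q (q*c0) y) = poch q (q*c0) (M+y)*poch q (q*c1) y*(c1*c4*q^(M+y+1))^M := by
  intro M
  induction M with
  | zero =>
    intro c0 c2 g
    have s04 := pne (g.get 1 0 0 0 1 (c := c0*c4) (by ring) le_rfl) 2 y (by omega) (by omega)
    have s23 : 1-c3*c2*q ≠ 0 := by simpa using (g.get 0 0 1 1 0 (c := c3*c2) (by ring) le_rfl).ne 1 (by omega) (by omega)
    have : T q c0 c1 c2 c3 c4 0 y 0 = poch q (q*c1) y/poch q (c0*c4*q^2) y := by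
      simp [T, F_zero, Vw, bp, Om1, poch_zero', poch_succ]
      generalize poch q (c0*c4*q^2) y = D at *
      generalize 1-c3*c2*q = D' at *
      field_simp
    rw [this, zero_add]
    generalize poch q (c0*c4*q^2) y = D at *
    rw [pow_zero, div_mul_eq_mul_div, div_eq_iff s04]
    ring
  | succ M ih =>
    intro c0 c2 g
    rw [show M+1+y = M+y+1 by omega] at *
    have h := ih (q*c0) (q*c2) (g.down 1 0 1 0 0 (by ring) (by ring) (by ring) (by ring) (by ring))
    have t := TY q c0 c1 c2 c3 c4 M y g
    have hq := g.hq
    have := g.n0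
    have := g.n2
    have := g.n3
    have nk : c0*c2*c3*q^(y+3) ≠ 0 := by positivity
    apply mul_left_cancel₀ nk
    rw [poch_succ' q (c0*c4*q^2), poch_succ' q (q*c0) (M+y), show c0*c4*q^2*q = q*c0*c4*q^2 by ring, show q*c0*q = q*(q*c0) by ring,
      show c1*c4*q^(M+y+1+1) = c1*c4*q^(M+y+1)*q by ring, mul_pow _ q, pow_succ _ M]
    have e := poch_shift q (q*c0) y
    rw [show q*c0*q = q*(q*c0) by ring] at e
    have pr : c0*c2*c3*q^(y+3)*(q^(M+1)*(c1*c4*q^(M+y+1))) = 1 := by rw [← g.pr]; ring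
    generalize (c1*c4*q^(M+y+1))^M = w at *
    linear_combination poch q (q*c0*c4*q^2) (M+y)*poch q (q*c0) y*t - T q (q*c0) c1 (q*c2) c3 c4 M y 0*poch q (q*c0*c4*q^2) (M+y)*e + (1-q*c0)*h
      - (1-q*c0)*poch q (q*(q*c0)) (M+y)*poch q (q*c1) y*w*pr

lemma Tx (y : ℕ) (q c0 c1 c2 : ℂ) : ∀ (x M : ℕ) (c3 c4 : ℂ) (_ : x ≤ M) (_ : G q c0 c1 c2 c3 c4 (M+y)),
    T q c0 c1 c2 c3 c4 M y x*(poch q (c0*c4*q^2) (M+y)*(c1*c2*c4*q^(M+y+2))^x*poch q (q*c3) x*(c1*c4*q^(M+y+1))^y*poch q (q*c0) y * poch q (c1*c2*q^2) (M+y-x))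
      = poch q (c1*c2*q^2) (M+y)*poch q (q*c0) (M+y-x)*poch q (q*c1) y*poch q (q*c4) x*(c1*c4*q^(M+y+1))^(M+y) := by
  intro x
  induction x with
  | zero =>
    intro M c3 c4 _ g
    have h := T0 y q c1 c3 c4 M c0 c2 g
    rw [poch_zero', poch_zero', pow_zero, Nat.sub_zero, pow_add _ M y]
    generalize (c1*c4*q^(M+y+1))^M = w at *
    generalize (c1*c4*q^(M+y+1))^y = w' at *
    linear_combination w'*poch q (c1*c2*q^2) (M+y)*h
  | succ x ih =>
    intro M c3 c4 hx g
    obtain ⟨M, rfl⟩ : ∃ M', M = M'+1 := ⟨M-1, by omega⟩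
    rw [show M+1+y = M+y+1 by omega] at *
    have h := ih M (q*c3) (q*c4) (by omega) (g.down 0 0 0 1 1 (by ring) (by ring) (by ring) (by ring) (by ring))
    have t := TX q c0 c1 c2 c3 c4 M y x (by omega) g
    rw [poch_succ' q (c0*c4*q^2), poch_succ' q (q*c3), poch_succ' q (q*c4), poch_succ q (c1*c2*q^2) (M+y), Nat.add_sub_add_right,
      show c0*c4*q^2*q = c0*(q*c4)*q^2 by ring, show q*c3*q = q*(q*c3) by ring, show q*c4*q = q*(q*c4) by ring,
      show c1*c2*c4*q^(M+y+1+2) = c1*c2*(q*c4)*q^(M+y+2) by ring, show c1*c4*q^(M+y+1+1) = c1*(q*c4)*q^(M+y+1) by ring, pow_succ (c1*c2*(q*c4)*q^(M+y+2)) x, pow_succ (c1*(q*c4)*q^(M+y+1)) (M+y)]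
    generalize (c1*(q*c4)*q^(M+y+1))^(M+y) = w1 at *
    generalize (c1*(q*c4)*q^(M+y+1))^y = w2 at *
    generalize (c1*c2*(q*c4)*q^(M+y+2))^x = w3 at *
    linear_combination (poch q (c0*(q*c4)*q^2) (M+y)*(w3*(c1*c4*q^(M+y+2)))*poch q (q*(q*c3)) x*w2*poch q (q*c0) y * poch q (c1*c2*q^2) (M+y-x))*t 
      + (1-q*c4)*(1-c1*c2*q^(M+y+2))*(c1*c4*q^(M+y+2))*h

lemma Main00 (q c0 c1 c2 c3 c4 : ℂ) (N x y : ℕ) (g : G q c0 c1 c2 c3 c4 N) : Main q c0 c1 c2 c3 c4 N 0 0 x y := by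
  rcases Nat.lt_or_ge N (x+y) with hxy | hxy
  · exact Main_triv _ _ _ _ _ _ _ _ _ _ _ hxy
  obtain ⟨M, rfl⟩ : ∃ M, N = M+y := ⟨N-y, by omega⟩
  have h := Tx y q c0 c1 c2 x M c3 c4 (by omega) g
  unfold Main
  rw [Sm00 q c0 c1 c2 c3 c4 M y x (by omega) g]
  have s04 : 1-c4*c0*q ≠ 0 := by simpa using (g.get 1 0 0 0 1 (c := c4*c0) (by ring) le_rfl).ne 1 (by omega) (by omega)
  have s12 : 1-c1*c2*q ≠ 0 := by simpa using (g.get 0 1 1 0 0 (c := c1*c2) (by ring) le_rfl).ne 1 (by omega) (by omega)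
  have pq := pne1 g.s1 (M+y) le_rfl
  have pq' := pne1 g.s1 (M+y-x) (by omega)
  rw [mul_one] at pq pq'
  unfold Rm
  rw [Nat.sub_zero, Q_zero q c3 c4 c0 (M+y) x (by omega) pq s04, Q_zero q c0 c1 c2 (M+y-x) y (by omega) pq' s12]
  have n1 := pne (g.get 1 0 0 0 1 (c := c0*c4) (by ring) le_rfl) 2 (M+y) (by omega) (by omega)
  have n2 := pne (g.get 0 1 1 0 0 (c := c1*c2) (by ring) le_rfl) 2 (M+y) (by omega) (by omega)
  have n3 := pne (g.get 0 1 1 0 0 (c := c1*c2) (by ring) le_rfl) 2 (M+y-x) (by omega) (by omega)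
  unfold wL wR
  rw [mul_comm c4 c0]
  simp only [poch_zero', pow_zero]
  generalize poch q (c1*c2*q^2) (M+y) = d1 at *
  generalize poch q (c1*c2*q^2) (M+y-x) = d2 at *
  generalize poch q (c0*c4*q^2) (M+y) = d3 at *
  generalize T q c0 c1 c2 c3 c4 M y x = t at *
  generalize (c1*c4*q^(M+y+1))^(M+y) = w1 at *
  generalize (c1*c4*q^(M+y+1))^y = w2 at *
  generalize (c1*c2*c4*q^(M+y+2))^x = w3 at *
  generalize poch q (q*c0) (M+y-x) = p1 at *
  rw [div_mul_eq_mul_div, div_mul_eq_mul_div, div_mul_div_comm, div_mul_eq_mul_div, div_eq_div_iff n2 (mul_ne_zero n1 n3)]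
  linear_combination poch q (q*c3) (M+y)*h

lemma Main_all (q : ℂ) : ∀ (N : ℕ) (c0 c1 c2 c3 c4 : ℂ) (i j x y : ℕ) (_ : i+j ≤ N) (_ : G q c0 c1 c2 c3 c4 N), Main q c0 c1 c2 c3 c4 N i j x y := by
  intro N
  induction N with
  | zero =>
    intro c0 c1 c2 c3 c4 i j x y hij g
    obtain rfl : i = 0 := by omega
    obtain rfl : j = 0 := by omega
    exact Main00 q c0 c1 c2 c3 c4 0 x y g
  | succ N ih =>
    intro c0 c1 c2 c3 c4 i j x y hij g
    rcases j with _ | j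
    · rcases i with _ | i
      · exact Main00 q c0 c1 c2 c3 c4 _ x y g
      · exact I_step q c0 c1 c2 c3 c4 N i x y g (by omega) (fun x y => ih _ _ _ _ _ _ _ _ _ (by omega) (g.down 0 1 1 0 0 (by ring) (by ring) (by ring) (by ring) (by ring)))
    · exact J_step q c0 c1 c2 c3 c4 N i j x y g (by omega) (fun x y => ih _ _ _ _ _ _ _ _ _ (by omega) (g.down 1 0 0 0 1 (by ring) (by ring) (by ring) (by ring) (by ring)))
end BE

namespace BE
open qR Finset

lemma p_eq (q s a b c tb : ℂ) (M n x : ℕ) (hs : s^2 = q) (hb : tb^2 = b) (h : s*tb ≠ 0) :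
    p q s a b c tb (M:ℤ) (n:ℤ) (x:ℤ) = Q q a b c M n x * (poch q (q*b) n/poch q (q*c) n) * ((s*tb)^M*((q*b)⁻¹)^n) := by
  by_cases hh : n ≤ M ∧ x ≤ M
  · have hi : (0:ℤ) ≤ n ∧ (n:ℤ) ≤ M ∧ (0:ℤ) ≤ x ∧ (x:ℤ) ≤ M := by omega
    rw [p, if_pos hi, Q_eq hh.1 hh.2]
    have e1 : ((M:ℤ)-(n:ℤ)).toNat = M-n := by omega
    have e2 : ((M:ℤ)+1).toNat = M+1 := by omega
    have z1 : q^(2*(n:ℤ)+1) = q^(2*n+1) := by rw [← zpow_natCast]; push_cast; rfl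
    have z2 : q^((M:ℤ)+2) = q^(M+2) := by rw [← zpow_natCast]; push_cast; rfl
    have z3 : ∀ n : ℕ, q^((n:ℤ)+1) = q^(n+1) := by intro n; rw [← zpow_natCast]; push_cast; rfl
    have z4 : ∀ n : ℕ, q^(-(n:ℤ)) = (q^n)⁻¹ := by intro n; rw [zpow_neg, zpow_natCast]
    have z5 : (s*tb)^(2*(n:ℤ)-(M:ℤ)) = (q*b)^n/(s*tb)^M := by
      rw [zpow_sub₀ h, zpow_mul, zpow_natCast, zpow_natCast, ← hs, ← hb]
      congr 2
      norm_cast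
      ring
    have hF : (∑ k ∈ Finset.range ((n:ℤ).toNat + 1),
        poch q (q ^ (-(n:ℤ))) k * poch q (b * c * q ^ ((n:ℤ) + 1)) k * poch q (q ^ (-(x:ℤ))) k
            * poch q (a * b * q ^ ((x:ℤ) + 1)) k * q ^ k
          / (poch q (q * b) k * poch q (a * b * c * q ^ ((M:ℤ) + 2)) k
              * poch q (q ^ (-(M:ℤ))) k * poch q q k)) = F q a b c M n x := by
      simp only [z2, z3, z4, Int.toNat_natCast]
      rfl
    rw [hF]
    unfold Om binom Om0
    rw [if_pos ⟨hi.1, hi.2.1⟩]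
    simp only [e1, e2, z1, z2, z3, z5, Int.toNat_natCast]
    generalize poch q (b*c*q^(n+1)) (M+1) = D
    generalize poch q (q*c) n = D'
    generalize poch q q n * poch q q (M-n) = D''
    simp only [div_eq_mul_inv, mul_inv, inv_inv, inv_pow]
    ring
  · have hi : ¬((0:ℤ) ≤ n ∧ (n:ℤ) ≤ M ∧ (0:ℤ) ≤ x ∧ (x:ℤ) ≤ M) := by omega
    rw [p, if_neg hi, Q, if_neg hh]; ring

lemma psub {u : ℂ} (hu : u ≠ 0) {N d : ℕ} (h : d ≤ N) : u^(N-d) = u^N*(u⁻¹)^d := by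
  rw [inv_pow, pow_sub₀ u hu h]

lemma xi_eq (q a b ta tb : ℂ) (n : ℕ) : xi q a b ta tb (n:ℤ) = poch q (q*a) n/poch q (q*b) n*(tb/ta)^n := by
  simp [xi]

lemma fin_aux (Sv Rv Wi Wj Wx Wy WN I' J' X' U V P0j P2i P0y P3x P4j P1i P1y P4x : ℂ)
    (h0 : P0j ≠ 0) (h2 : P2i ≠ 0) (h1 : P1y ≠ 0) (h4 : P4x ≠ 0) (hW : WN ≠ 0)
    (hUV : U*WN = V)
    (h : Sv*(Wi*Wj*Wx*Wy*P0j*P2i*P0y*P3x) = Rv*(P4j*P1i*P1y*P4x*WN)) :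
    Sv*((I'*Wi)*(J'*Wj)*(X'*Wx)*Wy*U)*(P0y/P1y*(P3x/P4x)) = Rv*(V*I'*J'*X')*(P4j/P0j*(P1i/P2i)) := by
  rw [← hUV, div_mul_div_comm, div_mul_div_comm, mul_div_assoc', mul_div_assoc', div_eq_div_iff (by positivity) (by positivity)]
  linear_combination I'*J'*X'*U*h

lemma G_mk (N : ℕ) (q c1 c2 c3 c4 c0 : ℂ)
    (hq : q ≠ 0) (hc1 : c1 ≠ 0) (hc2 : c2 ≠ 0) (hc3 : c3 ≠ 0) (hc4 : c4 ≠ 0)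
    (hc0 : c0 = (q ^ (2 * (N : ℤ) + 3) * c1 * c2 * c3 * c4)⁻¹)
    (hgen : ∀ e0 e1 e2 e3 e4 : ℕ, e0 ≤ 1 → e1 ≤ 1 → e2 ≤ 1 → e3 ≤ 1 → e4 ≤ 1 →
      1 ≤ e0 + e1 + e2 + e3 + e4 → e0 + e1 + e2 + e3 + e4 ≤ 4 →
      ∀ k : ℤ, 1 ≤ k → k ≤ 2 * (N : ℤ) + 5 →
        c0 ^ e0 * c1 ^ e1 * c2 ^ e2 * c3 ^ e3 * c4 ^ e4 ≠ q ^ (-k))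
    (hq1 : ∀ k : ℕ, 1 ≤ k → k ≤ N → q ^ k ≠ 1) : G q c0 c1 c2 c3 c4 N := by
  have z : q^(2*(N:ℤ)+3) = q^(2*N+3) := by rw [← zpow_natCast]; push_cast; rfl
  rw [z] at hc0
  refine ⟨hq, ?_, hc1, hc2, hc3, hc4, ?_, ?_, ?_⟩
  · rw [hc0]; positivity
  · rw [hc0]; field_simp
  · intro k h1 h2; rw [one_mul]; exact hq1 k h1 h2
  · intro e0 e1 e2 e3 e4 a0 a1 a2 a3 a4 a5 a6 k h1 h2 h
    refine hgen e0 e1 e2 e3 e4 a0 a1 a2 a3 a4 a5 a6 k (by omega) (by omega) ?_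
    rw [zpow_neg, zpow_natCast]
    exact eq_inv_of_mul_eq_one_left h

lemma term_eq (N : ℕ) (q s c1 c2 c3 c4 c0 t1 t2 t3 t4 t0 : ℂ) (i j x y a : ℕ) (hj : j ≤ N) (hy : y ≤ N) (ha : a ≤ N)
    (hs : s ^ 2 = q) (ht0 : t0^2 = c0) (ht2 : t2 ^ 2 = c2) (ht3 : t3 ^ 2 = c3)
    (ns : s ≠ 0) (n0 : t0 ≠ 0) (n2 : t2 ≠ 0) (n3 : t3 ≠ 0) (Al I J X Y Wi Wj Wa : ℂ)
    (hA : Al = (s*t0)⁻¹*(q*c3)⁻¹*(t1/t4)*(t3/t2))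
    (hI : I = (q*c2)⁻¹*(t0/t3)*(t2/t1))
    (hJ : J = (s*t2)⁻¹*(q*c0)⁻¹*(t3/t1)*(t0/t4))
    (hX : X = (t2/t0)*(t4/t3))
    (hY : Y = (s*t3)⁻¹*(t4/t2)*(t1/t0))
    (hWi : poch q (q*c2) i/poch q (q*c1) i*(poch q (q*c1) i/poch q (q*c2) i) = Wi)
    (hWj : poch q (q*c0) j/poch q (q*c4) j*(poch q (q*c4) j/poch q (q*c0) j) = Wj)
    (hWa : poch q (q*c3) a/poch q (q*c2) a*(poch q (q*c2) a/poch q (q*c3) a) = Wa) :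
    p q s c3 c2 c1 t2 ((N : ℤ) - (j : ℤ)) (i : ℤ) (a : ℤ)
          * p q s c1 c0 c4 t0 ((N : ℤ) - (a : ℤ)) (j : ℤ) (y : ℤ)
          * p q s c4 c3 c2 t3 ((N : ℤ) - (y : ℤ)) (a : ℤ) (x : ℤ)
          * ((t0 / t3) ^ i * (t3 / t1) ^ j * (t1 / t4) ^ a * (t4 / t2) ^ y * (t2 / t0) ^ x)
          * xi q c1 c2 t1 t2 (i : ℤ) * xi q c4 c0 t4 t0 (j : ℤ)
          * xi q c2 c3 t2 t3 (a : ℤ) * xi q c0 c1 t0 t1 (y : ℤ)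
          * xi q c3 c4 t3 t4 (x : ℤ)
    = Q q c3 c2 c1 (N-j) i a * (Q q c1 c0 c4 (N-a) j y * Q q c4 c3 c2 (N-y) a x) * Al^a
      *(Wi*Wj*Wa)*((I^i*J^j*X^x*Y^y*(s*t2*(s*t0)*(s*t3))^N)*(poch q (q*c0) y/poch q (q*c1) y*(poch q (q*c3) x/poch q (q*c4) x))) := by
  rw [← Nat.cast_sub hj, ← Nat.cast_sub hy, ← Nat.cast_sub ha, p_eq q s c3 c2 c1 t2 _ _ _ hs ht2 (by positivity),
    p_eq q s c1 c0 c4 t0 _ _ _ hs ht0 (by positivity), p_eq q s c4 c3 c2 t3 _ _ _ hs ht3 (by positivity),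
    psub (u := s*t2) (by positivity) hj, psub (u := s*t0) (by positivity) ha, psub (u := s*t3) (by positivity) hy]
  simp only [xi_eq]
  rw [← hWi, ← hWj, ← hWa, hA, hI, hJ, hX, hY]
  generalize poch q (q*c2) i/poch q (q*c1) i = r1
  generalize poch q (q*c1) i/poch q (q*c2) i = r2
  generalize poch q (q*c0) j/poch q (q*c4) j = r3
  generalize poch q (q*c4) j/poch q (q*c0) j = r4
  generalize poch q (q*c3) a/poch q (q*c2) a = r5
  generalize poch q (q*c2) a/poch q (q*c3) a = r6
  generalize poch q (q*c0) y/poch q (q*c1) y = r7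
  generalize poch q (q*c3) x/poch q (q*c4) x = r8
  generalize Q q c3 c2 c1 (N-j) i a = Q1
  generalize Q q c1 c0 c4 (N-a) j y = Q2
  generalize Q q c4 c3 c2 (N-y) a x = Q3
  simp only [mul_pow]
  generalize (t0/t3)^i = a1
  generalize (t3/t1)^j = a2
  generalize (t1/t4)^a = a3
  generalize (t4/t2)^y = a4
  generalize (t2/t0)^x = a5
  generalize (t2/t1)^i = a6
  generalize (t0/t4)^j = a7
  generalize (t3/t2)^a = a8
  generalize (t1/t0)^y = a9
  generalize (t4/t3)^x = a10
  generalize (q*c2)⁻¹^i = b1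
  generalize (q*c0)⁻¹^j = b2
  generalize (q*c3)⁻¹^a = b3
  generalize (s*t2)⁻¹^j = b4
  generalize (s*t0)⁻¹^a = b5
  generalize (s*t3)⁻¹^y = b6
  ring

lemma rt (s t0 t1 t2 t3 t4 E : ℂ) (ns : s ≠ 0) (n0 : t0 ≠ 0) (n1 : t1 ≠ 0) (n2 : t2 ≠ 0) (n3 : t3 ≠ 0) (n4 : t4 ≠ 0)
    (h : E*s^3*t0*t1*t2*t3*t4 = 1) :
    t1^2*E = (s*t0)⁻¹*(s^2*t3^2)⁻¹*(t1/t4)*(t3/t2) ∧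
    (s^2*t1^2)⁻¹*(s*t4)⁻¹*(t0^2*t1^2*t4^2*(E*s^4)) = (s^2*t2^2)⁻¹*(t0/t3)*(t2/t1) ∧
    (s^2*t4^2)⁻¹*(t3^2*t4^2*(E*s^2)) = (s*t2)⁻¹*(s^2*t0^2)⁻¹*(t3/t1)*(t0/t4) ∧
    (s*t1)⁻¹*(t1^2*t2^2*t4^2*(E*s^4)) = (t2/t0)*(t4/t3) ∧
    (t1^2*t4^2*(E*s^2)) = (s*t3)⁻¹*(t4/t2)*(t1/t0) ∧
    s*t2*(s*t0)*(s*t3)*(t1^2*t4^2*(E*s^2)) = s*t4*(s*t1) := by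
  refine ⟨?_, ?_, ?_, ?_, ?_, ?_⟩
  · field_simp
    linear_combination h
  · field_simp
    linear_combination h
  · field_simp
    linear_combination h
  · field_simp
    linear_combination h
  · field_simp
    linear_combination h
  · linear_combination s^2*t1*t4*h
end BE

/-- Biedenharn-Elliot relation for the normalized q-Racah polynomials. -/
theorem qRacah_biedenharn_elliot
    (N : ℕ) (q s c1 c2 c3 c4 c0 t1 t2 t3 t4 t0 : ℂ)
    (hq : q ≠ 0) (hc1 : c1 ≠ 0) (hc2 : c2 ≠ 0) (hc3 : c3 ≠ 0) (hc4 : c4 ≠ 0)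
    (hs : s ^ 2 = q) (ht1 : t1 ^ 2 = c1) (ht2 : t2 ^ 2 = c2) (ht3 : t3 ^ 2 = c3)
    (ht4 : t4 ^ 2 = c4)
    (hc0 : c0 = (q ^ (2 * (N : ℤ) + 3) * c1 * c2 * c3 * c4)⁻¹)
    (ht0 : t0 = (s ^ (2 * (N : ℤ) + 3) * t1 * t2 * t3 * t4)⁻¹)
    (hgen : ∀ e0 e1 e2 e3 e4 : ℕ, e0 ≤ 1 → e1 ≤ 1 → e2 ≤ 1 → e3 ≤ 1 → e4 ≤ 1 →
      1 ≤ e0 + e1 + e2 + e3 + e4 → e0 + e1 + e2 + e3 + e4 ≤ 4 →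
      ∀ k : ℤ, 1 ≤ k → k ≤ 2 * (N : ℤ) + 5 →
        c0 ^ e0 * c1 ^ e1 * c2 ^ e2 * c3 ^ e3 * c4 ^ e4 ≠ q ^ (-k))
    (hq1 : ∀ k : ℕ, 1 ≤ k → k ≤ N → q ^ k ≠ 1)
    (i j x y : ℕ) (hij : i + j ≤ N) (hxy : x + y ≤ N) :
    ∑ a ∈ Finset.range (min (N - j) (N - y) + 1),
        qR.p q s c3 c2 c1 t2 ((N : ℤ) - (j : ℤ)) (i : ℤ) (a : ℤ)
          * qR.p q s c1 c0 c4 t0 ((N : ℤ) - (a : ℤ)) (j : ℤ) (y : ℤ)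
          * qR.p q s c4 c3 c2 t3 ((N : ℤ) - (y : ℤ)) (a : ℤ) (x : ℤ)
          * ((t0 / t3) ^ i * (t3 / t1) ^ j * (t1 / t4) ^ a * (t4 / t2) ^ y * (t2 / t0) ^ x)
          * qR.xi q c1 c2 t1 t2 (i : ℤ) * qR.xi q c4 c0 t4 t0 (j : ℤ)
          * qR.xi q c2 c3 t2 t3 (a : ℤ) * qR.xi q c0 c1 t0 t1 (y : ℤ)
          * qR.xi q c3 c4 t3 t4 (x : ℤ)
      = qR.p q s c3 c4 c0 t4 ((N : ℤ) - (i : ℤ)) (j : ℤ) (x : ℤ)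
          * qR.p q s c0 c1 c2 t1 ((N : ℤ) - (x : ℤ)) (i : ℤ) (y : ℤ) := by
  have g := BE.G_mk N q c1 c2 c3 c4 c0 hq hc1 hc2 hc3 hc4 hc0 hgen hq1
  have ns : s ≠ 0 := by rintro rfl; apply hq; rw [← hs]; simp
  have n1 : t1 ≠ 0 := by rintro rfl; apply hc1; rw [← ht1]; simp
  have n2 : t2 ≠ 0 := by rintro rfl; apply hc2; rw [← ht2]; simp
  have n3 : t3 ≠ 0 := by rintro rfl; apply hc3; rw [← ht3]; simp
  have n4 : t4 ≠ 0 := by rintro rfl; apply hc4; rw [← ht4]; simp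
  have zs : s^(2*(N:ℤ)+3) = s^(2*N+3) := by rw [← zpow_natCast]; push_cast; rfl
  have zq : q^(2*(N:ℤ)+3) = q^(2*N+3) := by rw [← zpow_natCast]; push_cast; rfl
  rw [zs] at ht0
  have n0 : t0 ≠ 0 := by rw [ht0]; positivity
  have h0 : t0^2 = c0 := by
    rw [hc0, ht0, zq, ← hs, ← ht1, ← ht2, ← ht3, ← ht4, inv_pow]
    congr 1
    ring
  have hE : q^N*s^3*t0*t1*t2*t3*t4 = 1 := by
    have : q^N*s^3 = s^(2*N+3) := by rw [← hs]; ring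
    rw [this, ht0]
    field_simp
  obtain ⟨r1, r2, r3, r4, r5, r6⟩ := BE.rt s t0 t1 t2 t3 t4 (q^N) ns n0 n1 n2 n3 n4 hE
  simp only [hs, h0, ht1, ht2, ht3, ht4] at r1 r2 r3 r4 r5 r6
  have e4 : q^N*s^4 = q^(N+2) := by rw [← hs]; ring
  have e2 : q^N*q = q^(N+1) := by ring
  rw [e4] at r2 r4
  rw [e2] at r3 r5 r6
  have m := BE.Main_all q N c0 c1 c2 c3 c4 i j x y hij g
  have P0 := fun k hk => BE.pne1 (g.get 1 0 0 0 0 (c := c0) (by ring) le_rfl) k hk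
  have P1 := fun k hk => BE.pne1 (g.get 0 1 0 0 0 (c := c1) (by ring) le_rfl) k hk
  have P2 := fun k hk => BE.pne1 (g.get 0 0 1 0 0 (c := c2) (by ring) le_rfl) k hk
  have P3 := fun k hk => BE.pne1 (g.get 0 0 0 1 0 (c := c3) (by ring) le_rfl) k hk
  have P4 := fun k hk => BE.pne1 (g.get 0 0 0 0 1 (c := c4) (by ring) le_rfl) k hk
  have ca : ∀ u v : ℂ, u ≠ 0 → v ≠ 0 → u/v*(v/u) = 1 := by
    intro u v hu hv
    field_simp
  have hL := fun a (ha : a ≤ N) => BE.term_eq N q s c1 c2 c3 c4 c0 t1 t2 t3 t4 t0 i j x y a (by omega) (by omega) ha hs h0 ht2 ht3 ns n0 n2 n3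
    _ _ _ _ _ 1 1 1 r1 r2 r3 r4 r5 (ca _ _ (P2 i (by omega)) (P1 i (by omega))) (ca _ _ (P0 j (by omega)) (P4 j (by omega)))
    (ca _ _ (P3 a (by omega)) (P2 a (by omega)))
  rw [Finset.sum_congr rfl (fun a ha => hL a (by rw [Finset.mem_range] at ha; omega)), ← Finset.sum_mul]
  simp only [mul_one]
  have hS : ∑ a ∈ Finset.range (min (N - j) (N - y) + 1), BE.Q q c3 c2 c1 (N-j) i a * (BE.Q q c1 c0 c4 (N-a) j y * BE.Q q c4 c3 c2 (N-y) a x) * (c1*q^N)^a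
      = BE.Sm q c0 c1 c2 c3 c4 N i j x y := by
    unfold BE.Sm
    apply Finset.sum_subset (Finset.range_subset_range.2 (by omega))
    intro a _ ha
    rw [Finset.mem_range] at ha
    rcases Nat.lt_or_ge (N-j) a with h | h
    · rw [BE.Q_x (N := N-j) (x := a) h]; ring
    · rw [BE.Q_n (N := N-y) (n := a) (by omega)]; ring
  rw [hS]
  rw [← Nat.cast_sub (show i ≤ N by omega), ← Nat.cast_sub (show x ≤ N by omega),
    BE.p_eq q s c3 c4 c0 t4 _ _ _ hs ht4 (by positivity), BE.p_eq q s c0 c1 c2 t1 _ _ _ hs ht1 (by positivity),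
    BE.psub (u := s*t4) (by positivity) (show i ≤ N by omega), BE.psub (u := s*t1) (by positivity) (show x ≤ N by omega)]
  unfold BE.Main BE.wL BE.wR BE.Rm at m
  have f := BE.fin_aux _ _ _ _ _ _ _ (((q*c1)⁻¹*(s*t4)⁻¹)^i) (((q*c4)⁻¹)^j) (((s*t1)⁻¹)^x) ((s*t2*(s*t0)*(s*t3))^N) ((s*t4*(s*t1))^N) _ _ _ _ _ _ _ _
    (P0 j (by omega)) (P2 i (by omega)) (P1 y (by omega)) (P4 x (by omega)) (by positivity)
    (by rw [← r6, mul_pow _ (c1*c4*q^(N+1))]) m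
  rw [mul_pow ((q*c1)⁻¹*(s*t4)⁻¹) _ i, mul_pow ((q*c4)⁻¹) _ j, mul_pow ((s*t1)⁻¹) _ x, ← mul_assoc, f, mul_pow ((q*c1)⁻¹) _ i, mul_pow (s*t4) _ N]
  generalize BE.Q q c3 c4 c0 (N-i) j x = Q1
  generalize BE.Q q c0 c1 c2 (N-x) i y = Q2
  generalize qR.poch q (q*c4) j/qR.poch q (q*c0) j = b1
  generalize qR.poch q (q*c1) i/qR.poch q (q*c2) i = b2
  generalize (q*c1)⁻¹^i = a1
  generalize (s*t4)⁻¹^i = a2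
  generalize (q*c4)⁻¹^j = a3
  generalize (s*t1)⁻¹^x = a4
  ring
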